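/- arXiv:1707.06536 — 2 statements merged into one kernel-verified Lean document; each statement's English description precedes it below -/
import Mathlib

section
/- Let R be a Noetherian ring, 𝔞 an ideal, M a nonzero finitely generated faithful R-module of finite dimension c with cd(𝔞, M) = c. Then Ann_R(H^c_𝔞(M)) = 0 if and only if Ass_R(R) = Att_R(H^c_𝔞(M)). -/
open CategoryTheory

/-- `HasCD a M c` : the cohomological dimension of `M` with respect to `a` is `c`,
i.e. `H^c_a(M) ≠ 0` and `H^i_a(M) = 0` for all `i > c`. -/
def HasCD {R : Type} [CommRing R] (a : Ideal R) (M : ModuleCat R) (c : ℕ) : Prop :=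
  Nontrivial ((localCohomology a c).obj M) ∧
    ∀ i, c < i → Subsingleton ((localCohomology a i).obj M)

/-- The attached primes of an `R`-module `A`: primes of the form `Ann_R(A/B)`. -/
def attachedPrimes (R : Type) [CommRing R] (A : Type) [AddCommGroup A] [Module R A] :
    Set (Ideal R) :=
  {p | p.IsPrime ∧ ∃ B : Submodule R A, p = Module.annihilator R (A ⧸ B)}

open CategoryTheory

namespace LCP
open Opposite

universe u
variable {R : Type u} [CommRing R]

noncomputable section

abbrev yF (Y : ModuleCat.{u} R) : ModuleCat.{u} R ⥤ (ModuleCat.{u} R)ᵒᵖ :=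
  ((linearYoneda R (ModuleCat.{u} R)).obj Y).rightOp

abbrev yK {X : ModuleCat.{u} R} (P : ProjectiveResolution X) (Y : ModuleCat.{u} R) :
    ChainComplex (ModuleCat.{u} R)ᵒᵖ ℕ :=
  ((yF Y).mapHomologicalComplex _).obj P.complex

abbrev oExt (X Y : ModuleCat.{u} R) (n : ℕ) : ModuleCat.{u} R :=
  ((Ext R (ModuleCat.{u} R) n).obj (op X)).obj Y

def dIso {X : ModuleCat.{u} R} (P : ProjectiveResolution X) (Y : ModuleCat.{u} R) (n : ℕ) :
    ((yK P Y).homology n).unop ≅ oExt X Y n :=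
  (P.isoLeftDerivedObj (yF Y) n).unop

def clsπ {X : ModuleCat.{u} R} (P : ProjectiveResolution X) (Y : ModuleCat.{u} R) (n : ℕ) :
    ((yK P Y).opcycles n).unop ⟶ oExt X Y n :=
  ((yK P Y).homologyι n).unop ≫ (dIso P Y n).hom

def clsι {X : ModuleCat.{u} R} (P : ProjectiveResolution X) (Y : ModuleCat.{u} R) (n : ℕ) :
    ((yK P Y).opcycles n).unop ⟶ ModuleCat.of R (P.complex.X n ⟶ Y) :=
  ((yK P Y).pOpcycles n).unop

lemma clsι_inj {X : ModuleCat.{u} R} (P : ProjectiveResolution X) (Y : ModuleCat.{u} R) (n : ℕ) :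
    Function.Injective (clsι P Y n) := by
  rw [← ModuleCat.mono_iff_injective]
  exact unop_mono_of_epi ((yK P Y).pOpcycles n)

lemma clsπ_surj {X : ModuleCat.{u} R} (P : ProjectiveResolution X) (Y : ModuleCat.{u} R) (n : ℕ) :
    Function.Surjective (clsπ P Y n) := by
  rw [← ModuleCat.epi_iff_surjective]
  have : Epi ((yK P Y).homologyι n).unop := unop_epi_of_mono ((yK P Y).homologyι n)
  unfold clsπ
  infer_instance

lemma clsι_range {X : ModuleCat.{u} R} (P : ProjectiveResolution X) (Y : ModuleCat.{u} R) (n : ℕ)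
    (z : P.complex.X n ⟶ Y) :
    (∃ ζ, clsι P Y n ζ = z) ↔ P.complex.d (n+1) n ≫ z = 0 := by
  have hc : Limits.IsColimit (Limits.CokernelCofork.ofπ ((yK P Y).pOpcycles n) ((yK P Y).d_pOpcycles (n+1) n)) :=
    (yK P Y).opcyclesIsCokernel (n+1) n (by simp)
  let S : ShortComplex (ModuleCat.{u} R)ᵒᵖ :=
    ShortComplex.mk ((yK P Y).d (n+1) n) ((yK P Y).pOpcycles n) ((yK P Y).d_pOpcycles (n+1) n)
  have hS : S.Exact := ShortComplex.exact_of_g_is_cokernel S hc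
  have hS' := hS.unop
  rw [ShortComplex.moduleCat_exact_iff] at hS'
  constructor
  · rintro ⟨ζ, rfl⟩
    have := congrArg (fun f : _ ⟶ ((yK P Y).X (n+1)).unop => f.hom ζ) (congrArg Quiver.Hom.unop ((yK P Y).d_pOpcycles (n+1) n))
    exact this
  · intro h
    exact hS' z h

lemma clsπ_ker {X : ModuleCat.{u} R} (P : ProjectiveResolution X) (Y : ModuleCat.{u} R) (n : ℕ)
    (ζ) : clsπ P Y (n+1) ζ = 0 ↔ ∃ w : P.complex.X n ⟶ Y, clsι P Y (n+1) ζ = P.complex.d (n+1) n ≫ w := by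
  have hS : (ShortComplex.mk ((yK P Y).homologyι (n+1)) ((yK P Y).fromOpcycles (n+1) n) (by simp)).Exact := 
    (ShortComplex.exact_of_f_is_kernel _ ((yK P Y).homologyIsKernel (n+1) n (by simp)))
  have hS' := hS.unop
  rw [ShortComplex.moduleCat_exact_iff] at hS'
  have h1 : clsπ P Y (n+1) ζ = 0 ↔ ((yK P Y).homologyι (n+1)).unop ζ = 0 := by
    unfold clsπ
    rw [ModuleCat.comp_apply]
    refine ⟨fun h => ?_, fun h => by rw [h, map_zero]⟩
    have : Function.Injective ((dIso P Y (n+1)).hom) := by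
      rw [← ModuleCat.mono_iff_injective]; infer_instance
    exact this (by rw [h, map_zero])
  have h2 : ∀ w : P.complex.X n ⟶ Y, 
    clsι P Y (n+1) (((yK P Y).fromOpcycles (n+1) n).unop w) = P.complex.d (n+1) n ≫ w := by
    intro w
    have := congrArg (fun f : ((yK P Y).X n).unop ⟶ ((yK P Y).X (n+1)).unop => f.hom w) (congrArg Quiver.Hom.unop ((yK P Y).p_fromOpcycles (n+1) n))
    exact this
  rw [h1]
  constructor
  · intro h
    obtain ⟨w, hw⟩ := hS' ζ h
    refine ⟨w, ?_⟩
    rw [← h2 w]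
    exact congrArg _ hw.symm
  · rintro ⟨w, hw⟩
    rw [← h2] at hw
    rw [clsι_inj P Y _ hw]
    have := congrArg (fun f : ((yK P Y).X n).unop ⟶ ((yK P Y).homology (n+1)).unop => f.hom w) (congrArg Quiver.Hom.unop ((yK P Y).homologyι_comp_fromOpcycles (n+1) n))
    exact this

lemma clsπ_zero_inj {X : ModuleCat.{u} R} (P : ProjectiveResolution X) (Y : ModuleCat.{u} R) :
    Function.Injective (clsπ P Y 0) := by
  rw [← ModuleCat.mono_iff_injective]
  unfold clsπ
  have : IsIso ((yK P Y).homologyι 0) := 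
    (yK P Y).isIso_homologyι 0 _ rfl (by simp)
  have : Mono ((yK P Y).homologyι 0).unop := unop_mono_of_epi ((yK P Y).homologyι 0)
  infer_instance
end
end LCP

open CategoryTheory
namespace LCP
open Opposite
universe u
variable {R : Type u} [CommRing R]
noncomputable section

lemma cls_map_right {X : ModuleCat.{u} R} (P : ProjectiveResolution X) {Y Y' : ModuleCat.{u} R} (g : Y ⟶ Y') (n : ℕ)
    (ζ) : ∃ ζ', clsι P Y' n ζ' = clsι P Y n ζ ≫ g ∧ 
      clsπ P Y' n ζ' = (((Ext R (ModuleCat.{u} R) n).obj (op X)).map g) (clsπ P Y n ζ) := by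
  let α : yF Y' ⟶ yF Y := NatTrans.rightOp ((linearYoneda R (ModuleCat.{u} R)).map g)
  let ψ : yK P Y' ⟶ yK P Y := (NatTrans.mapHomologicalComplex α _).app P.complex
  have h1 := HomologicalComplex.p_opcyclesMap ψ n
  have h2 := HomologicalComplex.homologyι_naturality ψ n
  have h3 : (((Ext R (ModuleCat.{u} R) n).obj (op X)).map g) = (dIso P Y n).inv ≫ 
      (HomologicalComplex.homologyMap ψ n).unop ≫ (dIso P Y' n).hom := by
    have := congrArg Quiver.Hom.unop (P.leftDerived_app_eq α n)
    refine Eq.trans (show _ = ((NatTrans.leftDerived α n).app X).unop from rfl) ?_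
    rw [this]
    rw [unop_comp, unop_comp, Category.assoc]
    rfl
  have h2' : (HomologicalComplex.opcyclesMap ψ n).unop ≫ clsπ P Y' n = 
    clsπ P Y n ≫ (((Ext R (ModuleCat.{u} R) n).obj (op X)).map g) := by
    rw [h3]
    have h2' := congrArg Quiver.Hom.unop h2
    rw [unop_comp, unop_comp] at h2'
    unfold clsπ
    rw [← Category.assoc, ← h2']
    simp
  refine ⟨(HomologicalComplex.opcyclesMap ψ n).unop ζ, ?_, ?_⟩
  · exact (congrArg (fun f : ((yK P Y).opcycles n).unop ⟶ ((yK P Y').X n).unop => f.hom ζ) (congrArg Quiver.Hom.unop h1))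
  · exact congrArg (fun f => f.hom ζ) h2'

lemma cls_map_left {X X' : ModuleCat.{u} R} (P : ProjectiveResolution X) (P' : ProjectiveResolution X')
   (f : X ⟶ X') (φ : P.complex ⟶ P'.complex) (comm : φ.f 0 ≫ P'.π.f 0 = P.π.f 0 ≫ f) (Y : ModuleCat.{u} R) (n : ℕ)
    (ζ) : ∃ ζ', clsι P Y n ζ' = φ.f n ≫ clsι P' Y n ζ ∧ 
      clsπ P Y n ζ' = (((Ext R (ModuleCat.{u} R) n).map f.op).app Y) (clsπ P' Y n ζ) := by
  let ψ : yK P Y ⟶ yK P' Y := ((yF Y).mapHomologicalComplex _).map φ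
  have h1 := HomologicalComplex.p_opcyclesMap ψ n
  have h2 := HomologicalComplex.homologyι_naturality ψ n
  have h3 : (((Ext R (ModuleCat.{u} R) n).map f.op).app Y) = (dIso P' Y n).inv ≫ 
      (HomologicalComplex.homologyMap ψ n).unop ≫ (dIso P Y n).hom := by
    have h := congrArg Quiver.Hom.unop (ProjectiveResolution.isoLeftDerivedObj_hom_naturality f P P' φ comm (yF Y) n)
    rw [unop_comp, unop_comp] at h
    rw [Iso.eq_inv_comp]
    exact h
  have h2' : (HomologicalComplex.opcyclesMap ψ n).unop ≫ clsπ P Y n = 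
    clsπ P' Y n ≫ (((Ext R (ModuleCat.{u} R) n).map f.op).app Y) := by
    rw [h3]
    have h2' := congrArg Quiver.Hom.unop h2
    rw [unop_comp, unop_comp] at h2'
    unfold clsπ
    rw [← Category.assoc, ← h2']
    simp
  refine ⟨(HomologicalComplex.opcyclesMap ψ n).unop ζ, ?_, ?_⟩
  · exact (congrArg (fun f : ((yK P' Y).opcycles n).unop ⟶ ((yK P Y).X n).unop => f.hom ζ) (congrArg Quiver.Hom.unop h1))
  · exact congrArg (fun f => f.hom ζ) h2'
end
end LCP

open CategoryTheory
namespace LCP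
open Opposite
universe u
variable {R : Type u} [CommRing R]
noncomputable section

abbrev nExt (X Y : ModuleCat.{u} R) (n : ℕ) : Type u := Abelian.Ext.{u} X Y n

lemma extMk_zero_inj {X Y : ModuleCat.{u} R} (P : ProjectiveResolution X)
    (f : P.complex.X 0 ⟶ Y) (hf : P.complex.d 1 0 ≫ f = 0)
    (h : (P.extMk f 1 rfl hf : nExt X Y 0) = 0) : f = 0 := by
  rw [← P.extEquivCohomologyClass.apply_eq_iff_eq, ProjectiveResolution.extEquivCohomologyClass_extMk,
    ProjectiveResolution.extEquivCohomologyClass_zero,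
    CochainComplex.HomComplex.CohomologyClass.mk_eq_zero_iff,
    CochainComplex.HomComplex.Cocycle.toSingleMk_mem_coboundaries_iff _ _ _ _ _ 1 (by simp)] at h
  obtain ⟨g, hg⟩ := h
  have hz : Limits.IsZero (P.cochainComplex.X 1) := P.cochainComplex.isZero_of_isStrictlyLE 0 1 (by simp)
  rw [hz.eq_of_src g 0, Limits.comp_zero] at hg
  rw [← cancel_epi (P.cochainComplexXIso (-(0:ℕ)) 0 rfl).hom]
  simpa using hg.symm

def clsN {X : ModuleCat.{u} R} (P : ProjectiveResolution X) (Y : ModuleCat.{u} R) (n : ℕ) :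
    ((yK P Y).opcycles n).unop →ₗ[R] nExt X Y n where
  toFun ζ := P.extMk (clsι P Y n ζ) (n+1) rfl ((clsι_range P Y n _).1 ⟨ζ, rfl⟩)
  map_add' ζ ζ' := by
    rw [ProjectiveResolution.add_extMk]
    congr 1
    exact map_add (clsι P Y n).hom ζ ζ'
  map_smul' r ζ := by
    rw [RingHom.id_apply, Abelian.Ext.smul_eq_comp_mk₀, ProjectiveResolution.extMk_comp_mk₀]
    congr 1
    rw [Linear.comp_smul, Category.comp_id]
    exact map_smul (clsι P Y n).hom r ζ

lemma clsN_surj {X : ModuleCat.{u} R} (P : ProjectiveResolution X) (Y : ModuleCat.{u} R) (n : ℕ) :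
    Function.Surjective (clsN P Y n) := by
  intro e
  obtain ⟨f, hf, rfl⟩ := P.extMk_surjective e (n+1) rfl
  obtain ⟨ζ, rfl⟩ := (clsι_range P Y n f).2 hf
  exact ⟨ζ, rfl⟩

lemma cls_ker_eq {X : ModuleCat.{u} R} (P : ProjectiveResolution X) (Y : ModuleCat.{u} R) (n : ℕ) :
    LinearMap.ker (clsπ P Y n).hom = LinearMap.ker (clsN P Y n) := by
  ext ζ
  rw [LinearMap.mem_ker, LinearMap.mem_ker]
  rcases n with _ | n
  · constructor
    · intro h
      have : ζ = 0 := clsπ_zero_inj P Y (h.trans (map_zero (clsπ P Y 0).hom).symm)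
      rw [this, map_zero]
    · intro h
      have := extMk_zero_inj P _ ((clsι_range P Y 0 _).1 ⟨ζ, rfl⟩) h
      have : ζ = 0 := clsι_inj P Y _ (this.trans (map_zero (clsι P Y 0).hom).symm)
      rw [this, map_zero]
  · refine (clsπ_ker P Y n ζ).trans ?_
    refine Iff.trans ?_ (P.extMk_eq_zero_iff (clsι P Y (n+1) ζ) (n+2) rfl ((clsι_range P Y (n+1) _).1 ⟨ζ, rfl⟩) n rfl).symm
    exact ⟨fun ⟨w, h⟩ => ⟨w, h.symm⟩, fun ⟨w, h⟩ => ⟨w, h.symm⟩⟩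

def cmpP {X : ModuleCat.{u} R} (P : ProjectiveResolution X) (Y : ModuleCat.{u} R) (n : ℕ) :
    oExt X Y n ≃ₗ[R] nExt X Y n :=
  ((clsπ P Y n).hom.quotKerEquivOfSurjective (clsπ_surj P Y n)).symm ≪≫ₗ
    Submodule.quotEquivOfEq _ _ (cls_ker_eq P Y n) ≪≫ₗ
    (clsN P Y n).quotKerEquivOfSurjective (clsN_surj P Y n)

lemma cmpP_cls {X : ModuleCat.{u} R} (P : ProjectiveResolution X) (Y : ModuleCat.{u} R) (n : ℕ) (ζ) :
    cmpP P Y n (clsπ P Y n ζ) = clsN P Y n ζ := by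
  have : clsπ P Y n ζ = ((clsπ P Y n).hom.quotKerEquivOfSurjective (clsπ_surj P Y n)) (Submodule.Quotient.mk ζ) := rfl
  unfold cmpP
  rw [this]
  simp only [LinearEquiv.trans_apply]
  erw [LinearEquiv.symm_apply_apply]
  rfl

def cmp (X Y : ModuleCat.{u} R) (n : ℕ) : oExt X Y n ≃ₗ[R] nExt X Y n :=
  cmpP (projectiveResolution X) Y n

lemma cmp_cls (X Y : ModuleCat.{u} R) (n : ℕ) (ζ) :
    cmp X Y n (clsπ (projectiveResolution X) Y n ζ) = clsN (projectiveResolution X) Y n ζ := by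
  exact cmpP_cls _ _ _ _

lemma cmp_map_right (X : ModuleCat.{u} R) {Y Y' : ModuleCat.{u} R} (g : Y ⟶ Y') (n : ℕ) (e : oExt X Y n) :
    cmp X Y' n ((((Ext R (ModuleCat.{u} R) n).obj (op X)).map g) e) =
      (cmp X Y n e).comp (Abelian.Ext.mk₀ g) (add_zero n) := by
  obtain ⟨ζ, rfl⟩ := clsπ_surj (projectiveResolution X) Y n e
  obtain ⟨ζ', h1, h2⟩ := cls_map_right (projectiveResolution X) g n ζ
  rw [← h2, cmp_cls, cmp_cls]
  unfold clsN
  simp only [LinearMap.coe_mk, AddHom.coe_mk]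
  rw [ProjectiveResolution.extMk_comp_mk₀]
  congr 1

lemma cmp_map_left {X X' : ModuleCat.{u} R} (f : X ⟶ X') (Y : ModuleCat.{u} R) (n : ℕ) (e : oExt X' Y n) :
    cmp X Y n ((((Ext R (ModuleCat.{u} R) n).map f.op).app Y) e) =
      (Abelian.Ext.mk₀ f).comp (cmp X' Y n e) (zero_add n) := by
  obtain ⟨ζ, rfl⟩ := clsπ_surj (projectiveResolution X') Y n e
  have hc : (ProjectiveResolution.lift f (projectiveResolution X) (projectiveResolution X')).f 0 ≫ 
    (projectiveResolution X').π.f 0 = (projectiveResolution X).π.f 0 ≫ f := by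
    exact ProjectiveResolution.lift_commutes_zero f _ _
  obtain ⟨ζ', h1, h2⟩ := cls_map_left (projectiveResolution X) (projectiveResolution X') f 
    (ProjectiveResolution.lift f (projectiveResolution X) (projectiveResolution X')) hc Y n ζ
  rw [← h2, cmp_cls, cmp_cls]
  unfold clsN
  simp only [LinearMap.coe_mk, AddHom.coe_mk]
  rw [ProjectiveResolution.mk₀_comp_extMk _ _ _ _ (R' := projectiveResolution X) 
    ⟨ProjectiveResolution.lift f (projectiveResolution X) (projectiveResolution X'), by simpa using hc⟩]
  congr 1
end
end LCP

open CategoryTheory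
namespace LCP
open Opposite

variable {R : Type} [CommRing R]
noncomputable section

/-- The quotient `R/a^t`. -/
abbrev qm (a : Ideal R) (t : ℕ) : ModuleCat.{0} R := ModuleCat.of R (R ⧸ a ^ t)

def qmap (a : Ideal R) {s t : ℕ} (h : t ≤ s) : qm a s ⟶ qm a t :=
  ModuleCat.ofHom (Submodule.mapQ _ _ LinearMap.id (Ideal.pow_le_pow_right h))

abbrev ldg (a : Ideal R) (i : ℕ) := localCohomology.diagram (localCohomology.idealPowersDiagram a) i

def lcc (a : Ideal R) (i : ℕ) (N : ModuleCat.{0} R) :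
    Limits.Cocone (ldg a i ⋙ (evaluation _ _).obj N) :=
  ((evaluation _ _).obj N).mapCocone (Limits.colimit.cocone (ldg a i))

def lccIs (a : Ideal R) (i : ℕ) (N : ModuleCat.{0} R) : Limits.IsColimit (lcc a i N) :=
  Limits.isColimitOfPreserves ((evaluation _ _).obj N) (Limits.colimit.isColimit (ldg a i))

def lι (a : Ideal R) (i t : ℕ) (N : ModuleCat.{0} R) : oExt (qm a t) N i ⟶ (localCohomology a i).obj N :=
  (lcc a i N).ι.app (op (op t))

def iH (a : Ideal R) (i t : ℕ) (N : ModuleCat.{0} R) :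
    nExt (qm a t) N i →ₗ[R] (localCohomology a i).obj N :=
  (lι a i t N).hom ∘ₗ (cmp (qm a t) N i).symm.toLinearMap

lemma iH_cmp (a : Ideal R) (i t : ℕ) (N : ModuleCat.{0} R) (x : oExt (qm a t) N i) :
    iH a i t N (cmp (qm a t) N i x) = lι a i t N x := by
  unfold iH
  simp only [LinearMap.comp_apply, LinearEquiv.coe_coe, LinearEquiv.symm_apply_apply]

lemma lι_surj (a : Ideal R) (i : ℕ) (N : ModuleCat.{0} R) (z : (localCohomology a i).obj N) :
    ∃ t, ∃ x : oExt (qm a t) N i, lι a i t N x = z := by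
  obtain ⟨⟨⟨t⟩⟩, x, hx⟩ := Limits.Concrete.isColimit_exists_rep _ (lccIs a i N) z
  exact ⟨t, x, hx⟩

lemma iH_surj (a : Ideal R) (i : ℕ) (N : ModuleCat.{0} R) (z : (localCohomology a i).obj N) :
    ∃ t e, iH a i t N e = z := by
  obtain ⟨t, x, hx⟩ := lι_surj a i N z
  exact ⟨t, cmp (qm a t) N i x, (iH_cmp a i t N x).trans hx⟩

lemma qmap_diag (a : Ideal R) (i : ℕ) (N : ModuleCat.{0} R) {s t : ℕ} (h : t ≤ s) :
    (ldg a i ⋙ (evaluation _ _).obj N).map (homOfLE h).op.op = 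
      ((Ext R (ModuleCat.{0} R) i).map (qmap a h).op).app N := rfl

lemma iH_res (a : Ideal R) (i : ℕ) (N : ModuleCat.{0} R) {s t : ℕ} (h : t ≤ s) (e : nExt (qm a t) N i) :
    iH a i s N ((Abelian.Ext.mk₀ (qmap a h)).comp e (zero_add i)) = iH a i t N e := by
  obtain ⟨e, rfl⟩ := (cmp (qm a t) N i).surjective e
  rw [← cmp_map_left]
  unfold iH
  simp only [LinearMap.comp_apply, LinearEquiv.coe_coe, LinearEquiv.symm_apply_apply]
  have := (lcc a i N).w (homOfLE h).op.op
  exact congrArg (fun f => f.hom e) this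

lemma colim_zero {J : Type} [SmallCategory J] [IsFiltered J] (F : J ⥤ ModuleCat.{0} R) (c : Limits.Cocone F)
    (hc : Limits.IsColimit c) (j : J) (x : F.obj j) (hx : c.ι.app j x = 0) :
    ∃ k, ∃ f : j ⟶ k, F.map f x = 0 := by
  have h0 : c.ι.app j x = c.ι.app j 0 := by rw [hx, map_zero]
  obtain ⟨k, f, g, hfg⟩ := (Limits.Concrete.isColimit_rep_eq_iff_exists F hc x _).1 h0
  exact ⟨k, f, by rw [hfg, map_zero]⟩

lemma lι_zero (a : Ideal R) (i : ℕ) (N : ModuleCat.{0} R) {t : ℕ} (x : oExt (qm a t) N i)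
    (hx : lι a i t N x = 0) :
    ∃ s, ∃ h : t ≤ s, (((Ext R (ModuleCat.{0} R) i).map (qmap a h).op).app N) x = 0 := by
  obtain ⟨⟨⟨s⟩⟩, f, hf⟩ := colim_zero _ (lcc a i N) (lccIs a i N) (op (op t)) x hx
  have hs : t ≤ s := leOfHom f.unop.unop
  refine ⟨s, hs, ?_⟩
  have h1 : f = (homOfLE hs).op.op := Subsingleton.elim _ _
  rw [h1, qmap_diag] at hf
  exact hf

lemma iH_zero (a : Ideal R) (i : ℕ) (N : ModuleCat.{0} R) {t : ℕ} (e : nExt (qm a t) N i)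
    (he : iH a i t N e = 0) :
    ∃ s, ∃ h : t ≤ s, (Abelian.Ext.mk₀ (qmap a h)).comp e (zero_add i) = 0 := by
  obtain ⟨x, rfl⟩ := (cmp (qm a t) N i).surjective e
  rw [iH_cmp] at he
  obtain ⟨s, h, hs⟩ := lι_zero a i N x he
  exact ⟨s, h, by rw [← cmp_map_left, hs, map_zero]⟩

lemma iH_map (a : Ideal R) (i t : ℕ) {N N' : ModuleCat.{0} R} (g : N ⟶ N') (e : nExt (qm a t) N i) :
    (localCohomology a i).map g (iH a i t N e) = iH a i t N' (e.comp (Abelian.Ext.mk₀ g) (add_zero i)) := by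
  obtain ⟨e, rfl⟩ := (cmp (qm a t) N i).surjective e
  rw [← cmp_map_right]
  unfold iH
  simp only [LinearMap.comp_apply, LinearEquiv.coe_coe, LinearEquiv.symm_apply_apply]
  have := ((Limits.colimit.ι (ldg a i) (op (op t)))).naturality g
  exact congrArg (fun f => f.hom e) this.symm
end
end LCP

open CategoryTheory
namespace LCP
open Opposite
variable {R : Type} [CommRing R]
noncomputable section

/-- Local cohomology of an unbundled module. -/
def H (a : Ideal R) (i : ℕ) (N : Type) [AddCommGroup N] [Module R N] : Type :=
  (localCohomology a i).obj (ModuleCat.of R N)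

variable (a : Ideal R) (i : ℕ)
variable {N N' N'' : Type} [AddCommGroup N] [Module R N] [AddCommGroup N'] [Module R N'] [AddCommGroup N''] [Module R N'']

instance instACGH : AddCommGroup (H a i N) :=
  inferInstanceAs (AddCommGroup ((localCohomology a i).obj (ModuleCat.of R N)))
instance instModH : Module R (H a i N) :=
  inferInstanceAs (Module R ((localCohomology a i).obj (ModuleCat.of R N)))

def Hmap (f : N →ₗ[R] N') : H a i N →ₗ[R] H a i N' :=
  ((localCohomology a i).map (ModuleCat.ofHom f)).hom

def mkH (t : ℕ) : nExt (qm a t) (ModuleCat.of R N) i →ₗ[R] H a i N := iH a i t (ModuleCat.of R N)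

variable {a i}

lemma mkH_surj (z : H a i N) : ∃ t e, mkH a i t e = z := iH_surj a i (ModuleCat.of R N) z

lemma mkH_res {s t : ℕ} (h : t ≤ s) (e : nExt (qm a t) (ModuleCat.of R N) i) :
    mkH a i s ((Abelian.Ext.mk₀ (qmap a h)).comp e (zero_add i)) = mkH a i t e := iH_res a i _ h e

lemma mkH_zero {t : ℕ} (e : nExt (qm a t) (ModuleCat.of R N) i)
    (he : mkH a i t e = 0) :
    ∃ s, ∃ h : t ≤ s, (Abelian.Ext.mk₀ (qmap a h)).comp e (zero_add i) = 0 := iH_zero a i _ e he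

lemma Hmap_mkH (t : ℕ) (f : N →ₗ[R] N') (e : nExt (qm a t) (ModuleCat.of R N) i) :
    Hmap a i f (mkH a i t e) = mkH a i t (e.comp (Abelian.Ext.mk₀ (ModuleCat.ofHom f)) (add_zero i)) :=
  iH_map a i t _ e

lemma Hmap_id (z : H a i N) : Hmap a i LinearMap.id z = z := by
  obtain ⟨t, e, rfl⟩ := mkH_surj z
  rw [Hmap_mkH]
  exact congrArg _ (Abelian.Ext.comp_mk₀_id e)

lemma Hmap_comp (f : N →ₗ[R] N') (g : N' →ₗ[R] N'') (z : H a i N) : 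
    Hmap a i (g ∘ₗ f) z = Hmap a i g (Hmap a i f z) := by
  obtain ⟨t, e, rfl⟩ := mkH_surj z
  rw [Hmap_mkH, Hmap_mkH, Hmap_mkH, ModuleCat.ofHom_comp]
  congr 1
  simp

lemma Hmap_add (f g : N →ₗ[R] N') (z : H a i N) : 
    Hmap a i (f + g) z = Hmap a i f z + Hmap a i g z := by
  obtain ⟨t, e, rfl⟩ := mkH_surj z
  rw [Hmap_mkH, Hmap_mkH, Hmap_mkH, ← map_add, ← Abelian.Ext.comp_add, ← Abelian.Ext.mk₀_add]
  rfl

lemma Hmap_smul (r : R) (f : N →ₗ[R] N') (z : H a i N) : 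
    Hmap a i (r • f) z = r • Hmap a i f z := by
  obtain ⟨t, e, rfl⟩ := mkH_surj z
  rw [Hmap_mkH, Hmap_mkH, ← map_smul, ← Abelian.Ext.comp_smul, ← Abelian.Ext.mk₀_smul]
  rfl

lemma H_desc {W : Type} [AddCommGroup W] [Module R W]
    (d : ∀ t, nExt (qm a t) (ModuleCat.of R N) i →ₗ[R] W)
    (hd : ∀ s t (h : t ≤ s) e, d s ((Abelian.Ext.mk₀ (qmap a h)).comp e (zero_add i)) = d t e) :
    ∃ D : H a i N →ₗ[R] W, ∀ t e, D (mkH a i t e) = d t e := by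
  choose T E hE using mkH_surj (a := a) (i := i) (N := N)
  have key : ∀ t t' e e', mkH a i t e = mkH (N := N) a i t' e' → d t e = d t' e' := by
    intro t t' e e' h
    let s := max t t'
    have h1 : mkH a i s ((Abelian.Ext.mk₀ (qmap a (le_max_left t t'))).comp e (zero_add i) - 
      (Abelian.Ext.mk₀ (qmap a (le_max_right t t'))).comp e' (zero_add i)) = 0 := by
      rw [map_sub, mkH_res, mkH_res, h, sub_self]
    obtain ⟨s', hs, h2⟩ := mkH_zero _ h1
    have h3 := hd s' s hs ((Abelian.Ext.mk₀ (qmap a (le_max_left t t'))).comp e (zero_add i) - 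
      (Abelian.Ext.mk₀ (qmap a (le_max_right t t'))).comp e' (zero_add i))
    rw [h2, map_zero, map_sub, hd, hd] at h3
    exact sub_eq_zero.1 h3.symm
  refine ⟨{ toFun := fun z => d (T z) (E z), map_add' := ?_, map_smul' := ?_ }, ?_⟩
  · intro z w
    let s := max (T z) (T w)
    rw [← hd s (T z) (le_max_left _ _), ← hd s (T w) (le_max_right _ _), ← map_add]
    apply key
    rw [hE, map_add, mkH_res, mkH_res, hE, hE]
  · intro r z
    rw [RingHom.id_apply, ← map_smul]
    apply key
    rw [hE, map_smul, hE]
  · intro t e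
    exact key _ _ _ _ (hE _)

/-- short complex of a short exact sequence -/
lemma mkSES (f : N' →ₗ[R] N) (g : N →ₗ[R] N'') (hf : Function.Injective f) (hg : Function.Surjective g)
    (hfg : Function.Exact f g) :
    ∃ w, (ShortComplex.mk (ModuleCat.ofHom f) (ModuleCat.ofHom g) w).ShortExact := by
  have w : ModuleCat.ofHom f ≫ ModuleCat.ofHom g = 0 := by
    ext x
    exact hfg.apply_apply_eq_zero x
  refine ⟨w, ?_⟩
  refine ShortComplex.ShortExact.mk' ?_ ((ModuleCat.mono_iff_injective _).2 hf) ((ModuleCat.epi_iff_surjective _).2 hg)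
  rw [ShortComplex.moduleCat_exact_iff]
  intro x hx
  exact (hfg x).1 hx

theorem H_exact_mid (f : N' →ₗ[R] N) (g : N →ₗ[R] N'') (hf : Function.Injective f) (hg : Function.Surjective g)
    (hfg : Function.Exact f g) (i : ℕ) : Function.Exact (Hmap a i f) (Hmap a i g) := by
  obtain ⟨w, hS⟩ := mkSES f g hf hg hfg
  intro z
  constructor
  · intro hz
    obtain ⟨t, e, rfl⟩ := mkH_surj z
    rw [Hmap_mkH] at hz
    obtain ⟨s, h, hs⟩ := mkH_zero _ hz
    rw [← Abelian.Ext.comp_assoc_of_third_deg_zero] at hs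
    obtain ⟨e', he'⟩ := Abelian.Ext.covariant_sequence_exact₂ _ hS _ hs
    refine ⟨mkH a i s e', ?_⟩
    rw [Hmap_mkH, ← mkH_res h]
    exact congrArg _ he'
  · rintro ⟨y, rfl⟩
    rw [← Hmap_comp, hfg.linearMap_comp_eq_zero]
    have := Hmap_smul (a := a) (i := i) 0 (0 : N' →ₗ[R] N'') y
    simpa using this

theorem H_les (f : N' →ₗ[R] N) (g : N →ₗ[R] N'') (hf : Function.Injective f) (hg : Function.Surjective g)
    (hfg : Function.Exact f g) (i : ℕ) : ∃ δ : H a i N'' →ₗ[R] H a (i+1) N',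
      Function.Exact (Hmap a i g) δ ∧ Function.Exact δ (Hmap a (i+1) f) := by
  obtain ⟨w, hS⟩ := mkSES f g hf hg hfg
  let d : ∀ t, nExt (qm a t) (ModuleCat.of R N'') i →ₗ[R] H a (i+1) N' := fun t =>
    { toFun := fun e => mkH a (i+1) t (e.comp hS.extClass rfl)
      map_add' := fun e e' => by rw [Abelian.Ext.add_comp, map_add]
      map_smul' := fun r e => by rw [Abelian.Ext.smul_comp, map_smul]; rfl }
  obtain ⟨δ, hδ⟩ := H_desc d (by
    intro s t h e
    change mkH a (i+1) s _ = mkH a (i+1) t _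
    rw [Abelian.Ext.comp_assoc (h₂₃ := rfl) (h := by omega), mkH_res])
  have hδ' : ∀ t e, δ (mkH a i t e) = mkH a (i+1) t (e.comp hS.extClass rfl) := hδ
  refine ⟨δ, ?_, ?_⟩
  · intro z
    constructor
    · intro hz
      obtain ⟨t, e, rfl⟩ := mkH_surj z
      rw [hδ'] at hz
      obtain ⟨s, h, hs⟩ := mkH_zero _ hz
      rw [← Abelian.Ext.comp_assoc (h₁₂ := zero_add i) (h := by omega)] at hs
      obtain ⟨e', he'⟩ := Abelian.Ext.covariant_sequence_exact₃ _ hS _ rfl hs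
      refine ⟨mkH a i s e', ?_⟩
      rw [Hmap_mkH, ← mkH_res h]
      exact congrArg _ he'
    · rintro ⟨y, rfl⟩
      obtain ⟨t, e, rfl⟩ := mkH_surj y
      rw [Hmap_mkH, hδ', Abelian.Ext.comp_assoc_of_second_deg_zero]
      have := hS.comp_extClass
      erw [this]
      rw [Abelian.Ext.comp_zero, map_zero]
  · intro z
    constructor
    · intro hz
      obtain ⟨t, e, rfl⟩ := mkH_surj z
      rw [Hmap_mkH] at hz
      obtain ⟨s, h, hs⟩ := mkH_zero _ hz
      rw [← Abelian.Ext.comp_assoc_of_third_deg_zero] at hs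
      obtain ⟨e', he'⟩ := Abelian.Ext.covariant_sequence_exact₁ _ hS _ hs rfl
      refine ⟨mkH a i s e', ?_⟩
      rw [hδ', ← mkH_res h]
      exact congrArg _ he'
    · rintro ⟨y, rfl⟩
      obtain ⟨t, e, rfl⟩ := mkH_surj y
      rw [hδ', Hmap_mkH, Abelian.Ext.comp_assoc_of_third_deg_zero]
      have := hS.extClass_comp
      erw [this]
      rw [Abelian.Ext.comp_zero, map_zero]

theorem H_torsion (z : H a i N) : ∃ n, ∀ r ∈ a ^ n, r • z = 0 := by
  obtain ⟨t, e, rfl⟩ := mkH_surj z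
  refine ⟨t, fun r hr => ?_⟩
  rw [← map_smul]
  have h1 : r • e = (Abelian.Ext.mk₀ (r • 𝟙 (qm a t))).comp e (zero_add i) := by
    rw [Abelian.Ext.mk₀_smul, Abelian.Ext.smul_comp, Abelian.Ext.mk₀_id_comp]
  have h2 : r • 𝟙 (qm a t) = 0 := by
    ext
    change r • (Submodule.Quotient.mk 1 : R ⧸ a^t) = 0
    rw [← Submodule.Quotient.mk_smul, Submodule.Quotient.mk_eq_zero]
    simpa using hr
  rw [h1, h2, Abelian.Ext.mk₀_zero, Abelian.Ext.zero_comp, map_zero]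

theorem H_injective [Module.Injective R N] (i : ℕ) : Subsingleton (H a (i+1) N) := by
  refine ⟨fun z w => ?_⟩
  have : ∀ z : H a (i+1) N, z = 0 := by
    intro z
    obtain ⟨t, e, rfl⟩ := mkH_surj z
    have : CategoryTheory.Injective (ModuleCat.of R N) := Module.injective_object_of_injective_module R N
    rw [Abelian.Ext.eq_zero_of_injective e, map_zero]
  rw [this z, this w]

end
end LCP

open CategoryTheory
namespace LCP
open Opposite
variable {R : Type} [CommRing R]
noncomputable section

variable {a : Ideal R} {i : ℕ}
variable {N N' N'' : Type} [AddCommGroup N] [Module R N] [AddCommGroup N'] [Module R N'] [AddCommGroup N''] [Module R N'']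

def Gam (a : Ideal R) (N : Type) [AddCommGroup N] [Module R N] : Submodule R N where
  carrier := {n | ∃ t, ∀ r ∈ a ^ t, r • n = 0}
  add_mem' := by
    rintro x y ⟨t, ht⟩ ⟨s, hs⟩
    refine ⟨max t s, fun r hr => ?_⟩
    rw [smul_add, ht r (Ideal.pow_le_pow_right (le_max_left _ _) hr), hs r (Ideal.pow_le_pow_right (le_max_right _ _) hr), add_zero]
  zero_mem' := ⟨0, by simp⟩
  smul_mem' := by
    rintro c x ⟨t, ht⟩
    refine ⟨t, fun r hr => ?_⟩
    rw [smul_comm, ht r hr, smul_zero]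

lemma mem_Gam {x : N} : x ∈ Gam a N ↔ ∃ t, ∀ r ∈ a ^ t, r • x = 0 := Iff.rfl

def h0d (a : Ideal R) (N : Type) [AddCommGroup N] [Module R N] (t : ℕ) : nExt (qm a t) (ModuleCat.of R N) 0 →ₗ[R] N where
  toFun e := (Abelian.Ext.linearEquiv₀ (R := R) e).hom (Submodule.Quotient.mk (1 : R))
  map_add' e e' := by rw [map_add]; rfl
  map_smul' r e := by rw [map_smul]; rfl

lemma h0d_mk₀ (t : ℕ) (f : qm a t ⟶ ModuleCat.of R N) : 
    h0d a N t (Abelian.Ext.mk₀ f) = f.hom (Submodule.Quotient.mk (1 : R)) := by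
  have : Abelian.Ext.linearEquiv₀ (R := R) (Abelian.Ext.mk₀ f) = f :=
    (Abelian.Ext.linearEquiv₀ (R := R)).apply_symm_apply f
  change (Abelian.Ext.linearEquiv₀ (R := R) (Abelian.Ext.mk₀ f)).hom _ = _
  rw [this]

lemma mk₀_surj {X Y : ModuleCat.{0} R} (e : nExt X Y 0) : ∃ f, e = Abelian.Ext.mk₀ f :=
  ⟨_, (Abelian.Ext.mk₀_linearEquiv₀_apply (R := R) e).symm⟩

lemma h0_exists (a : Ideal R) (N : Type) [AddCommGroup N] [Module R N] : 
    ∃ D : H a 0 N →ₗ[R] N, ∀ t e, D (mkH a 0 t e) = h0d a N t e := by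
  apply H_desc
  intro s t h e
  obtain ⟨f, rfl⟩ := mk₀_surj e
  rw [Abelian.Ext.mk₀_comp_mk₀, h0d_mk₀, h0d_mk₀]
  rfl

def h0 (a : Ideal R) (N : Type) [AddCommGroup N] [Module R N] : H a 0 N →ₗ[R] N := (h0_exists a N).choose

lemma h0_mkH (t : ℕ) (f : qm a t ⟶ ModuleCat.of R N) : 
    h0 a N (mkH a 0 t (Abelian.Ext.mk₀ f)) = f.hom (Submodule.Quotient.mk (1 : R)) := by
  rw [← h0d_mk₀]
  exact (h0_exists a N).choose_spec t _

lemma h0_inj : Function.Injective (h0 a N) := by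
  rw [← LinearMap.ker_eq_bot, LinearMap.ker_eq_bot']
  intro z hz
  obtain ⟨t, e, rfl⟩ := mkH_surj z
  obtain ⟨f, rfl⟩ := mk₀_surj e
  rw [h0_mkH] at hz
  have : f = 0 := by
    ext
    exact hz
  rw [this, Abelian.Ext.mk₀_zero, map_zero]

lemma h0_nat (f : N →ₗ[R] N') (z : H a 0 N) : h0 a N' (Hmap a 0 f z) = f (h0 a N z) := by
  obtain ⟨t, e, rfl⟩ := mkH_surj z
  obtain ⟨g, rfl⟩ := mk₀_surj e
  rw [Hmap_mkH, Abelian.Ext.mk₀_comp_mk₀, h0_mkH, h0_mkH]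
  rfl

lemma h0_range : LinearMap.range (h0 a N) = Gam a N := by
  ext x
  constructor
  · rintro ⟨z, rfl⟩
    obtain ⟨t, ht⟩ := H_torsion z
    refine ⟨t, fun r hr => ?_⟩
    rw [← map_smul, ht r hr, map_zero]
  · rintro ⟨t, ht⟩
    let f : (R ⧸ a ^ t) →ₗ[R] N := Submodule.liftQ _ (LinearMap.toSpanSingleton R N x) (fun r hr => by
      simpa using ht r hr)
    refine ⟨mkH a 0 t (Abelian.Ext.mk₀ (ModuleCat.ofHom f)), ?_⟩
    rw [h0_mkH]
    change (LinearMap.toSpanSingleton R N x) 1 = x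
    simp

theorem exists_inj (R : Type) [CommRing R] (N : Type) [AddCommGroup N] [Module R N] : 
    ∃ (I : Type) (_ : AddCommGroup I) (_ : Module R I) (_ : Module.Injective R I) (f : N →ₗ[R] I), Function.Injective f := by
  obtain ⟨I, hI, f, hf⟩ := (EnoughInjectives.presentation (ModuleCat.of R N)).some
  exact ⟨I, inferInstance, inferInstance, Module.injective_module_of_injective_object R I, f.hom, (ModuleCat.mono_iff_injective _).1 hf⟩

lemma tors_bound {X : Type} [AddCommGroup X] [Module R X] [Module.Finite R X] (h : Gam a X = ⊤) :
    ∃ t, ∀ r ∈ a ^ t, ∀ x : X, r • x = 0 := by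
  classical
  obtain ⟨s, hs⟩ := Module.Finite.fg_top (R := R) (M := X)
  have : ∀ F : Finset X, ∃ t, ∀ r ∈ a ^ t, ∀ x ∈ F, r • x = 0 := by
    intro F
    induction F using Finset.induction_on with
    | empty => exact ⟨0, by simp⟩
    | insert y F hy ih =>
      obtain ⟨t, ht⟩ := ih
      obtain ⟨t', ht'⟩ : y ∈ Gam a X := h ▸ trivial
      refine ⟨max t t', fun r hr x hx => ?_⟩
      rw [Finset.mem_insert] at hx
      rcases hx with rfl | hx
      · exact ht' r (Ideal.pow_le_pow_right (le_max_right _ _) hr)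
      · exact ht r (Ideal.pow_le_pow_right (le_max_left _ _) hr) x hx
  obtain ⟨t, ht⟩ := this s
  refine ⟨t, fun r hr x => ?_⟩
  have h1 : Submodule.span R (s : Set X) ≤ LinearMap.ker (LinearMap.lsmul R X r) :=
    Submodule.span_le.2 (fun y hy => ht r hr y hy)
  rw [hs] at h1
  exact h1 (x := x) trivial

theorem Gam_injective [IsNoetherianRing R] (a : Ideal R) (I : Type) [AddCommGroup I] [Module R I] [Module.Injective R I] :
    Module.Injective R (Gam a I) := by
  apply Module.Baer.injective
  intro J g
  obtain ⟨t, ht⟩ : ∃ t, ∀ r ∈ a ^ t, ∀ x, r • g x = 0 := by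
    obtain ⟨t, ht⟩ := tors_bound (a := a) (X := LinearMap.range g) (by
      rw [eq_top_iff]
      rintro x -
      obtain ⟨t, ht⟩ := (x : Gam a I).2
      exact ⟨t, fun r hr => Subtype.ext (Subtype.ext (ht r hr))⟩)
    exact ⟨t, fun r hr x => congrArg Subtype.val (ht r hr ⟨g x, ⟨x, rfl⟩⟩)⟩
  obtain ⟨k, hk⟩ := Ideal.exists_pow_inf_eq_pow_smul a J
  have hk := hk (k + t) (by omega)
  let φ : J →ₗ[R] (R ⧸ a ^ (k + t)) := (Submodule.mkQ (a ^ (k+t))) ∘ₗ J.subtype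
  let g1 : J →ₗ[R] I := (Gam a I).subtype ∘ₗ g
  have hker : LinearMap.ker φ ≤ LinearMap.ker g1 := by
    rintro ⟨x, hx⟩ h
    have h1 : x ∈ a ^ (k+t) := by
      exact (Submodule.Quotient.mk_eq_zero _).1 h
    have h2 : x ∈ a ^ (k + t - k) • (a ^ k • (⊤ : Submodule R R) ⊓ J) := by
      rw [← hk]
      exact ⟨by simpa using h1, hx⟩
    have h3 : x ∈ a ^ t • J := by
      rw [add_tsub_cancel_left] at h2
      exact Submodule.smul_mono le_rfl inf_le_right h2
    have h4 : a ^ t • J ≤ (LinearMap.ker g).map J.subtype := by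
      rw [Submodule.smul_le]
      intro r hr n hn
      refine ⟨r • ⟨n, hn⟩, ?_, rfl⟩
      rw [SetLike.mem_coe, LinearMap.mem_ker, map_smul, ht r hr]
    obtain ⟨⟨y, hy⟩, h5, h6⟩ := h4 h3
    change y = x at h6
    subst h6
    change ((g ⟨y, hx⟩ : Gam a I) : I) = 0
    rw [LinearMap.mem_ker.1 h5]; rfl
  let g2 : LinearMap.range φ →ₗ[R] I := (Submodule.liftQ _ g1 hker) ∘ₗ φ.quotKerEquivRange.symm.toLinearMap
  obtain ⟨G, hG⟩ := Module.Injective.out (LinearMap.range φ).subtype (Submodule.subtype_injective _) g2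
  refine ⟨LinearMap.codRestrict (Gam a I) (G ∘ₗ Submodule.mkQ (a ^ (k+t))) (fun x => ⟨k + t, fun r hr => ?_⟩), ?_⟩
  · rw [← map_smul]
    have : r • x ∈ a ^ (k+t) := Ideal.mul_mem_right _ _ hr
    rw [LinearMap.comp_apply, Submodule.mkQ_apply, (Submodule.Quotient.mk_eq_zero _).2 this, map_zero]
  · intro x hx
    apply Subtype.ext
    have h1 := hG ⟨φ ⟨x, hx⟩, ⟨_, rfl⟩⟩
    have h2 : g2 ⟨φ ⟨x, hx⟩, ⟨_, rfl⟩⟩ = g1 ⟨x, hx⟩ := by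
      have : φ.quotKerEquivRange.symm ⟨φ ⟨x, hx⟩, ⟨_, rfl⟩⟩ = Submodule.Quotient.mk ⟨x, hx⟩ := by
        rw [LinearEquiv.symm_apply_eq]; rfl
      change (Submodule.liftQ _ g1 hker) (φ.quotKerEquivRange.symm _) = _
      rw [this]; rfl
    rw [h2] at h1
    exact h1

lemma Gam_top_of_surj (f : N →ₗ[R] N') (hf : Function.Surjective f) (h : Gam a N = ⊤) : Gam a N' = ⊤ := by
  rw [eq_top_iff]
  rintro x -
  obtain ⟨y, rfl⟩ := hf x
  obtain ⟨t, ht⟩ : y ∈ Gam a N := h ▸ trivial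
  exact ⟨t, fun r hr => by rw [← map_smul, ht r hr, map_zero]⟩

lemma Gam_Gam : Gam a (Gam a N) = ⊤ := by
  rw [eq_top_iff]
  rintro x -
  obtain ⟨t, ht⟩ := x.2
  exact ⟨t, fun r hr => Subtype.ext (ht r hr)⟩

lemma H_zero_surj (f : N →ₗ[R] N') (hf : Function.Surjective f) (h : Gam a N = ⊤) : 
    Function.Surjective (Hmap a 0 f) := by
  intro z
  obtain ⟨y, hy⟩ := hf (h0 a N' z)
  have hy' : y ∈ LinearMap.range (h0 a N) := by rw [h0_range, h]; trivial
  obtain ⟨w, rfl⟩ := hy'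
  refine ⟨w, h0_inj ?_⟩
  rw [h0_nat, hy]

/-- torsion modules have no higher local cohomology -/
theorem H_tors_zero [IsNoetherianRing R] (a : Ideal R) (i : ℕ) (N : Type) [AddCommGroup N] [Module R N] (hN : Gam a N = ⊤) :
    Subsingleton (H a (i+1) N) := by
  induction i generalizing N with
  | zero =>
    obtain ⟨I, _, _, _, f, hf⟩ := exists_inj R N
    have := Gam_injective a I
    let f' : N →ₗ[R] Gam a I := LinearMap.codRestrict _ f (fun x => by
      obtain ⟨t, ht⟩ : x ∈ Gam a N := hN ▸ trivial
      exact ⟨t, fun r hr => by rw [← map_smul, ht r hr, map_zero]⟩)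
    have hf' : Function.Injective f' := fun x y h => hf (congrArg Subtype.val h)
    obtain ⟨δ, h1, h2⟩ := H_les (a := a) f' (Submodule.mkQ (LinearMap.range f')) hf' (Submodule.mkQ_surjective _) 
      (LinearMap.exact_map_mkQ_range f') 0
    have h3 := H_zero_surj (a := a) (Submodule.mkQ (LinearMap.range f')) (Submodule.mkQ_surjective _) Gam_Gam
    have h4 := H_injective (a := a) (N := Gam a I) 0
    refine subsingleton_of_forall_eq 0 (fun z => ?_)
    obtain ⟨w, rfl⟩ := (h2 z).1 (Subsingleton.elim _ _)
    exact (h1 w).2 (h3 w)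
  | succ i ih =>
    obtain ⟨I, _, _, _, f, hf⟩ := exists_inj R N
    have := Gam_injective a I
    let f' : N →ₗ[R] Gam a I := LinearMap.codRestrict _ f (fun x => by
      obtain ⟨t, ht⟩ : x ∈ Gam a N := hN ▸ trivial
      exact ⟨t, fun r hr => by rw [← map_smul, ht r hr, map_zero]⟩)
    have hf' : Function.Injective f' := fun x y h => hf (congrArg Subtype.val h)
    obtain ⟨δ, h1, h2⟩ := H_les (a := a) f' (Submodule.mkQ (LinearMap.range f')) hf' (Submodule.mkQ_surjective _) 
      (LinearMap.exact_map_mkQ_range f') (i+1)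
    have h3 := ih (Gam a I ⧸ LinearMap.range f') (Gam_top_of_surj (Submodule.mkQ (LinearMap.range f')) (Submodule.mkQ_surjective _) Gam_Gam)
    have h4 := H_injective (a := a) (N := Gam a I) (i+1)
    refine subsingleton_of_forall_eq 0 (fun z => ?_)
    obtain ⟨w, rfl⟩ := (h2 z).1 (Subsingleton.elim _ _)
    rw [Subsingleton.elim w 0, map_zero]

theorem ext_fg [IsNoetherianRing R] (i : ℕ) (C : ModuleCat.{0} R) [Module.Finite R C] (e : nExt C (ModuleCat.of R N) i) :
    ∃ (N0 : Submodule R N) (_ : N0.FG) (e0 : nExt C (ModuleCat.of R N0) i), 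
      e0.comp (Abelian.Ext.mk₀ (ModuleCat.ofHom N0.subtype)) (add_zero i) = e := by
  induction i generalizing C with
  | zero => 
    obtain ⟨f, rfl⟩ := mk₀_surj e
    refine ⟨LinearMap.range f.hom, Submodule.fg_range f.hom, Abelian.Ext.mk₀ (ModuleCat.ofHom f.hom.rangeRestrict), ?_⟩
    rw [Abelian.Ext.mk₀_comp_mk₀]
    rfl
  | succ i ih =>
    obtain ⟨k, g, hg⟩ := Module.Finite.exists_fin' R C
    obtain ⟨w, hS⟩ := mkSES (LinearMap.ker g).subtype g (Submodule.subtype_injective _) hg (LinearMap.exact_subtype_ker_map g)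
    have : CategoryTheory.Projective (ModuleCat.of R (Fin k → R)) := inferInstance
    obtain ⟨x1, hx1⟩ := Abelian.Ext.contravariant_sequence_exact₃ hS _ e (Abelian.Ext.eq_zero_of_projective _) (add_comm 1 i)
    obtain ⟨N0, h0, e0, he0⟩ := ih (ModuleCat.of R (LinearMap.ker g)) x1
    refine ⟨N0, h0, hS.extClass.comp e0 (add_comm 1 i), ?_⟩
    rw [Abelian.Ext.comp_assoc_of_third_deg_zero, he0]
    exact hx1

theorem H_fg [IsNoetherianRing R] (z : H a i N) : ∃ (N0 : Submodule R N) (_ : N0.FG) (z0 : H a i N0), Hmap a i N0.subtype z0 = z := by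
  obtain ⟨t, e, rfl⟩ := mkH_surj z
  obtain ⟨N0, h0, e0, he0⟩ := ext_fg i _ e
  exact ⟨N0, h0, mkH a i t e0, by rw [Hmap_mkH, he0]⟩

end
end LCP

open CategoryTheory
namespace LCP
noncomputable section

section kills
variable {R : Type} [CommRing R] {a : Ideal R}
variable {N N' N'' : Type} [AddCommGroup N] [Module R N] [AddCommGroup N'] [Module R N'] [AddCommGroup N''] [Module R N'']

lemma kills_zero (r : R) : (∀ z : H a 0 N, r • z = 0) ↔ ∀ x ∈ Gam a N, r • x = 0 := by
  constructor
  · intro h x hx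
    rw [← h0_range] at hx
    obtain ⟨z, rfl⟩ := hx
    rw [← map_smul, h, map_zero]
  · intro h z
    apply h0_inj
    rw [map_smul, map_zero]
    apply h
    rw [← h0_range]
    exact ⟨z, rfl⟩

lemma kills_one (f : N' →ₗ[R] N) (g : N →ₗ[R] N'') (hf : Function.Injective f) (hg : Function.Surjective g)
    (hfg : Function.Exact f g) [Subsingleton (H a 1 N)] (r : R) : 
    (∀ z : H a 1 N', r • z = 0) ↔ ∀ y ∈ Gam a N'', ∃ x ∈ Gam a N, g x = r • y := by
  obtain ⟨δ, h1, h2⟩ := H_les (a := a) f g hf hg hfg 0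
  constructor
  · intro h y hy
    rw [← h0_range] at hy
    obtain ⟨z, rfl⟩ := hy
    obtain ⟨w, hw⟩ := (h1 (r • z)).1 (by rw [map_smul, h])
    refine ⟨h0 a N w, ?_, ?_⟩
    · rw [← h0_range]; exact ⟨w, rfl⟩
    · rw [← h0_nat, hw, map_smul]
  · intro h z
    obtain ⟨w, rfl⟩ := (h2 z).1 (Subsingleton.elim _ _)
    obtain ⟨x, hx, e⟩ := h (h0 a N'' w) (by rw [← h0_range]; exact ⟨w, rfl⟩)
    rw [← h0_range] at hx
    obtain ⟨u, rfl⟩ := hx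
    rw [← map_smul, h1]
    refine ⟨u, h0_inj ?_⟩
    rw [h0_nat, e, map_smul]

lemma kills_succ (f : N' →ₗ[R] N) (g : N →ₗ[R] N'') (hf : Function.Injective f) (hg : Function.Surjective g)
    (hfg : Function.Exact f g) (i : ℕ) [Subsingleton (H a (i+1) N)] [Subsingleton (H a (i+2) N)] (r : R) : 
    (∀ z : H a (i+2) N', r • z = 0) ↔ ∀ z : H a (i+1) N'', r • z = 0 := by
  obtain ⟨δ, h1, h2⟩ := H_les (a := a) f g hf hg hfg (i+1)
  constructor
  · intro h z
    obtain ⟨w, hw⟩ := (h1 (r • z)).1 (by rw [map_smul, h])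
    rw [← hw, Subsingleton.elim w 0, map_zero]
  · intro h z
    obtain ⟨w, rfl⟩ := (h2 z).1 (Subsingleton.elim _ _)
    rw [← map_smul, h, map_zero]

end kills

variable {R : Type} [CommRing R] (B : Type) [CommRing B] [Algebra R B]

lemma Gam_base (a : Ideal R) {W : Type} [AddCommGroup W] [Module R W] [Module B W] [IsScalarTower R B W] (x : W) :
    x ∈ Gam a W ↔ x ∈ Gam (a.map (algebraMap R B)) W := by
  constructor
  · rintro ⟨t, ht⟩
    refine ⟨t, fun b hb => ?_⟩
    rw [← Ideal.map_pow] at hb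
    have : (a ^ t).map (algebraMap R B) ≤ LinearMap.ker (LinearMap.toSpanSingleton B W x) := by
      rw [Ideal.map_le_iff_le_comap]
      intro r hr
      rw [Ideal.mem_comap, LinearMap.mem_ker, LinearMap.toSpanSingleton_apply, algebraMap_smul, ht r hr]
    simpa using this hb
  · rintro ⟨t, ht⟩
    refine ⟨t, fun r hr => ?_⟩
    rw [← algebraMap_smul B r x]
    apply ht
    rw [← Ideal.map_pow]
    exact Ideal.mem_map_of_mem _ hr

lemma injective_restrict [Module.Flat R B] (Q : Type) [AddCommGroup Q] [Module R Q] [Module B Q] [IsScalarTower R B Q]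
    [Module.Injective B Q] : Module.Injective R Q := by
  constructor
  intro X Y _ _ _ _ f hf g
  obtain ⟨G, hG⟩ := Module.Injective.out (f.baseChange B) (Module.Flat.lTensor_preserves_injective_linearMap (M := B) f hf) 
    (g.liftBaseChange B)
  refine ⟨(G.restrictScalars R) ∘ₗ (TensorProduct.mk R B Y 1), fun x => ?_⟩
  have := hG (1 ⊗ₜ x)
  simpa using this

lemma exists_pres [Module.Flat R B] (W : Type) [AddCommGroup W] [Module R W] [Module B W] [IsScalarTower R B W] :
    ∃ (I : Type) (_ : AddCommGroup I) (_ : Module B I) (_ : Module R I) (_ : IsScalarTower R B I)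
      (C : Type) (_ : AddCommGroup C) (_ : Module B C) (_ : Module R C) (_ : IsScalarTower R B C)
      (f : W →ₗ[B] I) (g : I →ₗ[B] C), Module.Injective B I ∧ Module.Injective R I ∧
      Function.Injective f ∧ Function.Surjective g ∧ Function.Exact f g := by
  obtain ⟨I, _, _, hI, f, hf⟩ := exists_inj B W
  let : Module R I := Module.compHom I (algebraMap R B)
  have : IsScalarTower R B I := ⟨fun r b x => by rw [Algebra.smul_def, mul_smul]; rfl⟩
  have h := injective_restrict (R := R) B I
  exact ⟨I, _, _, _, this, I ⧸ LinearMap.range f, _, _, inferInstance, inferInstance, f, (LinearMap.range f).mkQ, 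
    hI, h, hf, Submodule.mkQ_surjective _, LinearMap.exact_map_mkQ_range f⟩

theorem kills_base [Module.Flat R B] (a : Ideal R) (r : R) (i : ℕ) 
    (W : Type) [AddCommGroup W] [Module R W] [Module B W] [IsScalarTower R B W] :
    (∀ z : H a i W, r • z = 0) ↔ ∀ z : H (a.map (algebraMap R B)) i W, algebraMap R B r • z = 0 := by
  cases i with
  | zero =>
    rw [kills_zero, kills_zero]
    simp only [← Gam_base, algebraMap_smul]
  | succ i =>
  induction i generalizing W with
  | zero =>
    obtain ⟨I, _, _, _, _, C, _, _, _, _, f, g, _, _, hf, hg, hfg⟩ := exists_pres (R := R) B W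
    have s1 := H_injective (a := a) (N := I) 0
    have s2 := H_injective (a := (a.map (algebraMap R B))) (N := I) 0
    have k1 := kills_one (a := a.map (algebraMap R B)) f g hf hg hfg (algebraMap R B r)
    have k2 := kills_one (a := a) (f.restrictScalars R) (g.restrictScalars R) hf hg hfg r
    simp only [← Gam_base, algebraMap_smul] at k1
    exact k2.trans k1.symm
  | succ i ih =>
    obtain ⟨I, _, _, _, _, C, _, _, _, _, f, g, _, _, hf, hg, hfg⟩ := exists_pres (R := R) B W
    have s1 := H_injective (a := a) (N := I) i
    have s2 := H_injective (a := (a.map (algebraMap R B))) (N := I) i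
    have s3 := H_injective (a := a) (N := I) (i+1)
    have s4 := H_injective (a := (a.map (algebraMap R B))) (N := I) (i+1)
    have k1 := kills_succ (a := a.map (algebraMap R B)) f g hf hg hfg i (algebraMap R B r)
    have k2 := kills_succ (a := a) (f.restrictScalars R) (g.restrictScalars R) hf hg hfg i r
    exact k2.trans ((ih C).trans k1.symm)

end
end LCP

open CategoryTheory
namespace LCP
noncomputable section

variable {R : Type} [CommRing R] {a : Ideal R} {i : ℕ}
variable {N N' N'' : Type} [AddCommGroup N] [Module R N] [AddCommGroup N'] [Module R N'] [AddCommGroup N''] [Module R N'']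

lemma Hmap_smul_id (r : R) (z : H a i N) : Hmap a i (r • LinearMap.id) z = r • z := by
  rw [Hmap_smul, Hmap_id]

lemma Hmap_zero (z : H a i N) : Hmap a i (0 : N →ₗ[R] N') z = 0 := by
  have := Hmap_smul (a := a) (i := i) 0 (0 : N →ₗ[R] N') z
  simpa using this

lemma Hmap_sum {ι : Type} (s : Finset ι) (f : ι → (N →ₗ[R] N')) (z : H a i N) : 
    Hmap a i (∑ j ∈ s, f j) z = ∑ j ∈ s, Hmap a i (f j) z := by
  classical
  induction s using Finset.induction_on with
  | empty => simp [Hmap_zero]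
  | insert y F hy ih => rw [Finset.sum_insert hy, Finset.sum_insert hy, Hmap_add, ih]

def Hequiv (a : Ideal R) (i : ℕ) (e : N ≃ₗ[R] N') : H a i N ≃ₗ[R] H a i N' :=
  LinearEquiv.ofLinearMap (Hmap a i e.toLinearMap) (Hmap a i e.symm.toLinearMap)
    (by ext z; simp only [LinearMap.comp_apply, ← Hmap_comp]; simp [Hmap_id])
    (by ext z; simp only [LinearMap.comp_apply, ← Hmap_comp]; simp [Hmap_id])

instance H_sub [Subsingleton N] : Subsingleton (H a i N) := by
  refine subsingleton_of_forall_eq 0 (fun z => ?_)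
  rw [← Hmap_id z, Subsingleton.elim (LinearMap.id : N →ₗ[R] N) 0, Hmap_zero]

lemma H_sub_mid (f : N' →ₗ[R] N) (g : N →ₗ[R] N'') (hf : Function.Injective f) (hg : Function.Surjective g)
    (hfg : Function.Exact f g) (h' : Subsingleton (H a i N')) (h'' : Subsingleton (H a i N'')) : 
    Subsingleton (H a i N) := by
  refine subsingleton_of_forall_eq 0 (fun z => ?_)
  obtain ⟨w, rfl⟩ := (H_exact_mid (a := a) f g hf hg hfg i z).1 (Subsingleton.elim _ _)
  rw [Subsingleton.elim w 0, map_zero]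

lemma H_surj_of (f : N' →ₗ[R] N) (g : N →ₗ[R] N'') (hf : Function.Injective f) (hg : Function.Surjective g)
    (hfg : Function.Exact f g) (h' : Subsingleton (H a (i+1) N')) : Function.Surjective (Hmap a i g) := by
  obtain ⟨δ, h1, h2⟩ := H_les (a := a) f g hf hg hfg i
  intro z
  exact (h1 z).1 (Subsingleton.elim _ _)

lemma H_surj_ker (g : N →ₗ[R] N'') (hg : Function.Surjective g)
    (h' : Subsingleton (H a (i+1) (LinearMap.ker g))) : Function.Surjective (Hmap a i g) :=
  H_surj_of (LinearMap.ker g).subtype g (Submodule.subtype_injective _) hg (LinearMap.exact_subtype_ker_map g) h'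

lemma H_inj_of (f : N' →ₗ[R] N) (g : N →ₗ[R] N'') (hf : Function.Injective f) (hg : Function.Surjective g)
    (hfg : Function.Exact f g) (h' : Subsingleton (H a i N'')) : Function.Injective (Hmap a (i+1) f) := by
  obtain ⟨δ, h1, h2⟩ := H_les (a := a) f g hf hg hfg i
  rw [← LinearMap.ker_eq_bot, LinearMap.ker_eq_bot']
  intro z hz
  obtain ⟨w, rfl⟩ := (h2 z).1 hz
  rw [Subsingleton.elim w 0, map_zero]

lemma H_rexact (f : N' →ₗ[R] N) (g : N →ₗ[R] N'') (hg : Function.Surjective g)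
    (hfg : Function.Exact f g) (h' : Subsingleton (H a (i+1) (LinearMap.ker f))) : 
    Function.Exact (Hmap a i f) (Hmap a i g) := by
  have h1 : Function.Surjective (Hmap a i f.rangeRestrict) := by
    apply H_surj_ker _ f.surjective_rangeRestrict
    rwa [LinearMap.ker_rangeRestrict]
  have h2 := H_exact_mid (a := a) (LinearMap.range f).subtype g (Submodule.subtype_injective _) hg
    (by
      intro x
      rw [hfg x]
      simp) i
  intro z
  rw [h2 z]
  constructor
  · rintro ⟨y, rfl⟩
    obtain ⟨w, rfl⟩ := h1 y
    exact ⟨w, by rw [← Hmap_comp]; rfl⟩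
  · rintro ⟨w, rfl⟩
    exact ⟨Hmap a i f.rangeRestrict w, by rw [← Hmap_comp]; rfl⟩

lemma mem_supp_quot {I : Ideal R} {Q : PrimeSpectrum R} : Q ∈ Module.support R (R ⧸ I) ↔ I ≤ Q.1 := by
  rw [Module.support_eq_zeroLocus, Ideal.annihilator_quotient]
  exact Iff.rfl

lemma lt_succ_of_le' {x : ℕ∞} {c : ℕ} (h : x ≤ c) : x < (c + 1 : ℕ) :=
  lt_of_le_of_lt h (by exact_mod_cast Nat.lt_succ_self c)

theorem H_van [IsNoetherianRing R] (W : Type) [AddCommGroup W] [Module R W] [hW : Module.Finite R W]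
    (h : ∀ P ∈ Module.support R W, Subsingleton (H a i (R ⧸ P.1))) : Subsingleton (H a i W) := by
  revert h
  induction hW using IsNoetherianRing.induction_on_isQuotientEquivQuotientPrime R with
  | subsingleton N => intro _; infer_instance
  | quotient N p f =>
    intro h
    have := h p (by
      rw [f.support_eq, mem_supp_quot])
    exact (Hequiv a i f).toEquiv.subsingleton
  | exact N₁ N₂ N₃ f g hf hg hfg h₁ h₃ =>
    intro h
    rw [Module.support_of_exact hfg hf hg] at h
    exact H_sub_mid f g hf hg hfg (h₁ fun P hP => h P (Or.inl hP)) (h₃ fun P hP => h P (Or.inr hP))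

/-- `N / sN` -/
abbrev qs (s : R) (N : Type) [AddCommGroup N] [Module R N] : Type := 
  N ⧸ LinearMap.range (s • (LinearMap.id : N →ₗ[R] N))

lemma qs_exact (s : R) : Function.Exact (s • (LinearMap.id : N →ₗ[R] N)) 
    (LinearMap.range (s • (LinearMap.id : N →ₗ[R] N))).mkQ := LinearMap.exact_map_mkQ_range _

lemma qs_supp (s : R) {Q : PrimeSpectrum R} (hQ : Q ∈ Module.support R (qs s N)) : 
    s ∈ Q.1 ∧ Q ∈ Module.support R N := by
  constructor
  · refine Module.annihilator_le_of_mem_support hQ ?_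
    rw [Module.mem_annihilator]
    intro x
    obtain ⟨x, rfl⟩ := Submodule.Quotient.mk_surjective _ x
    rw [← Submodule.Quotient.mk_smul, Submodule.Quotient.mk_eq_zero]
    exact ⟨x, rfl⟩
  · exact Module.support_subset_of_surjective _ (Submodule.mkQ_surjective _) hQ

lemma qs_supp_lt {P : PrimeSpectrum R} (hP : P.1 ≤ Module.annihilator R N) (s : R) (hs : s ∉ P.1) 
    {Q : PrimeSpectrum R} (hQ : Q ∈ Module.support R (qs s N)) : P < Q := by
  obtain ⟨h1, h2⟩ := qs_supp s hQ
  refine lt_of_le_of_ne (hP.trans (Module.annihilator_le_of_mem_support h2)) ?_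
  rintro rfl
  exact hs h1

lemma ann_quot (P : Ideal R) : P ≤ Module.annihilator R (R ⧸ P) := by
  rw [Ideal.annihilator_quotient]

lemma lt_of_lt_succ_coheight {P Q : PrimeSpectrum R} (h : P < Q) {d : ℕ} (hP : Order.coheight P ≤ d) : 
    Order.coheight Q < d := Order.coheight_le_coe_iff.1 hP Q h

lemma smul_inj_quot (P : PrimeSpectrum R) (f : R) (hf : f ∉ P.1) : 
    Function.Injective (f • (LinearMap.id : (R ⧸ P.1) →ₗ[R] (R ⧸ P.1))) := by
  rw [← LinearMap.ker_eq_bot, LinearMap.ker_eq_bot']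
  intro x hx
  obtain ⟨x, rfl⟩ := Ideal.Quotient.mk_surjective x
  have : Ideal.Quotient.mk P.1 (f * x) = 0 := hx
  rw [Ideal.Quotient.eq_zero_iff_mem] at this ⊢
  exact (P.2.mem_or_mem this).resolve_left hf

lemma tors_inj_zero {A : Type} [AddCommGroup A] [Module R A] (f : R) (h1 : ∀ z : A, f • z = 0 → z = 0) 
    (z : A) (n : ℕ) (hn : f ^ n • z = 0) : z = 0 := by
  induction n with
  | zero => simpa using hn
  | succ n ih => exact ih (h1 _ (by rwa [pow_succ', mul_smul] at hn))

theorem groth [IsNoetherianRing R] (d : ℕ) (W : Type) [AddCommGroup W] [Module R W] [Module.Finite R W]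
    (h : ∀ Q ∈ Module.support R W, Order.coheight Q < d) : Subsingleton (H a d W) := by
  induction d generalizing W with
  | zero =>
    have : Subsingleton W := by
      rw [← Module.support_eq_empty_iff (R := R), Set.eq_empty_iff_forall_notMem]
      intro Q hQ
      simpa using h Q hQ
    infer_instance
  | succ d ih =>
    apply H_van
    intro P hP
    have hPd : Order.coheight P ≤ d := by
      have := h P hP
      exact Order.le_of_lt_add_one (by exact_mod_cast this)
    by_cases haP : a ≤ P.1
    · apply H_tors_zero
      rw [eq_top_iff]
      rintro x -
      refine ⟨1, fun r hr => ?_⟩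
      rw [pow_one] at hr
      exact Module.mem_annihilator.1 (ann_quot P.1 (haP hr)) x
    · obtain ⟨f, hfa, hfP⟩ := SetLike.not_le_iff_exists.1 haP
      have h1 := ih (qs f (R ⧸ P.1)) (fun Q hQ => lt_of_lt_succ_coheight (qs_supp_lt (ann_quot P.1) f hfP hQ) hPd)
      have h2 := H_inj_of (a := a) _ _ (smul_inj_quot P f hfP) (Submodule.mkQ_surjective _) (qs_exact f) h1
      refine subsingleton_of_forall_eq 0 (fun z => ?_)
      obtain ⟨n, hn⟩ := H_torsion z
      refine tors_inj_zero f (fun z hz => h2 ?_) z n (hn _ (Ideal.pow_mem_pow hfa n))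
      rw [Hmap_smul_id, hz, map_zero]

theorem groth_all [IsNoetherianRing R] (c : ℕ) (hR : ∀ Q : PrimeSpectrum R, Order.coheight Q ≤ c) 
    (W : Type) [AddCommGroup W] [Module R W] : Subsingleton (H a (c+1) W) := by
  refine subsingleton_of_forall_eq 0 (fun z => ?_)
  obtain ⟨N0, h0, z0, rfl⟩ := H_fg z
  have : Module.Finite R N0 := Module.Finite.iff_fg.2 h0
  have := groth (a := a) (c+1) N0 (fun Q _ => lt_succ_of_le' (hR Q))
  rw [Subsingleton.elim z0 0, map_zero]

/-- multiplication by `s` is onto on top local cohomology when `N/sN` has smaller dimension -/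
theorem smul_surj [IsNoetherianRing R] (d : ℕ) [Module.Finite R N] (s : R)
    (h1 : ∀ Q ∈ Module.support R N, Order.coheight Q ≤ d)
    (h2 : ∀ Q ∈ Module.support R (qs s N), Order.coheight Q < d) (z : H a d N) : ∃ w, s • w = z := by
  have h3 := groth (a := a) d (qs s N) h2
  have h4 := groth (a := a) (d+1) (LinearMap.ker (s • (LinearMap.id : N →ₗ[R] N))) (fun Q hQ => lt_succ_of_le' (h1 Q (Module.support_subset_of_injective _ (Submodule.subtype_injective _) hQ)))
  obtain ⟨w, hw⟩ := (H_rexact (a := a) _ _ (Submodule.mkQ_surjective _) (qs_exact (N := N) s) h4 z).1 (Subsingleton.elim _ _)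
  exact ⟨w, by rw [← hw, Hmap_smul_id]⟩

end
end LCP

open CategoryTheory
namespace LCP
noncomputable section

variable {R : Type} [CommRing R] {a : Ideal R} {i : ℕ}
variable {N N' N'' : Type} [AddCommGroup N] [Module R N] [AddCommGroup N'] [Module R N'] [AddCommGroup N''] [Module R N'']

lemma finsupp_span [IsNoetherianRing R] {J : Type} (w : H a i (J →₀ N)) : 
    ∃ s : Finset J, w = ∑ j ∈ s, Hmap a i (Finsupp.lsingle j) (Hmap a i (Finsupp.lapply (R := R) j) w) := by
  classical
  obtain ⟨N0, ⟨S, hS⟩, z, rfl⟩ := H_fg w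
  let s : Finset J := S.biUnion (fun f => f.support)
  have hs : N0 ≤ LinearMap.ker ((LinearMap.id : (J →₀ N) →ₗ[R] (J →₀ N)) - ∑ j ∈ s, Finsupp.lsingle j ∘ₗ Finsupp.lapply j) := by
    rw [← hS, Submodule.span_le]
    intro f hf
    rw [SetLike.mem_coe, LinearMap.mem_ker, LinearMap.sub_apply, sub_eq_zero, LinearMap.sum_apply]
    ext j
    simp only [LinearMap.id_apply, LinearMap.comp_apply, Finsupp.lapply_apply, Finsupp.lsingle_apply, Finsupp.finsetSum_apply,
      Finsupp.single_apply, Finset.sum_ite_eq']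
    split_ifs with h
    · rfl
    · by_contra h'
      exact h (Finset.mem_biUnion.2 ⟨f, hf, Finsupp.mem_support_iff.2 h'⟩)
  refine ⟨s, ?_⟩
  simp only [← Hmap_comp]
  rw [← Hmap_sum]
  refine DFunLike.congr_fun (congrArg (Hmap a i) ?_) z
  ext1 x
  have := hs x.2
  rw [LinearMap.mem_ker, LinearMap.sub_apply, sub_eq_zero] at this
  simpa using this

/-- the map `(p →₀ M) → M` -/
def sumMap (p : Ideal R) (N : Type) [AddCommGroup N] [Module R N] : (p →₀ N) →ₗ[R] N :=
  Finsupp.lsum R (fun r : p => (r : R) • (LinearMap.id : N →ₗ[R] N))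

lemma sumMap_range (p : Ideal R) : LinearMap.range (sumMap p N) = p • (⊤ : Submodule R N) := by
  apply le_antisymm
  · rintro _ ⟨f, rfl⟩
    induction f using Finsupp.induction_linear with
    | zero => simp
    | add f g hf hg => rw [map_add]; exact add_mem hf hg
    | single r x => 
      have : sumMap p N (Finsupp.single r x) = (r : R) • x := by simp [sumMap]
      rw [this]
      exact Submodule.smul_mem_smul r.2 trivial
  · rw [Submodule.smul_le]
    intro r hr x _
    exact ⟨Finsupp.single ⟨r, hr⟩ x, by simp [sumMap]⟩

theorem quot_ker [IsNoetherianRing R] (c : ℕ) (hR : ∀ Q : PrimeSpectrum R, Order.coheight Q ≤ c)  (p : Ideal R) (z : H a c N) 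
    (hz : Hmap a c (p • (⊤ : Submodule R N)).mkQ z = 0) : z ∈ p • (⊤ : Submodule R (H a c N)) := by
  have h1 : Function.Exact (sumMap p N) (p • (⊤ : Submodule R N)).mkQ := by
    intro x
    rw [← LinearMap.mem_ker, Submodule.ker_mkQ, ← sumMap_range]
    rfl
  obtain ⟨w, rfl⟩ := (H_rexact (a := a) _ _ (Submodule.mkQ_surjective _) h1 (groth_all c hR _) z).1 hz
  obtain ⟨s, hs⟩ := finsupp_span w
  rw [hs, map_sum]
  refine Submodule.sum_mem _ (fun r hr => ?_)
  rw [← Hmap_comp]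
  have : sumMap p N ∘ₗ Finsupp.lsingle r = (r : R) • LinearMap.id := by
    ext x; simp [sumMap]
  rw [this, Hmap_smul_id]
  exact Submodule.smul_mem_smul r.2 trivial

lemma quot_kill (p : Ideal R) : p ≤ Module.annihilator R (N ⧸ (p • (⊤ : Submodule R N))) := by
  intro r hr
  rw [Module.mem_annihilator]
  intro x
  obtain ⟨x, rfl⟩ := Submodule.Quotient.mk_surjective _ x
  rw [← Submodule.Quotient.mk_smul, Submodule.Quotient.mk_eq_zero]
  exact Submodule.smul_mem_smul hr trivial

lemma minimal_of_coheight {P : PrimeSpectrum R} (c : ℕ) (hR : ∀ Q : PrimeSpectrum R, Order.coheight Q ≤ c)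
    (hP : c ≤ Order.coheight P) : P.1 ∈ minimalPrimes R := by
  refine ⟨⟨P.2, bot_le⟩, fun q hq hqP => ?_⟩
  by_contra h
  have : (⟨q, hq.1⟩ : PrimeSpectrum R) < P := lt_of_le_not_ge hqP h
  exact absurd (lt_of_lt_succ_coheight this (hR _)) (not_lt.2 hP)

lemma ass_of_coheight [IsNoetherianRing R] {P : PrimeSpectrum R} (c : ℕ) (hR : ∀ Q : PrimeSpectrum R, Order.coheight Q ≤ c)
    (hP : c ≤ Order.coheight P) : P.1 ∈ associatedPrimes R R := by
  apply Module.associatedPrimes.minimalPrimes_annihilator_subset_associatedPrimes R R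
  have := minimal_of_coheight c hR hP
  have h0 : Module.annihilator R R = ⊥ := by
    rw [Module.annihilator_eq_bot]; infer_instance
  rw [h0]
  exact this

/-- if `F(N) ≠ 0` with `N` killed by a prime `p` then `coheight p = c`. -/
lemma coheight_of_ne [IsNoetherianRing R] (d : ℕ) [Module.Finite R N] (P : PrimeSpectrum R) (hP : P.1 ≤ Module.annihilator R N)
    (h : ¬ Subsingleton (H a d N)) : d ≤ Order.coheight P := by
  by_contra hlt
  apply h
  apply groth
  intro Q hQ
  exact lt_of_le_of_lt (Order.coheight_anti (hP.trans (Module.annihilator_le_of_mem_support hQ))) (not_le.1 hlt)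

/-- direction 1 -/
theorem att_sub [IsNoetherianRing R] (c : ℕ) (hR : ∀ Q : PrimeSpectrum R, Order.coheight Q ≤ c) [Module.Finite R N]
    (P : PrimeSpectrum R) (S : Submodule R (H a c N)) (hS : P.1 = Module.annihilator R (H a c N ⧸ S)) :
    ¬ Subsingleton (H a c (N ⧸ (P.1 • (⊤ : Submodule R N)))) := by
  intro hsub
  apply P.2.ne_top
  rw [hS, Module.annihilator_eq_top_iff, Submodule.Quotient.subsingleton_iff, eq_top_iff]
  rintro z -
  have h1 := quot_ker c hR P.1 z (Subsingleton.elim _ _)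
  have h2 : P.1 • (⊤ : Submodule R (H a c N)) ≤ S := by
    rw [Submodule.smul_le]
    intro r hr x _
    rw [hS] at hr
    rw [← Submodule.Quotient.mk_eq_zero, Submodule.Quotient.mk_smul]
    exact Module.mem_annihilator.1 hr _
  exact h2 h1

/-- direction 2 -/
theorem ass_sub [IsNoetherianRing R] (c : ℕ) (hR : ∀ Q : PrimeSpectrum R, Order.coheight Q ≤ c) [Module.Finite R N]
    (P : PrimeSpectrum R) (x : R) (hx : ∀ r, r ∈ P.1 ↔ r * x = 0) (hA : ∃ z : H a c N, x • z ≠ 0) : 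
    ∃ S : Submodule R (H a c N), P.1 = Module.annihilator R (H a c N ⧸ S) := by
  refine ⟨P.1 • ⊤, le_antisymm (quot_kill _) ?_⟩
  let N1 := N ⧸ (P.1 • (⊤ : Submodule R N))
  let g : N →ₗ[R] N1 := (P.1 • (⊤ : Submodule R N)).mkQ
  have hg : Function.Surjective g := Submodule.mkQ_surjective _
  have hker : ∀ z ∈ P.1 • (⊤ : Submodule R (H a c N)), x • z = 0 := by
    have : P.1 • (⊤ : Submodule R (H a c N)) ≤ LinearMap.ker (LinearMap.lsmul R (H a c N) x) := by
      rw [Submodule.smul_le]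
      intro r hr z _
      change x • r • z = 0
      rw [smul_smul, mul_comm, (hx r).1 hr, zero_smul]
    exact fun z hz => this hz
  obtain ⟨z, hz⟩ := hA
  have hz' : Hmap a c g z ≠ 0 := fun h => hz (hker z (quot_ker c hR P.1 z h))
  have hco := coheight_of_ne (a := a) c (N := N1) P (quot_kill _) (fun h => hz' (Subsingleton.elim _ _))
  intro s hs
  by_contra hsP
  have h1 : ∃ w, s • w = Hmap a c g z := smul_surj c s (fun Q _ => hR Q) 
    (fun Q hQ => lt_of_lt_succ_coheight (qs_supp_lt (quot_kill P.1) s hsP hQ) (hR P)) _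
  obtain ⟨w, hw⟩ := h1
  obtain ⟨w, rfl⟩ := H_surj_ker (a := a) g hg (groth_all c hR _) w
  apply hz'
  rw [← hw]
  have h2 : s • w ∈ P.1 • (⊤ : Submodule R (H a c N)) := by
    have := Module.mem_annihilator.1 hs (Submodule.Quotient.mk w)
    rwa [← Submodule.Quotient.mk_smul, Submodule.Quotient.mk_eq_zero] at this
  rw [← map_smul]
  have h3 : P.1 • (⊤ : Submodule R (H a c N)) ≤ LinearMap.ker (Hmap a c g) := by
    rw [Submodule.smul_le]
    intro r hr y _
    rw [LinearMap.mem_ker, map_smul, ← Hmap_smul_id, ← Hmap_comp]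
    have : (r • LinearMap.id) ∘ₗ g = 0 := by
      ext u
      exact Module.mem_annihilator.1 (quot_kill P.1 hr) (g u)
    rw [this, Hmap_zero]
  exact h3 h2

end
end LCP

open CategoryTheory
namespace LCP
noncomputable section
open TensorProduct

variable {R : Type} [CommRing R] {a : Ideal R} {i : ℕ}
variable (N X : Type) [AddCommGroup N] [Module R N] [AddCommGroup X] [Module R X]

/-- `(X →₀ N) → N ⊗ X` -/
def tmap : (X →₀ N) →ₗ[R] N ⊗[R] X := Finsupp.lsum R (fun x => (TensorProduct.mk R N X).flip x)

lemma tmap_single (x : X) (n : N) : tmap (R := R) N X (Finsupp.single x n) = n ⊗ₜ x := by simp [tmap]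

lemma tmap_surj : Function.Surjective (tmap (R := R) N X) := by
  intro t
  induction t using TensorProduct.induction_on with
  | zero => exact ⟨0, map_zero _⟩
  | tmul n x => exact ⟨_, tmap_single N X x n⟩
  | add t u ht hu =>
    obtain ⟨y, rfl⟩ := ht
    obtain ⟨z, rfl⟩ := hu
    exact ⟨y + z, map_add _ _ _⟩

/-- relations -/
abbrev relK (R X : Type) [CommRing R] [AddCommGroup X] [Module R X] : Submodule R (X →₀ R) := LinearMap.ker (Finsupp.linearCombination R (id : X → X))

/-- for `k : X →₀ R`, the map `n ↦ (x ↦ k x • n)` -/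
def kmap (k : X →₀ R) : N →ₗ[R] (X →₀ N) := k.sum (fun x r => r • Finsupp.lsingle x)

lemma kmap_add (k l : X →₀ R) : kmap N X (k + l) = kmap N X k + kmap N X l := by
  classical
  unfold kmap
  rw [Finsupp.sum_add_index']
  · intro x; simp
  · intro x r s; rw [add_smul]

lemma kmap_single (x : X) (r : R) : kmap N X (Finsupp.single x r) = r • Finsupp.lsingle x := by
  unfold kmap
  rw [Finsupp.sum_single_index]; simp

lemma kmap_apply (k : X →₀ R) (n : N) (x : X) : kmap N X k n x = k x • n := by
  induction k using Finsupp.induction_linear with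
  | zero => simp [kmap]
  | add f g hf hg => rw [kmap_add, LinearMap.add_apply, Finsupp.add_apply, hf, hg, Finsupp.add_apply, add_smul]
  | single y r => 
    classical
    rw [kmap_single, LinearMap.smul_apply, Finsupp.lsingle_apply, Finsupp.smul_apply, Finsupp.single_apply, Finsupp.single_apply]
    split_ifs <;> simp

lemma tmap_kmap (k : X →₀ R) (n : N) : tmap (R := R) N X (kmap N X k n) = n ⊗ₜ (Finsupp.linearCombination R id k) := by
  induction k using Finsupp.induction_linear with
  | zero => simp [kmap]
  | add f g hf hg => rw [kmap_add, LinearMap.add_apply, map_add, hf, hg, map_add, TensorProduct.tmul_add]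
  | single y r => 
    rw [kmap_single, LinearMap.smul_apply, map_smul, Finsupp.lsingle_apply, tmap_single]
    simp

def rmap : (relK R X →₀ N) →ₗ[R] (X →₀ N) := Finsupp.lsum R (fun k => kmap N X k.1)

lemma rmap_single (k : relK R X) (n : N) : rmap N X (Finsupp.single k n) = kmap N X k.1 n := by simp [rmap]

lemma rel_exact : Function.Exact (rmap (R := R) N X) (tmap (R := R) N X) := by
  classical
  have hle : LinearMap.range (rmap (R := R) N X) ≤ LinearMap.ker (tmap (R := R) N X) := by
    rintro _ ⟨f, rfl⟩
    induction f using Finsupp.induction_linear with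
    | zero => simp
    | add f g hf hg => rw [map_add]; exact add_mem hf hg
    | single k n => 
      rw [rmap_single, LinearMap.mem_ker, tmap_kmap, LinearMap.mem_ker.1 k.2, TensorProduct.tmul_zero]
  let C := (X →₀ N) ⧸ LinearMap.range (rmap (R := R) N X)
  have key : ∀ (k : X →₀ R) (hk : k ∈ relK R X) (n : N), (Submodule.Quotient.mk (kmap N X k n) : C) = 0 := by
    intro k hk n
    rw [Submodule.Quotient.mk_eq_zero]
    exact ⟨Finsupp.single ⟨k, hk⟩ n, rmap_single N X _ _⟩
  let inv : N ⊗[R] X →ₗ[R] C := TensorProduct.lift (LinearMap.mk₂ R (fun n x => (Submodule.Quotient.mk (Finsupp.single x n) : C))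
    (fun n n' x => by rw [Finsupp.single_add, Submodule.Quotient.mk_add])
    (fun r n x => by rw [← Finsupp.smul_single, Submodule.Quotient.mk_smul])
    (fun n x y => by
      have := key (Finsupp.single (x + y) 1 - Finsupp.single x 1 - Finsupp.single y 1) (by simp [relK, add_sub_cancel_left]) n
      have e : kmap N X (Finsupp.single (x + y) 1 - Finsupp.single x 1 - Finsupp.single y 1 : X →₀ R) n = 
          Finsupp.single (x + y) n - (Finsupp.single x n + Finsupp.single y n) := by
        ext u
        rw [kmap_apply]
        simp only [Finsupp.sub_apply, Finsupp.add_apply, Finsupp.single_apply, sub_smul, ite_smul, one_smul, zero_smul, sub_sub, add_smul]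
      rw [e, Submodule.Quotient.mk_sub, sub_eq_zero, Submodule.Quotient.mk_add] at this
      exact this)
    (fun r n x => by
      have := key (Finsupp.single (r • x) 1 - Finsupp.single x r) (by simp [relK]) n
      have e : kmap N X (Finsupp.single (r • x) 1 - Finsupp.single x r : X →₀ R) n = 
          Finsupp.single (r • x) n - r • Finsupp.single x n := by
        ext u
        rw [kmap_apply]
        simp only [Finsupp.sub_apply, Finsupp.smul_apply, Finsupp.single_apply, sub_smul, ite_smul, one_smul, zero_smul, smul_ite, smul_zero]
      rw [e, Submodule.Quotient.mk_sub, sub_eq_zero, Submodule.Quotient.mk_smul] at this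
      exact this))
  have hinv : inv ∘ₗ tmap N X = Submodule.mkQ _ := by
    ext x n
    simp only [LinearMap.comp_apply, Finsupp.lsingle_apply, tmap_single]
    rfl
  intro y
  constructor
  · intro hy
    have := LinearMap.congr_fun hinv y
    rw [LinearMap.comp_apply, hy, map_zero] at this
    exact (Submodule.Quotient.mk_eq_zero _).1 this.symm
  · intro h; exact hle h

variable {N X}

theorem ten_inj [IsNoetherianRing R] (c : ℕ) (hR : ∀ Q : PrimeSpectrum R, Order.coheight Q ≤ c) (z : H a c N) (x : X)
    (hz : Hmap a c ((TensorProduct.mk R N X).flip x) z = 0) : z ⊗ₜ[R] x = (0 : H a c N ⊗[R] X) := by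
  classical
  have e1 : (TensorProduct.mk R N X).flip x = tmap N X ∘ₗ Finsupp.lsingle x := by
    ext n; simp [tmap_single]
  rw [e1, Hmap_comp] at hz
  obtain ⟨w, hw⟩ := (H_rexact (a := a) _ _ (tmap_surj N X) (rel_exact N X) (groth_all c hR _) _).1 hz
  obtain ⟨s, hs⟩ := finsupp_span w
  set v : relK R X → H a c N := fun k => Hmap a c (Finsupp.lapply (R := R) k) w with hv
  have h2 : ∀ y : X, (if x = y then z else 0) = ∑ k ∈ s, k.1 y • v k := by
    intro y
    have := congrArg (Hmap a c (Finsupp.lapply (R := R) y)) hw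
    rw [hs, map_sum, map_sum, ← Hmap_comp] at this
    have e2 : Finsupp.lapply (R := R) y ∘ₗ Finsupp.lsingle (M := N) x = (if x = y then (1 : R) else 0) • LinearMap.id := by
      ext n
      simp only [LinearMap.comp_apply, Finsupp.lsingle_apply, Finsupp.lapply_apply, Finsupp.single_apply, LinearMap.smul_apply, LinearMap.id_apply]
      split_ifs <;> simp
    rw [e2, Hmap_smul_id] at this
    have e3 : ∀ k ∈ s, Hmap a c (Finsupp.lapply (R := R) y) (Hmap a c (rmap N X) (Hmap a c (Finsupp.lsingle k) (v k))) = k.1 y • v k := by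
      intro k _
      rw [← Hmap_comp, ← Hmap_comp, ← Hmap_smul_id]
      congr 2
      ext n
      simp [rmap_single, kmap_apply]
    rw [← Finset.sum_congr rfl e3]
    refine Eq.trans ?_ this.symm
    split_ifs <;> simp
  let T : Finset X := insert x (s.biUnion fun k => k.1.support)
  have h3 : z ⊗ₜ[R] x = ∑ y ∈ T, (if x = y then z else 0) ⊗ₜ[R] y := by
    rw [Finset.sum_eq_single x]
    · simp
    · intro y _ h; rw [if_neg (Ne.symm h), TensorProduct.zero_tmul]
    · intro h; exact absurd (Finset.mem_insert_self _ _) h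
  rw [h3]
  simp only [h2, TensorProduct.sum_tmul, TensorProduct.smul_tmul]
  rw [Finset.sum_comm]
  refine Finset.sum_eq_zero (fun k hk => ?_)
  rw [← TensorProduct.tmul_sum]
  have h4 : ∑ y ∈ T, k.1 y • y = Finsupp.linearCombination R (id : X → X) k.1 := by
    rw [Finsupp.linearCombination_apply, Finsupp.sum]
    symm
    apply Finset.sum_subset
    · intro y hy
      exact Finset.mem_insert_of_mem (Finset.mem_biUnion.2 ⟨k, hk, hy⟩)
    · intro y _ hy
      rw [Finsupp.notMem_support_iff.1 hy, zero_smul]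
  rw [h4, LinearMap.mem_ker.1 k.2, TensorProduct.tmul_zero]

theorem ten_kills [IsNoetherianRing R] (c : ℕ) (hR : ∀ Q : PrimeSpectrum R, Order.coheight Q ≤ c) (r : R)
    (h : ∀ z : H a c N, r • z = 0) (z : H a c (N ⊗[R] X)) : r • z = 0 := by
  classical
  obtain ⟨w, rfl⟩ := H_surj_ker (a := a) _ (tmap_surj (R := R) N X) (groth_all c hR _) z
  obtain ⟨s, hs⟩ := finsupp_span w
  rw [hs, ← map_smul, Finset.smul_sum]
  rw [Finset.sum_eq_zero, map_zero]
  intro x _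
  rw [← map_smul, h, map_zero]

end
end LCP

open CategoryTheory
namespace LCP
noncomputable section

section hull
variable {R : Type} [CommRing R]

/-- every nonzero element of `E` has a nonzero multiple in `K` -/
def Ess {I : Type} [AddCommGroup I] [Module R I] (K E : Submodule R I) : Prop :=
  ∀ x ∈ E, x ≠ 0 → ∃ r : R, r • x ≠ 0 ∧ r • x ∈ K

lemma exists_ess {I : Type} [AddCommGroup I] [Module R I] [Module.Injective R I] (K : Submodule R I) :
    ∃ E : Submodule R I, K ≤ E ∧ Ess K E ∧ Module.Injective R E := by
  obtain ⟨E, hKE, hE⟩ := zorn_le_nonempty₀ {E : Submodule R I | K ≤ E ∧ Ess K E} (by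
    intro c hc hchain y hy
    refine ⟨sSup c, ⟨(hc hy).1.trans (le_sSup hy), ?_⟩, fun z hz => le_sSup hz⟩
    intro x hx hx0
    obtain ⟨z, hz, hxz⟩ := (Submodule.mem_sSup_of_directed ⟨y, hy⟩ hchain.directedOn).1 hx
    exact (hc hz).2 x hxz hx0) K ⟨le_rfl, fun x hx hx0 => ⟨1, by simpa, by simpa⟩⟩
  obtain ⟨N, -, hN⟩ := zorn_le_nonempty₀ {N : Submodule R I | ∀ x ∈ N, x ∈ E → x = 0} (by
    intro c hc hchain y hy
    refine ⟨sSup c, ?_, fun z hz => le_sSup hz⟩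
    intro x hx hxE
    obtain ⟨z, hz, hxz⟩ := (Submodule.mem_sSup_of_directed ⟨y, hy⟩ hchain.directedOn).1 hx
    exact hc hz x hxz hxE) ⊥ (by simp)
  have key : ∀ x ∉ N, ∃ n ∈ N, ∃ r : R, n + r • x ∈ E ∧ n + r • x ≠ 0 := by
    intro x hx
    by_contra hcon
    push Not at hcon
    apply hx
    have : N ⊔ Submodule.span R {x} ≤ N := hN.2 (by
      intro y hy hyE
      obtain ⟨n, hn, w, hw, rfl⟩ := Submodule.mem_sup.1 hy
      obtain ⟨r, rfl⟩ := Submodule.mem_span_singleton.1 hw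
      exact hcon n hn r hyE) le_sup_left
    exact this (Submodule.mem_sup_right (Submodule.mem_span_singleton_self x))
  have hinj : Function.Injective (N.mkQ ∘ₗ E.subtype) := by
    rw [← LinearMap.ker_eq_bot, LinearMap.ker_eq_bot']
    intro e he
    have : (e : I) ∈ N := by simpa using he
    exact Subtype.ext (hN.1 e this e.2)
  obtain ⟨h0, hh0⟩ := Module.Injective.out (N.mkQ ∘ₗ E.subtype) hinj E.subtype
  set h : I →ₗ[R] I := h0 ∘ₗ N.mkQ with hh
  have hE' : ∀ e ∈ E, h e = e := fun e he => hh0 ⟨e, he⟩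
  have hN' : ∀ n ∈ N, h n = 0 := by
    intro n hn
    have : N.mkQ n = 0 := by simpa using hn
    rw [hh, LinearMap.comp_apply, this, map_zero]
  have hr : LinearMap.range h ≤ E := by
    refine hE.2 ⟨?_, ?_⟩ ?_
    · exact fun x hx => ⟨x, hE' x (hE.1.1 hx)⟩
    · rintro _ ⟨x, rfl⟩ hx0
      have hxN : x ∉ N := fun hx => hx0 (hN' x hx)
      obtain ⟨n, hn, r, h1, h2⟩ := key x hxN
      obtain ⟨s, hs1, hs2⟩ := hE.1.2 _ h1 h2
      have h3 := hE' _ h1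
      rw [map_add, hN' n hn, zero_add, map_smul] at h3
      refine ⟨s * r, ?_, ?_⟩
      · rwa [mul_smul, h3]
      · rwa [mul_smul, h3]
    · exact fun x hx => ⟨x, hE' x hx⟩
  refine ⟨E, hKE, hE.1.2, ⟨?_⟩⟩
  intro X Y _ _ _ _ f hf g
  obtain ⟨k, hk⟩ := Module.Injective.out f hf (E.subtype ∘ₗ g)
  refine ⟨(h.codRestrict E (fun x => hr ⟨x, rfl⟩)) ∘ₗ k, fun x => ?_⟩
  apply Subtype.ext
  simp only [LinearMap.comp_apply, LinearMap.codRestrict_apply, hk]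
  exact hE' _ (g x).2

end hull

open IsLocalRing

lemma exists_hull (B : Type) [CommRing B] [IsLocalRing B] :
    ∃ (E : Type) (_ : AddCommGroup E) (_ : Module B E) (_ : Module.Injective B E) (e0 : E),
      e0 ≠ 0 ∧ (∀ r ∈ maximalIdeal B, r • e0 = 0) ∧
      (∀ x : E, (∀ r ∈ maximalIdeal B, r • x = 0) → ∃ r : B, x = r • e0) := by
  obtain ⟨I, _, _, _, f, hf⟩ := exists_inj B (B ⧸ maximalIdeal B)
  set u := f 1 with hu
  obtain ⟨E, hKE, hess, hinj⟩ := exists_ess (Submodule.span B {u})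
  have hu0 : u ≠ 0 := by
    intro h
    have := hf (h.trans (map_zero f).symm)
    exact one_ne_zero this
  refine ⟨E, inferInstance, inferInstance, hinj, ⟨u, hKE (Submodule.mem_span_singleton_self u)⟩, ?_, ?_, ?_⟩
  · intro h; exact hu0 (congrArg Subtype.val h)
  · intro r hr
    apply Subtype.ext
    change r • f 1 = 0
    rw [← map_smul]
    have : r • (1 : B ⧸ maximalIdeal B) = 0 := by
      rw [Algebra.smul_def, mul_one]
      exact Ideal.Quotient.eq_zero_iff_mem.2 hr
    rw [this, map_zero]
  · intro x hx
    by_cases hx0 : x = 0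
    · exact ⟨0, by simp [hx0]⟩
    obtain ⟨r, h1, h2⟩ := hess x x.2 (fun h => hx0 (Subtype.ext h))
    have hr : IsUnit r := by
      by_contra hr
      have := hx r ((mem_maximalIdeal r).2 hr)
      exact h1 (congrArg Subtype.val this)
    obtain ⟨v, rfl⟩ := hr
    obtain ⟨s, hs⟩ := Submodule.mem_span_singleton.1 h2
    refine ⟨(↑v⁻¹ : B) * s, Subtype.ext ?_⟩
    change (x : I) = ((↑v⁻¹ : B) * s) • u
    rw [mul_smul, hs, ← mul_smul, Units.inv_mul, one_smul]

end
end LCP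

open CategoryTheory
namespace LCP
noncomputable section
set_option linter.unusedSectionVars false
open IsLocalRing

section gam
variable {R : Type} [CommRing R] [IsNoetherianRing R] {a : Ideal R}
variable {X Y Z : Type} [AddCommGroup X] [Module R X] [AddCommGroup Y] [Module R Y] [AddCommGroup Z] [Module R Z]

lemma gam_mid (f : X →ₗ[R] Y) (g : Y →ₗ[R] Z) (hfg : Function.Exact f g) (hX : Gam a X = ⊤) (y : Y)
    (hy : g y ∈ Gam a Z) : y ∈ Gam a Y := by
  obtain ⟨s, hs⟩ := hy
  set Y' : Submodule R Y := (a ^ s) • Submodule.span R {y} with hY'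
  have hfin : Module.Finite R Y' := by
    rw [Module.Finite.iff_fg]
    exact Submodule.FG.smul (IsNoetherian.noetherian _) (Submodule.fg_span_singleton y)
  have hr : ∀ r ∈ a ^ s, r • y ∈ Gam a Y := by
    intro r hr
    obtain ⟨x, hx⟩ := (hfg (r • y)).1 (by rw [map_smul, hs r hr])
    obtain ⟨t, ht⟩ : x ∈ Gam a X := hX ▸ trivial
    exact ⟨t, fun b hb => by rw [← hx, ← map_smul, ht b hb, map_zero]⟩
  have hle : Y' ≤ Gam a Y := by
    rw [hY', Submodule.smul_le]
    intro r hr' w hw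
    obtain ⟨b, rfl⟩ := Submodule.mem_span_singleton.1 hw
    rw [smul_comm]
    exact Submodule.smul_mem _ _ (hr r hr')
  obtain ⟨t, ht⟩ := tors_bound (a := a) (X := Y') (by
    rw [eq_top_iff]
    rintro x -
    obtain ⟨t, ht⟩ := hle x.2
    exact ⟨t, fun r hr => Subtype.ext (ht r hr)⟩)
  refine ⟨t + s, fun r hr => ?_⟩
  rw [pow_add] at hr
  refine Submodule.mul_induction_on hr ?_ ?_
  · intro b hb d hd
    rw [mul_smul]
    exact congrArg Subtype.val (ht b hb ⟨d • y, Submodule.smul_mem_smul hd (Submodule.mem_span_singleton_self y)⟩)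
  · intro b d hb hd
    rw [add_smul, hb, hd, add_zero]

end gam

/-- injective with simple socle -/
structure IsHull (B : Type) [CommRing B] [IsLocalRing B] (E : Type) [AddCommGroup E] [Module B E] : Prop where
  inj : Module.Injective B E
  soc : ∃ e0 : E, e0 ≠ 0 ∧ (∀ r ∈ maximalIdeal B, r • e0 = 0) ∧
      (∀ x : E, (∀ r ∈ maximalIdeal B, r • x = 0) → ∃ r : B, x = r • e0)

variable {B : Type} [CommRing B] [IsLocalRing B] {E : Type} [AddCommGroup E] [Module B E] 
variable {X Y Z A : Type} [AddCommGroup X] [Module B X] [AddCommGroup Y] [Module B Y] [AddCommGroup Z] [Module B Z]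
  [AddCommGroup A] [Module B A]

lemma dual_sep (hE : IsHull B E) (x : A) (hx : x ≠ 0) : ∃ φ : A →ₗ[B] E, φ x ≠ 0 := by
  obtain ⟨hinj, e0, he0, hme, -⟩ := hE
  set I := LinearMap.ker (LinearMap.toSpanSingleton B A x) with hI
  have hI' : I ≤ maximalIdeal B := by
    apply le_maximalIdeal
    rw [Ne, Ideal.eq_top_iff_one]
    intro h
    exact hx (by simpa [hI] using h)
  obtain ⟨φ, hφ⟩ := Module.Injective.out (R := B) (Submodule.liftQ I (LinearMap.toSpanSingleton B A x) le_rfl)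
    (by rw [← LinearMap.ker_eq_bot]; exact Submodule.ker_liftQ_eq_bot _ _ _ le_rfl)
    (Submodule.liftQ I (LinearMap.toSpanSingleton B E e0) (fun r hr => by
      simpa using hme r (hI' hr)))
  refine ⟨φ, fun h => he0 ?_⟩
  have := hφ (Submodule.Quotient.mk 1)
  rw [Submodule.liftQ_apply, Submodule.liftQ_apply, LinearMap.toSpanSingleton_apply, LinearMap.toSpanSingleton_apply, one_smul, one_smul, h] at this
  exact this.symm

lemma dual_kills (hE : IsHull B E) (v : B) (h : ∀ φ : A →ₗ[B] E, v • φ = 0) (z : A) : v • z = 0 := by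
  by_contra hz
  obtain ⟨φ, hφ⟩ := dual_sep hE _ hz
  apply hφ
  rw [map_smul]
  exact LinearMap.congr_fun (h φ) z

/-- dual of a map -/
abbrev dmap (E : Type) [AddCommGroup E] [Module B E] (f : X →ₗ[B] Y) : (Y →ₗ[B] E) →ₗ[B] (X →ₗ[B] E) :=
  LinearMap.lcomp B E f

lemma dmap_surj (hE : IsHull B E) (f : X →ₗ[B] Y) (hf : Function.Injective f) : Function.Surjective (dmap E f) := by
  have := hE.inj
  intro g
  obtain ⟨h, hh⟩ := Module.Injective.out f hf g
  exact ⟨h, LinearMap.ext hh⟩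

lemma dmap_inj (f : X →ₗ[B] Y) (hf : Function.Surjective f) : Function.Injective (dmap E f) := by
  intro g h hgh
  ext y
  obtain ⟨x, rfl⟩ := hf y
  exact LinearMap.congr_fun hgh x

lemma dmap_exact (hE : IsHull B E) (f : X →ₗ[B] Y) (g : Y →ₗ[B] Z) (hfg : Function.Exact f g) :
    Function.Exact (dmap E g) (dmap E f) := by
  have := hE.inj
  intro φ
  constructor
  · intro h
    have hker : LinearMap.ker g ≤ LinearMap.ker φ := by
      intro y hy
      obtain ⟨x, rfl⟩ := (hfg y).1 hy
      exact LinearMap.congr_fun h x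
    obtain ⟨ψ, hψ⟩ := Module.Injective.out (Submodule.liftQ _ g le_rfl)
      (by rw [← LinearMap.ker_eq_bot]; exact Submodule.ker_liftQ_eq_bot _ _ _ le_rfl)
      (Submodule.liftQ (LinearMap.ker g) φ hker)
    refine ⟨ψ, LinearMap.ext fun y => ?_⟩
    simpa using hψ (Submodule.Quotient.mk y)
  · rintro ⟨ψ, rfl⟩
    ext x
    have : g (f x) = 0 := (hfg _).2 ⟨x, rfl⟩
    simp [this]

/-- `m`-torsion with finitely generated dual -/
def AA (B : Type) [CommRing B] [IsLocalRing B] (E : Type) [AddCommGroup E] [Module B E] (A : Type) [AddCommGroup A] [Module B A] : Prop :=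
  Gam (maximalIdeal B) A = ⊤ ∧ Module.Finite B (A →ₗ[B] E)

lemma AA_sub (hE : IsHull B E) (f : X →ₗ[B] Y) (hf : Function.Injective f) (h : AA B E Y) : AA B E X := by
  obtain ⟨h1, h2⟩ := h
  refine ⟨?_, Module.Finite.of_surjective _ (dmap_surj hE f hf)⟩
  rw [eq_top_iff]
  rintro x -
  obtain ⟨t, ht⟩ : f x ∈ Gam (maximalIdeal B) Y := h1 ▸ trivial
  exact ⟨t, fun r hr => hf (by rw [map_smul, ht r hr, map_zero])⟩

lemma AA_quot [IsNoetherianRing B] (f : X →ₗ[B] Y) (hf : Function.Surjective f) (h : AA B E X) : AA B E Y := by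
  obtain ⟨h1, h2⟩ := h
  exact ⟨Gam_top_of_surj f hf h1, Module.Finite.of_injective _ (dmap_inj (E := E) f hf)⟩

lemma AA_mid [IsNoetherianRing B] (hE : IsHull B E) (f : X →ₗ[B] Y) (g : Y →ₗ[B] Z) (hfg : Function.Exact f g) 
    (hX : AA B E X) (hZ : AA B E Z) : AA B E Y := by
  obtain ⟨h1, h2⟩ := hX
  obtain ⟨h3, h4⟩ := hZ
  refine ⟨?_, ?_⟩
  · rw [eq_top_iff]
    rintro y -
    exact gam_mid f g hfg h1 y (h3 ▸ trivial)
  · have hex := dmap_exact hE f g hfg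
    have h5 : Module.Finite B (LinearMap.range (dmap E g)) := inferInstance
    have h6 : Module.Finite B (LinearMap.range (dmap E f)) := inferInstance
    rw [Module.finite_def]
    refine Submodule.fg_of_fg_map_of_fg_inf_ker (dmap E f) ?_ ?_
    · rw [Submodule.map_top]; exact Module.Finite.iff_fg.1 h6
    · rw [top_inf_eq, hex.linearMap_ker_eq]; exact Module.Finite.iff_fg.1 h5

lemma AA_subsingleton [Subsingleton A] : AA B E A := by
  refine ⟨?_, inferInstance⟩
  rw [eq_top_iff]
  intro x _
  rw [Subsingleton.elim x 0]
  exact zero_mem _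

lemma AA_k [IsNoetherianRing B] (hE : IsHull B E) : AA B E (B ⧸ maximalIdeal B) := by
  refine ⟨?_, ?_⟩
  · rw [eq_top_iff]
    rintro x -
    refine ⟨1, fun r hr => ?_⟩
    rw [pow_one] at hr
    exact Module.mem_annihilator.1 (ann_quot _ hr) x
  · obtain ⟨e0, he0, hme, hs⟩ := hE.soc
    let φ0 : (B ⧸ maximalIdeal B) →ₗ[B] E := Submodule.liftQ _ (LinearMap.toSpanSingleton B E e0) (fun r hr => by
      simpa using hme r hr)
    refine Module.Finite.of_surjective (LinearMap.toSpanSingleton B _ φ0) ?_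
    intro φ
    obtain ⟨r, hr⟩ := hs (φ (Submodule.Quotient.mk 1)) (by
      intro r hr
      rw [← map_smul, ← Submodule.Quotient.mk_smul]
      have : (Submodule.Quotient.mk (r • 1) : B ⧸ maximalIdeal B) = 0 := by
        rw [Submodule.Quotient.mk_eq_zero]; simpa using hr
      rw [this, map_zero])
    refine ⟨r, LinearMap.ext fun x => ?_⟩
    obtain ⟨x, rfl⟩ := Submodule.Quotient.mk_surjective _ x
    have h1 : (Submodule.Quotient.mk x : B ⧸ maximalIdeal B) = x • Submodule.Quotient.mk 1 := by
      rw [← Submodule.Quotient.mk_smul]; simp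
    rw [h1, map_smul, map_smul, hr]
    have h2 : φ0 (Submodule.Quotient.mk 1) = e0 := by
      change (LinearMap.toSpanSingleton B E e0) 1 = e0
      simp
    rw [LinearMap.toSpanSingleton_apply, LinearMap.smul_apply, h2]

lemma dual_haus (h : Gam (maximalIdeal B) A = ⊤) : IsHausdorff (maximalIdeal B) (A →ₗ[B] E) := by
  refine ⟨fun φ hφ => LinearMap.ext fun z => ?_⟩
  obtain ⟨t, ht⟩ : z ∈ Gam (maximalIdeal B) A := h ▸ trivial
  have h1 := SModEq.zero.1 (hφ t)
  rw [LinearMap.zero_apply]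
  refine Submodule.smul_induction_on h1 ?_ ?_
  · intro r hr ψ _
    rw [LinearMap.smul_apply, ← map_smul, ht r hr, map_zero]
  · intro ψ χ h1 h2
    rw [LinearMap.add_apply, h1, h2, add_zero]

lemma mem_smul_pi {R : Type} [CommRing R] (J : Ideal R) {n : ℕ} (x : Fin n → R) : 
    x ∈ (J • ⊤ : Submodule R (Fin n → R)) ↔ ∀ j, x j ∈ J := by
  constructor
  · intro hx j
    refine Submodule.smul_induction_on hx ?_ ?_
    · intro r hr y _
      exact J.mul_mem_right _ hr
    · intro y z hy hz
      exact J.add_mem hy hz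
  · intro h
    rw [pi_eq_sum_univ x]
    exact Submodule.sum_mem _ (fun j _ => Submodule.smul_mem_smul (h j) trivial)

lemma precomplete_pi {R : Type} [CommRing R] {I : Ideal R} [IsAdicComplete I R] (n : ℕ) : IsPrecomplete I (Fin n → R) := by
  refine ⟨fun f hf => ?_⟩
  have key : ∀ j, ∃ L : R, ∀ n, f n j ≡ L [SMOD (I ^ n • ⊤ : Submodule R R)] := by
    intro j
    refine IsPrecomplete.prec' (fun n => f n j) ?_
    intro m n hmn
    have := SModEq.sub_mem.1 (hf hmn)
    rw [mem_smul_pi] at this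
    rw [SModEq.sub_mem, Ideal.smul_eq_mul, Ideal.mul_top]
    exact this j
  choose L hL using key
  refine ⟨L, fun n => ?_⟩
  rw [SModEq.sub_mem, mem_smul_pi]
  intro j
  have := SModEq.sub_mem.1 (hL j n)
  rwa [Ideal.smul_eq_mul, Ideal.mul_top] at this

lemma finite_of_haus [IsNoetherianRing B] [IsAdicComplete (maximalIdeal B) B] {V W : Type} [AddCommGroup V] [Module B V]
    [AddCommGroup W] [Module B W] [Module.Finite B W] [IsHausdorff (maximalIdeal B) V] (π : V →ₗ[B] W)
    (hπ : Function.Surjective π) (f : B) (hf : f ∈ maximalIdeal B) (hk : ∀ v, π v = 0 → ∃ w, v = f • w) :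
    Module.Finite B V := by
  obtain ⟨n, s, hs⟩ := Module.Finite.exists_fin (R := B) (M := W)
  choose v hv using fun i => hπ (s i)
  have hc : IsPrecomplete (maximalIdeal B) (Fin n → B) := precomplete_pi n
  refine Module.Finite.of_surjective (Fintype.linearCombination B v) ?_
  refine surjective_of_mkQ_comp_surjective (I := maximalIdeal B) ?_
  intro x
  obtain ⟨x, rfl⟩ := Submodule.mkQ_surjective _ x
  have hx : π x ∈ Submodule.span B (Set.range s) := by rw [hs]; trivial
  obtain ⟨c, hc⟩ := (Submodule.mem_span_range_iff_exists_fun B).1 hx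
  refine ⟨c, ?_⟩
  obtain ⟨w, hw⟩ := hk (x - Fintype.linearCombination B v c) (by
    rw [map_sub, ← hc, Fintype.linearCombination_apply, map_sum]
    simp [hv])
  rw [LinearMap.comp_apply, eq_comm, ← sub_eq_zero, ← map_sub, hw, Submodule.mkQ_apply, Submodule.Quotient.mk_eq_zero]
  exact Submodule.smul_mem_smul hf trivial

lemma AA_f [IsNoetherianRing B] [IsAdicComplete (maximalIdeal B) B] (hE : IsHull B E) (f : B) (hf : f ∈ maximalIdeal B)
    (h1 : ∀ z : A, ∃ n : ℕ, f ^ n • z = 0) (h2 : AA B E (LinearMap.ker (f • (LinearMap.id : A →ₗ[B] A)))) : AA B E A := by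
  have hex : Function.Exact (LinearMap.ker (f • (LinearMap.id : A →ₗ[B] A))).subtype (f • (LinearMap.id : A →ₗ[B] A)) :=
    LinearMap.exact_subtype_ker_map _
  have hG : Gam (maximalIdeal B) A = ⊤ := by
    rw [eq_top_iff]
    rintro z -
    obtain ⟨n, hn⟩ := h1 z
    induction n generalizing z with
    | zero => 
      have : z = 0 := by simpa using hn
      rw [this]; exact zero_mem _
    | succ n ih => exact gam_mid _ _ hex h2.1 z (ih (z := f • z) (by rwa [pow_succ, mul_smul] at hn))
  refine ⟨hG, ?_⟩
  have := dual_haus (E := E) hG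
  have := h2.2
  refine finite_of_haus (dmap E (LinearMap.ker (f • (LinearMap.id : A →ₗ[B] A))).subtype) (dmap_surj hE _ (Submodule.subtype_injective _)) f hf ?_
  intro φ hφ
  obtain ⟨ψ, hψ⟩ := (dmap_exact hE _ _ hex φ).1 hφ
  refine ⟨ψ, ?_⟩
  rw [← hψ]
  ext x
  simp

end
end LCP

open CategoryTheory
namespace LCP
noncomputable section
set_option linter.unusedSectionVars false
open IsLocalRing

section gen
variable {R : Type} [CommRing R] 

lemma ass_iff [IsNoetherianRing R] {W : Type} [AddCommGroup W] [Module R W] {P : Ideal R} (h : P ∈ associatedPrimes R W) : 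
    ∃ w : W, ∀ r, r ∈ P ↔ r • w = 0 := by
  obtain ⟨_, w, hw⟩ := (⊥ : Submodule R W).isAssociatedPrime_iff.1 h
  refine ⟨w, fun r => ?_⟩
  rw [hw, Submodule.mem_colon_singleton]
  simp

/-- primes of maximal coheight in the support are associated -/
lemma ass_of_top [IsNoetherianRing R] {W : Type} [AddCommGroup W] [Module R W] [Module.Finite R W] (d : ℕ) 
    (h : ∀ Q ∈ Module.support R W, Order.coheight Q ≤ d) {Q : PrimeSpectrum R} (hQ : Q ∈ Module.support R W)
    (hd : ¬ Order.coheight Q < d) : ∃ w : W, ∀ r, r ∈ Q.1 ↔ r • w = 0 := by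
  apply ass_iff
  apply Module.associatedPrimes.minimalPrimes_annihilator_subset_associatedPrimes R W
  refine ⟨⟨Q.2, Module.annihilator_le_of_mem_support hQ⟩, ?_⟩
  rintro P ⟨hP, hPa⟩ hPQ
  by_contra hcon
  have hlt : (⟨P, hP⟩ : PrimeSpectrum R) < Q := lt_of_le_not_ge hPQ hcon
  have hPs : (⟨P, hP⟩ : PrimeSpectrum R) ∈ Module.support R W := by
    rw [Module.support_eq_zeroLocus]; exact hPa
  exact hd (lt_of_lt_succ_coheight hlt (h _ hPs))

end gen

variable {B : Type} [CommRing B] [IsLocalRing B] [IsNoetherianRing B] [IsAdicComplete (maximalIdeal B) B]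
variable {E : Type} [AddCommGroup E] [Module B E] {a : Ideal B}

theorem AA_van (hE : IsHull B E) (i : ℕ) (W : Type) [AddCommGroup W] [Module B W] [hW : Module.Finite B W]
    (h : ∀ P ∈ Module.support B W, AA B E (H a i (B ⧸ P.1))) : AA B E (H a i W) := by
  revert h
  induction hW using IsNoetherianRing.induction_on_isQuotientEquivQuotientPrime B with
  | subsingleton N => intro _; exact AA_subsingleton
  | quotient N p f =>
    intro h
    have := h p (by
      rw [f.support_eq, mem_supp_quot])
    exact AA_sub hE (Hequiv a i f).toLinearMap (Hequiv a i f).injective this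
  | exact N₁ N₂ N₃ f g hf hg hfg h₁ h₃ =>
    intro h
    rw [Module.support_of_exact hfg hf hg] at h
    exact AA_mid hE _ _ (H_exact_mid (a := a) f g hf hg hfg i) (h₁ fun P hP => h P (Or.inl hP)) (h₃ fun P hP => h P (Or.inr hP))

lemma AA_step (hE : IsHull B E) (i : ℕ) {N : Type} [AddCommGroup N] [Module B N] (f : B) (hf : f ∈ maximalIdeal B)
    (hfa : f ∈ a) (hinj : Function.Injective (f • (LinearMap.id : N →ₗ[B] N))) (h : AA B E (H a i (qs f N))) :
    AA B E (H a (i+1) N) := by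
  refine AA_f hE f hf (fun z => ?_) ?_
  · obtain ⟨n, hn⟩ := H_torsion z
    exact ⟨n, hn _ (Ideal.pow_mem_pow hfa n)⟩
  · obtain ⟨δ, -, h2⟩ := H_les (a := a) _ _ hinj (Submodule.mkQ_surjective _) (qs_exact f) i
    have h3 : LinearMap.ker (f • (LinearMap.id : H a (i+1) N →ₗ[B] H a (i+1) N)) = LinearMap.range δ := by
      ext z
      rw [LinearMap.mem_ker, LinearMap.mem_range]
      have := h2 z
      rw [Hmap_smul_id] at this
      exact this
    rw [h3]
    exact AA_quot δ.rangeRestrict δ.surjective_rangeRestrict h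

lemma max_of_coheight {P : PrimeSpectrum B} (h : Order.coheight P ≤ (0 : ℕ)) : P.1 = maximalIdeal B := by
  by_contra hne
  have hle : P.1 ≤ maximalIdeal B := le_maximalIdeal P.2.ne_top
  have hlt : P < (⟨maximalIdeal B, inferInstance⟩ : PrimeSpectrum B) := lt_of_le_of_ne hle (fun h => hne (congrArg PrimeSpectrum.asIdeal h))
  simpa using lt_of_lt_succ_coheight hlt h

lemma H_top_zero {R : Type} [CommRing R] {a : Ideal R} (ha : a = ⊤) (i : ℕ) {N : Type} [AddCommGroup N] [Module R N] : Subsingleton (H a i N) := by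
  refine subsingleton_of_forall_eq 0 (fun z => ?_)
  obtain ⟨n, hn⟩ := H_torsion z
  simpa using hn 1 (by rw [ha, Ideal.top_pow]; trivial)

lemma H_le_zero {R : Type} [CommRing R] [IsNoetherianRing R] {a : Ideal R} {P : Ideal R} (haP : a ≤ P) (i : ℕ) : Subsingleton (H a (i+1) (R ⧸ P)) := by
  apply H_tors_zero
  rw [eq_top_iff]
  rintro x -
  refine ⟨1, fun r hr => ?_⟩
  rw [pow_one] at hr
  exact Module.mem_annihilator.1 (ann_quot P (haP hr)) x

theorem Art (hE : IsHull B E) (d : ℕ) (W : Type) [AddCommGroup W] [Module B W] [Module.Finite B W]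
    (h : ∀ Q ∈ Module.support B W, Order.coheight Q ≤ d) : AA B E (H a d W) := by
  induction d generalizing W with
  | zero => 
    apply AA_van hE
    intro P hP
    have := AA_k hE
    rw [← max_of_coheight (h P hP)] at this
    exact AA_sub hE (h0 a _) h0_inj this
  | succ d ih =>
    apply AA_van hE
    intro P hP
    by_cases haP : a ≤ P.1
    · have := H_le_zero haP d
      exact AA_subsingleton
    by_cases hat : a = ⊤
    · have := H_top_zero hat (d+1) (N := B ⧸ P.1)
      exact AA_subsingleton
    obtain ⟨f, hfa, hfP⟩ := SetLike.not_le_iff_exists.1 haP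
    refine AA_step hE d f (le_maximalIdeal hat hfa) hfa (smul_inj_quot P f hfP) (ih _ ?_)
    intro Q hQ
    have := lt_of_lt_succ_coheight (qs_supp_lt (ann_quot P.1) f hfP hQ) (h P hP)
    exact Order.le_of_lt_add_one (by exact_mod_cast this)

/-- Cayley--Hamilton trick -/
lemma ch_trick {A : Type} [AddCommGroup A] [Module B A] (hE : IsHull B E) (hA : AA B E A) (Θ : A →ₗ[B] A) (v t : B) 
    (h : ∀ z, v • Θ z = t • z) (q : Ideal B) [q.IsPrime] (hv : v ∈ q) (ht : t ∉ q) :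
    ∃ u, u ∉ q ∧ ∀ z : A, u • z = 0 := by
  have := hA.2
  let θ : Module.End B (A →ₗ[B] E) := dmap E Θ
  obtain ⟨p, hp, hpθ⟩ := LinearMap.exists_monic_and_aeval_eq_zero B θ
  have h1 := Polynomial.scaleRoots_aeval_eq_zero (r := v) hpθ
  have h2 : algebraMap B (Module.End B (A →ₗ[B] E)) v * θ = algebraMap B _ t := by
    refine LinearMap.ext fun φ => LinearMap.ext fun z => ?_
    change v • (φ (Θ z)) = t • φ z
    rw [← map_smul, h, map_smul]
  rw [h2, Polynomial.aeval_algebraMap_apply] at h1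
  refine ⟨Polynomial.eval t (p.scaleRoots v), ?_, dual_kills hE _ (fun φ => ?_)⟩
  · rw [Polynomial.eval_eq_sum_range, Finset.sum_range_succ, Polynomial.natDegree_scaleRoots]
    intro hmem
    rw [Ideal.add_mem_iff_right] at hmem
    · rw [Polynomial.coeff_scaleRoots_natDegree, hp.leadingCoeff, one_mul] at hmem
      exact ht (Ideal.IsPrime.mem_of_pow_mem inferInstance _ hmem)
    · refine Ideal.sum_mem _ (fun j hj => ?_)
      rw [Finset.mem_range] at hj
      rw [Polynomial.coeff_scaleRoots]
      exact Ideal.mul_mem_right _ _ (Ideal.mul_mem_left _ _ (Ideal.pow_mem_of_mem _ hv _ (by omega)))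
  · have := LinearMap.congr_fun h1 φ
    rw [Polynomial.coe_aeval_eq_eval] at this
    exact this

end
end LCP

open CategoryTheory
namespace LCP
noncomputable section
set_option linter.unusedSectionVars false
open IsLocalRing

/-- `{x : ∃ t ∉ q, t x ∈ v D}` -/
def Ksub {R : Type} [CommRing R] (q : Ideal R) [hq : q.IsPrime] (v : R) (D : Type) [AddCommGroup D] [Module R D] : Submodule R D where
  carrier := {x | ∃ t ∉ q, ∃ y, t • x = v • y}
  add_mem' := by
    rintro x x' ⟨t, ht, y, h⟩ ⟨t', ht', y', h'⟩
    refine ⟨t * t', fun h => (hq.mem_or_mem h).elim ht ht', t' • y + t • y', ?_⟩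
    rw [smul_add, smul_add, mul_comm, mul_smul, h, mul_comm, mul_smul, h', smul_comm t', smul_comm t]
  zero_mem' := ⟨1, fun h => hq.ne_top ((Ideal.eq_top_iff_one _).2 h), 0, by simp⟩
  smul_mem' := by
    rintro c x ⟨t, ht, y, h⟩
    exact ⟨t, ht, c • y, by rw [smul_comm, h, smul_comm]⟩

lemma Ksub_unif {R : Type} [CommRing R] [IsNoetherianRing R] (q : Ideal R) [hq : q.IsPrime] (v : R) (D : Type) [AddCommGroup D] [Module R D]
    [Module.Finite R D] : ∃ t ∉ q, ∀ x ∈ Ksub q v D, ∃ y, t • x = v • y := by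
  classical
  obtain ⟨s, hs⟩ := (IsNoetherian.noetherian (Ksub q v D) : (Ksub q v D).FG)
  have : ∀ F : Finset D, (F : Set D) ⊆ Ksub q v D → ∃ t ∉ q, ∀ x ∈ F, ∃ y, t • x = v • y := by
    intro F
    induction F using Finset.induction_on with
    | empty => intro _; exact ⟨1, fun h => hq.ne_top ((Ideal.eq_top_iff_one _).2 h), by simp⟩
    | insert x F hx ih =>
      intro hF
      rw [Finset.coe_insert, Set.insert_subset_iff] at hF
      obtain ⟨t, ht, h⟩ := ih hF.2
      obtain ⟨t', ht', y', h'⟩ := hF.1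
      refine ⟨t * t', fun h => (hq.mem_or_mem h).elim ht ht', ?_⟩
      intro z hz
      rcases Finset.mem_insert.1 hz with rfl | hz
      · exact ⟨t • y', by rw [mul_smul, h', smul_comm]⟩
      · obtain ⟨y, hy⟩ := h z hz
        exact ⟨t' • y, by rw [mul_comm, mul_smul, hy, smul_comm]⟩
  obtain ⟨t, ht, h⟩ := this s (hs ▸ Submodule.subset_span)
  refine ⟨t, ht, fun x hx => ?_⟩
  rw [← hs] at hx
  refine Submodule.span_induction (p := fun x _ => ∃ y, t • x = v • y) ?_ ?_ ?_ ?_ hx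
  · exact fun x hx => h x hx
  · exact ⟨0, by simp⟩
  · rintro x x' _ _ ⟨y, hy⟩ ⟨y', hy'⟩
    exact ⟨y + y', by rw [smul_add, smul_add, hy, hy']⟩
  · rintro c x _ ⟨y, hy⟩
    exact ⟨c • y, by rw [smul_comm, hy, smul_comm]⟩

variable {B : Type} [CommRing B] [IsLocalRing B] [IsNoetherianRing B] [IsAdicComplete (maximalIdeal B) B]
variable {a : Ideal B}

theorem LHVT (d : ℕ) (P : PrimeSpectrum B) (hP : Order.coheight P ≤ d) (q : PrimeSpectrum B) (hq : q.1 ≠ maximalIdeal B)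
    (haq : a ≤ q.1) (hPq : P ≤ q) : Subsingleton (H a d (B ⧸ P.1)) := by
  induction d generalizing P with
  | zero => 
    exfalso
    apply hq
    have h1 : P.1 ≤ q.1 := hPq
    rw [max_of_coheight hP] at h1
    exact le_antisymm (le_maximalIdeal q.2.ne_top) h1
  | succ d ih =>
    by_cases hqP : q.1 ≤ P.1
    · exact H_le_zero (haq.trans hqP) d
    obtain ⟨v, hvq, hvP⟩ := SetLike.not_le_iff_exists.1 hqP
    obtain ⟨E, _, _, hinj, hs⟩ := exists_hull B
    have hE : IsHull B E := ⟨hinj, hs⟩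
    set D := B ⧸ P.1 with hD
    set K := Ksub q.1 v D with hK
    have hsupp : ∀ Q ∈ Module.support B (D ⧸ K), P < Q := by
      intro Q hQ
      refine qs_supp_lt (N := D) (ann_quot P.1) v hvP ?_
      refine Module.support_subset_of_surjective (Submodule.factor (p := LinearMap.range (v • (LinearMap.id : D →ₗ[B] D))) (p' := K) ?_) (Submodule.factor_surjective _) hQ
      rintro _ ⟨y, rfl⟩
      exact ⟨1, fun h => q.2.ne_top ((Ideal.eq_top_iff_one _).2 h), y, by simp⟩
    have hsupp' : ∀ Q ∈ Module.support B (D ⧸ K), Order.coheight Q < (d + 1 : ℕ) := fun Q hQ =>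
      lt_of_lt_succ_coheight (hsupp Q hQ) hP
    have hsupp'' : ∀ Q ∈ Module.support B (D ⧸ K), Order.coheight Q ≤ d := fun Q hQ =>
      Order.le_of_lt_add_one (by exact_mod_cast hsupp' Q hQ)
    have h1 : Subsingleton (H a (d+1) (D ⧸ K)) := groth _ _ hsupp'
    have h0 : Subsingleton (H a d (D ⧸ K)) := by
      apply H_van
      intro Q hQ
      by_cases hQd : Order.coheight Q < d
      · apply groth
        intro Q' hQ'
        rw [mem_supp_quot] at hQ'
        exact lt_of_le_of_lt (Order.coheight_anti hQ') hQd
      · refine ih Q (hsupp'' Q hQ) ?_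
        obtain ⟨w, hw⟩ := ass_of_top d hsupp'' hQ hQd
        obtain ⟨x, rfl⟩ := Submodule.Quotient.mk_surjective _ w
        intro s hs
        by_contra hsq
        have hx := (hw s).1 hs
        rw [← Submodule.Quotient.mk_smul, Submodule.Quotient.mk_eq_zero] at hx
        obtain ⟨t, ht, y, hy⟩ := hx
        have hxK : x ∈ K := ⟨t * s, fun h => (q.2.mem_or_mem h).elim ht hsq, y, by rw [mul_smul, hy]⟩
        have : (1 : B) ∈ Q.1 := (hw 1).2 (by rw [one_smul, Submodule.Quotient.mk_eq_zero]; exact hxK)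
        exact Q.2.ne_top ((Ideal.eq_top_iff_one _).2 this)
    have hex : Function.Exact K.subtype K.mkQ := LinearMap.exact_subtype_mkQ K
    have hι1 := H_inj_of (a := a) (i := d) K.subtype K.mkQ K.subtype_injective K.mkQ_surjective hex h0
    have hι2 : Function.Surjective (Hmap a (d+1) K.subtype) := fun z =>
      (H_exact_mid (a := a) K.subtype K.mkQ K.subtype_injective K.mkQ_surjective hex (d+1) z).1 (Subsingleton.elim _ _)
    let ι := LinearEquiv.ofBijective (Hmap a (d+1) K.subtype) ⟨hι1, hι2⟩
    obtain ⟨t, ht, htK⟩ := Ksub_unif q.1 v D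
    let e := LinearEquiv.ofInjective (v • (LinearMap.id : D →ₗ[B] D)) (smul_inj_quot P v hvP)
    let g : K →ₗ[B] D := e.symm.toLinearMap ∘ₗ (LinearMap.codRestrict _ (t • K.subtype) (fun x => by
      obtain ⟨y, hy⟩ := htK x x.2
      exact ⟨y, hy.symm⟩))
    have hg : v • g = t • K.subtype := by
      ext x
      exact congrArg Subtype.val (e.apply_symm_apply (LinearMap.codRestrict _ (t • K.subtype) _ x))
    obtain ⟨u, huq, hu⟩ := ch_trick hE (Art (a := a) hE (d+1) D (fun Q hQ => by
        rw [mem_supp_quot] at hQ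
        exact (Order.coheight_anti (show P ≤ Q from hQ)).trans hP)) (Hmap a (d+1) g ∘ₗ ι.symm.toLinearMap) v t (by
      intro z
      obtain ⟨w, rfl⟩ := ι.surjective z
      change v • Hmap a (d+1) g (ι.symm (ι w)) = t • Hmap a (d+1) K.subtype w
      rw [ι.symm_apply_apply, ← Hmap_smul, hg, Hmap_smul]) q.1 hvq ht
    refine subsingleton_of_forall_eq 0 (fun z => ?_)
    obtain ⟨w, rfl⟩ := smul_surj (a := a) (N := D) (d+1) u (fun Q hQ => by
        rw [mem_supp_quot] at hQ
        exact (Order.coheight_anti (show P ≤ Q from hQ)).trans hP) (fun Q hQ => 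
        lt_of_lt_succ_coheight (qs_supp_lt (ann_quot P.1) u (fun h => huq (hPq h)) hQ) hP) z
    exact hu w

end
end LCP

open CategoryTheory
namespace LCP
noncomputable section
set_option linter.unusedSectionVars false
open IsLocalRing Pointwise

lemma supp_dim_iff {R : Type} [CommRing R] {V : Type} [AddCommGroup V] [Module R V] (n : ℕ) :
    Module.supportDim R V ≤ (n : ℕ∞) ↔ ∀ Q ∈ Module.support R V, Order.coheight Q ≤ n := by
  constructor
  · intro h Q hQ
    have h1 := Order.coheight_eq_krullDim_Ici Q
    have h2 : Order.krullDim (Set.Ici Q) ≤ Order.krullDim (Module.support R V) :=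
      Order.krullDim_le_of_strictMono (fun x => ⟨x.1, Module.mem_support_mono x.2 hQ⟩) (fun x y hxy => hxy)
    rw [← h1] at h2
    exact_mod_cast h2.trans h
  · intro h
    unfold Module.supportDim
    rw [Order.krullDim_eq_iSup_coheight]
    refine iSup_le fun Q => ?_
    have h1 : Order.coheight Q ≤ Order.coheight Q.1 := 
      Order.coheight_le_coheight_apply_of_strictMono (Subtype.val) (fun x y hxy => hxy) Q
    exact_mod_cast h1.trans (h Q.1 Q.2)

variable {B : Type} [CommRing B] [IsLocalRing B] [IsNoetherianRing B] [IsAdicComplete (maximalIdeal B) B]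
variable {E : Type} [AddCommGroup E] [Module B E] {a : Ideal B}
variable {X Y Z : Type} [AddCommGroup X] [Module B X] [AddCommGroup Y] [Module B Y] [AddCommGroup Z] [Module B Z]

/-- `AA` with dual of dimension at most `i` -/
def UU (B : Type) [CommRing B] [IsLocalRing B] (E : Type) [AddCommGroup E] [Module B E] (i : ℕ) (A : Type) [AddCommGroup A] [Module B A] : Prop :=
  AA B E A ∧ ∀ Q ∈ Module.support B (A →ₗ[B] E), Order.coheight Q ≤ i

lemma UU_sub (hE : IsHull B E) {i : ℕ} (f : X →ₗ[B] Y) (hf : Function.Injective f) (h : UU B E i Y) : UU B E i X :=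
  ⟨AA_sub hE f hf h.1, fun Q hQ => h.2 Q (Module.support_subset_of_surjective _ (dmap_surj hE f hf) hQ)⟩

lemma UU_quot {i : ℕ} (f : X →ₗ[B] Y) (hf : Function.Surjective f) (h : UU B E i X) : UU B E i Y :=
  ⟨AA_quot f hf h.1, fun Q hQ => h.2 Q (Module.support_subset_of_injective _ (dmap_inj f hf) hQ)⟩

lemma UU_mid (hE : IsHull B E) {i : ℕ} (f : X →ₗ[B] Y) (g : Y →ₗ[B] Z) (hfg : Function.Exact f g) 
    (hX : UU B E i X) (hZ : UU B E i Z) : UU B E i Y := by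
  refine ⟨AA_mid hE f g hfg hX.1 hZ.1, fun Q hQ => ?_⟩
  have hex := dmap_exact hE f g hfg
  have := Module.support_of_exact (R := B) (f := (LinearMap.ker (dmap E f)).subtype) (g := (dmap E f).rangeRestrict)
    (fun x => by
      rw [← LinearMap.mem_ker, LinearMap.ker_rangeRestrict]
      simp) (Submodule.subtype_injective _) (LinearMap.surjective_rangeRestrict _)
  rw [this] at hQ
  rcases hQ with hQ | hQ
  · rw [hex.linearMap_ker_eq] at hQ
    exact hZ.2 Q (Module.support_subset_of_surjective _ (LinearMap.surjective_rangeRestrict _) hQ)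
  · exact hX.2 Q (Module.support_subset_of_injective _ (Submodule.subtype_injective _) hQ)

lemma UU_subsingleton {i : ℕ} [Subsingleton X] : UU B E i X := by
  refine ⟨AA_subsingleton, ?_⟩
  rw [Module.support_eq_empty_iff.2 inferInstance]
  simp

theorem UU_van (hE : IsHull B E) (j i : ℕ) (W : Type) [AddCommGroup W] [Module B W] [hW : Module.Finite B W]
    (h : ∀ P ∈ Module.support B W, UU B E j (H a i (B ⧸ P.1))) : UU B E j (H a i W) := by
  revert h
  induction hW using IsNoetherianRing.induction_on_isQuotientEquivQuotientPrime B with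
  | subsingleton N => intro _; exact UU_subsingleton
  | quotient N p f =>
    intro h
    have := h p (by
      rw [f.support_eq, mem_supp_quot])
    exact UU_sub hE (Hequiv a i f).toLinearMap (Hequiv a i f).injective this
  | exact N₁ N₂ N₃ f g hf hg hfg h₁ h₃ =>
    intro h
    rw [Module.support_of_exact hfg hf hg] at h
    exact UU_mid hE _ _ (H_exact_mid (a := a) f g hf hg hfg i) (h₁ fun P hP => h P (Or.inl hP)) (h₃ fun P hP => h P (Or.inr hP))

lemma UU_k (hE : IsHull B E) : UU B E 0 (B ⧸ maximalIdeal B) := by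
  refine ⟨AA_k hE, fun Q hQ => ?_⟩
  have hle : maximalIdeal B ≤ Q.1 := by
    refine le_trans ?_ (Module.annihilator_le_of_mem_support hQ)
    intro r hr
    rw [Module.mem_annihilator]
    intro φ
    ext
    rw [LinearMap.comp_apply, LinearMap.comp_apply, LinearMap.smul_apply, ← map_smul, Module.mem_annihilator.1 (ann_quot _ hr), map_zero]
    rfl
  rw [Order.coheight_le_coe_iff]
  intro Q' hQ'
  exfalso
  exact absurd (lt_of_le_of_lt hle hQ') (not_lt_of_ge (le_maximalIdeal Q'.2.ne_top))

lemma UU_step (hE : IsHull B E) (i : ℕ) {N : Type} [AddCommGroup N] [Module B N] (f : B) (hf : f ∈ maximalIdeal B)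
    (hfa : f ∈ a) (hinj : Function.Injective (f • (LinearMap.id : N →ₗ[B] N))) (h : UU B E i (H a i (qs f N))) :
    UU B E (i+1) (H a (i+1) N) := by
  have hAA := AA_step hE i f hf hfa hinj h.1
  refine ⟨hAA, ?_⟩
  have := hAA.2
  obtain ⟨δ, -, h2⟩ := H_les (a := a) _ _ hinj (Submodule.mkQ_surjective _) (qs_exact f) i
  have hrange : UU B E i (LinearMap.range δ) := UU_quot δ.rangeRestrict δ.surjective_rangeRestrict h
  have hex : Function.Exact (LinearMap.range δ).subtype (f • (LinearMap.id : H a (i+1) N →ₗ[B] H a (i+1) N)) := by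
    intro z
    have := h2 z
    rw [Hmap_smul_id] at this
    change f • z = 0 ↔ _
    rw [this]
    simp
  have hdex := dmap_exact hE _ _ hex
  set V := (H a (i+1) N →ₗ[B] E)
  set π := dmap E (LinearMap.range δ).subtype
  have hπ : Function.Surjective π := dmap_surj hE _ (Submodule.subtype_injective _)
  rw [← supp_dim_iff]
  refine (Module.supportDim_le_supportDim_quotSMulTop_succ hf).trans ?_
  have h3 : Module.supportDim B (QuotSMulTop f V) ≤ (i : ℕ∞) := by
    rw [supp_dim_iff]
    intro Q hQ
    refine hrange.2 Q ?_
    have hle : LinearMap.ker π ≤ f • (⊤ : Submodule B V) := by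
      intro φ hφ
      obtain ⟨ψ, rfl⟩ := (hdex φ).1 hφ
      have : dmap E (f • (LinearMap.id : H a (i+1) N →ₗ[B] H a (i+1) N)) ψ = f • ψ := by
        ext z; simp
      rw [this]
      exact Submodule.smul_mem_pointwise_smul _ _ _ trivial
    have h4 := Module.support_subset_of_surjective _ (Submodule.factor_surjective hle) hQ
    rwa [(LinearMap.quotKerEquivOfSurjective π hπ).support_eq] at h4
  calc _ ≤ ((i : ℕ∞) : WithBot ℕ∞) + 1 := by gcongr
    _ = _ := by push_cast; rfl

theorem U2 (hE : IsHull B E) (i : ℕ) (W : Type) [AddCommGroup W] [Module B W] [Module.Finite B W]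
    (h : ∀ Q ∈ Module.support B W, a ≤ Q.1 → Q.1 = maximalIdeal B) : UU B E i (H a i W) := by
  induction i generalizing W with
  | zero => 
    apply UU_van hE
    intro P hP
    by_cases haP : a ≤ P.1
    · have := UU_k hE
      rw [← h P hP haP] at this
      exact UU_sub hE (h0 a _) h0_inj this
    · obtain ⟨f, hfa, hfP⟩ := SetLike.not_le_iff_exists.1 haP
      have : Subsingleton (H a 0 (B ⧸ P.1)) := by
        refine subsingleton_of_forall_eq 0 (fun z => ?_)
        obtain ⟨n, hn⟩ := H_torsion z
        refine tors_inj_zero f (fun z hz => h0_inj ?_) z n (hn _ (Ideal.pow_mem_pow hfa n))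
        refine smul_inj_quot P f hfP ?_
        rw [map_zero, map_zero, LinearMap.smul_apply, LinearMap.id_apply, ← map_smul, hz, map_zero]
      exact UU_subsingleton
  | succ d ih =>
    apply UU_van hE
    intro P hP
    by_cases haP : a ≤ P.1
    · have := H_le_zero haP d
      exact UU_subsingleton
    by_cases hat : a = ⊤
    · have := H_top_zero hat (d+1) (N := B ⧸ P.1)
      exact UU_subsingleton
    obtain ⟨f, hfa, hfP⟩ := SetLike.not_le_iff_exists.1 haP
    refine UU_step hE d f (le_maximalIdeal hat hfa) hfa (smul_inj_quot P f hfP) (ih _ ?_)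
    intro Q hQ
    refine h Q ?_
    exact Module.mem_support_mono (show P ≤ Q from mem_supp_quot.1 (qs_supp f hQ).2) hP

end
end LCP

open CategoryTheory
namespace LCP
noncomputable section
set_option linter.unusedSectionVars false
open IsLocalRing

/-- if `P` of top coheight is in the support of `W` and `H^c(W) = 0` then `H^c(R/P) = 0` -/
lemma nz {R : Type} [CommRing R] [IsNoetherianRing R] {a : Ideal R} (c : ℕ) (hR : ∀ Q : PrimeSpectrum R, Order.coheight Q ≤ c)
    (W : Type) [AddCommGroup W] [Module R W] [Module.Finite R W] (P : PrimeSpectrum R) (hc : c ≤ Order.coheight P)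
    (hP : Module.annihilator R W ≤ P.1) (h : Subsingleton (H a c W)) : Subsingleton (H a c (R ⧸ P.1)) := by
  obtain ⟨K, hK, hmax⟩ := set_has_maximal_iff_noetherian.2 (inferInstance : IsNoetherian R W) 
    {K : Submodule R W | ∀ s ∉ P.1, ∃ w, s • w ∉ K} ⟨⊥, by
      intro s hs
      by_contra hcon
      push Not at hcon
      exact hs (hP (Module.mem_annihilator.2 (fun w => by simpa using hcon w)))⟩
  have hU : Subsingleton (H a c (W ⧸ K)) := by
    have hs : Function.Surjective (Hmap a c K.mkQ) := H_surj_ker _ K.mkQ_surjective (groth_all c hR _)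
    exact hs.subsingleton
  have hPs : P ∈ Module.support R (W ⧸ K) := by
    rw [Module.support_eq_zeroLocus]
    intro s hs
    by_contra hsP
    obtain ⟨w, hw⟩ := hK s hsP
    apply hw
    have := Module.mem_annihilator.1 hs (K.mkQ w)
    rwa [← map_smul, Submodule.mkQ_apply, Submodule.Quotient.mk_eq_zero] at this
  obtain ⟨u, hu⟩ := ass_of_top c (fun Q _ => hR Q) hPs (not_lt_of_ge hc)
  obtain ⟨w0, rfl⟩ := K.mkQ_surjective u
  have hw0 : w0 ∉ K := by
    intro hw0
    have : (1 : R) ∈ P.1 := (hu 1).2 (by rw [one_smul, Submodule.mkQ_apply, Submodule.Quotient.mk_eq_zero]; exact hw0)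
    exact P.2.ne_top ((Ideal.eq_top_iff_one _).2 this)
  have hK' : ∃ s ∉ P.1, ∀ w, s • w ∈ K ⊔ Submodule.span R {w0} := by
    by_contra hcon
    push Not at hcon
    refine hmax (K ⊔ Submodule.span R {w0}) hcon (lt_of_le_of_ne le_sup_left ?_)
    intro heq
    apply hw0
    rw [heq]
    exact Submodule.mem_sup_right (Submodule.mem_span_singleton_self _)
  obtain ⟨s, hs, hsw⟩ := hK'
  let j : (R ⧸ P.1) →ₗ[R] (W ⧸ K) := Submodule.liftQ P.1 (LinearMap.toSpanSingleton R _ (K.mkQ w0)) (fun r hr => (hu r).1 hr)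
  have hj : ∀ r : R, j (Submodule.Quotient.mk r) = r • K.mkQ w0 := fun r => rfl
  have hjinj : Function.Injective j := by
    rw [← LinearMap.ker_eq_bot, LinearMap.ker_eq_bot']
    intro x hx
    obtain ⟨x, rfl⟩ := Submodule.Quotient.mk_surjective _ x
    rw [hj] at hx
    rw [Submodule.Quotient.mk_eq_zero]
    exact (hu x).2 hx
  let e := LinearEquiv.ofInjective j hjinj
  let g : (W ⧸ K) →ₗ[R] (R ⧸ P.1) := e.symm.toLinearMap ∘ₗ (LinearMap.codRestrict _ (s • LinearMap.id) (fun x => by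
    obtain ⟨w, rfl⟩ := K.mkQ_surjective x
    obtain ⟨k, hk, y, hy, hky⟩ := Submodule.mem_sup.1 (hsw w)
    obtain ⟨r, rfl⟩ := Submodule.mem_span_singleton.1 hy
    refine ⟨Submodule.Quotient.mk r, ?_⟩
    rw [hj, LinearMap.smul_apply, LinearMap.id_apply, ← map_smul K.mkQ s, ← hky, map_add]
    have : K.mkQ k = 0 := by simpa using hk
    rw [this, zero_add, map_smul]))
  have hg : ∀ y, j (g y) = s • y := fun y => congrArg Subtype.val (e.apply_symm_apply (LinearMap.codRestrict _ (s • LinearMap.id) _ y))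
  have hgj : g ∘ₗ j = s • LinearMap.id := by
    refine LinearMap.ext fun y => hjinj ?_
    rw [LinearMap.comp_apply, hg, LinearMap.smul_apply, LinearMap.id_apply, map_smul]
  refine subsingleton_of_forall_eq 0 (fun z => ?_)
  obtain ⟨w, rfl⟩ := smul_surj (a := a) (N := R ⧸ P.1) c s (fun Q _ => hR Q) (fun Q hQ => 
        lt_of_lt_succ_coheight (qs_supp_lt (ann_quot P.1) s hs hQ) (hR P)) z
  rw [← Hmap_smul_id, ← hgj, Hmap_comp, Subsingleton.elim (Hmap a c j w) 0, map_zero]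

variable {B : Type} [CommRing B] [IsLocalRing B] [IsNoetherianRing B] [IsAdicComplete (maximalIdeal B) B]
variable {a : Ideal B}

theorem ThmC (c : ℕ) (hR : ∀ Q : PrimeSpectrum B, Order.coheight Q ≤ c) (P : PrimeSpectrum B) (x : B)
    (hx : ∀ r, r ∈ P.1 ↔ r * x = 0) (hne : ¬ Subsingleton (H a c (B ⧸ P.1))) (M : Type) [AddCommGroup M] [Module B M]
    [Module.Finite B M] (hM : ∀ r : B, (∀ m : M, r • m = 0) → r = 0) : ∃ z : H a c M, x • z ≠ 0 := by
  by_contra hcon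
  push Not at hcon
  have hc : c ≤ Order.coheight P := coheight_of_ne (a := a) c P (ann_quot P.1) hne
  have hmax : ∀ Q : PrimeSpectrum B, P ≤ Q → a ≤ Q.1 → Q.1 = maximalIdeal B := by
    intro Q hPQ haQ
    by_contra hQ
    exact hne (LHVT c P (hR P) Q hQ haQ hPQ)
  set T := Ksub P.1 0 M with hT
  obtain ⟨s0, hs0, hs0T⟩ := Ksub_unif P.1 0 M
  let M' := M ⧸ T
  have htf : ∀ s ∉ P.1, ∀ y : M', s • y = 0 → y = 0 := by
    intro s hs y hy
    obtain ⟨y, rfl⟩ := T.mkQ_surjective y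
    rw [← map_smul, Submodule.mkQ_apply, Submodule.Quotient.mk_eq_zero] at hy
    obtain ⟨t, ht, z, hz⟩ := hy
    rw [Submodule.mkQ_apply, Submodule.Quotient.mk_eq_zero]
    exact ⟨t * s, fun h => (P.2.mem_or_mem h).elim ht hs, z, by rw [mul_smul, hz]⟩
  have hsupp : ∀ Q ∈ Module.support B M', P ≤ Q := by
    intro Q hQ
    obtain ⟨Q0, hQ0, hQ0Q⟩ := Ideal.exists_minimalPrimes_le (Module.annihilator_le_of_mem_support hQ)
    have hprime : Q0.IsPrime := hQ0.1.1
    obtain ⟨w, hw⟩ := ass_iff (Module.associatedPrimes.minimalPrimes_annihilator_subset_associatedPrimes B M' hQ0)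
    have hle : Q0 ≤ P.1 := by
      intro s hs
      by_contra hsP
      have hw0 := htf s hsP w ((hw s).1 hs)
      have : (1 : B) ∈ Q0 := (hw 1).2 (by rw [hw0, smul_zero])
      exact hprime.ne_top ((Ideal.eq_top_iff_one _).2 this)
    by_contra hPQ
    have hlt : (⟨Q0, hprime⟩ : PrimeSpectrum B) < P := lt_of_le_not_ge hle (fun h => hPQ (le_trans h hQ0Q))
    exact absurd (lt_of_lt_succ_coheight hlt (hR _)) (not_lt_of_ge hc)
  set L := LinearMap.range (x • (LinearMap.id : M' →ₗ[B] M')) with hL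
  have hxM' : ∀ z : H a c M', x • z = 0 := by
    intro z
    obtain ⟨w, rfl⟩ := H_surj_ker (a := a) (i := c) T.mkQ T.mkQ_surjective (groth_all c hR _) z
    rw [← map_smul, hcon, map_zero]
  have hzero : ∀ z : H a c L, Hmap a c L.subtype z = 0 := by
    intro z
    obtain ⟨w, rfl⟩ := H_surj_ker (a := a) (i := c) (LinearMap.rangeRestrict (x • (LinearMap.id : M' →ₗ[B] M'))) (LinearMap.surjective_rangeRestrict _) (groth_all c hR _) z
    rw [← Hmap_comp]
    have : L.subtype ∘ₗ (LinearMap.rangeRestrict (x • (LinearMap.id : M' →ₗ[B] M'))) = x • LinearMap.id := rfl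
    rw [this, Hmap_smul_id, hxM']
  have hFL : Subsingleton (H a c L) := by
    rcases c with _ | c
    · refine subsingleton_of_forall_eq 0 (fun z => h0_inj (L.subtype_injective ?_))
      rw [← h0_nat, hzero, map_zero, map_zero, map_zero]
    · obtain ⟨δ, -, h2⟩ := H_les (a := a) L.subtype L.mkQ L.subtype_injective L.mkQ_surjective (LinearMap.exact_subtype_mkQ L) c
      obtain ⟨E, _, _, hinj, hs⟩ := exists_hull B
      have hE : IsHull B E := ⟨hinj, hs⟩
      have hU := U2 (a := a) hE c (M' ⧸ L) (fun Q hQ haQ => 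
        hmax Q (hsupp Q (Module.support_subset_of_surjective _ L.mkQ_surjective hQ)) haQ)
      have := hU.1.2
      have hPV : P ∉ Module.support B (H a c (M' ⧸ L) →ₗ[B] E) := by
        intro hP
        have := hc.trans (hU.2 P hP)
        have h3 : c + 1 ≤ c := by exact_mod_cast this
        omega
      rw [Module.support_eq_zeroLocus] at hPV
      obtain ⟨s, hs, hsP⟩ := Set.not_subset.1 hPV
      have hkill : ∀ z : H a (c+1) L, s • z = 0 := by
        intro z
        obtain ⟨w, rfl⟩ := (h2 z).1 (hzero z)
        rw [← map_smul, dual_kills hE s (fun φ => Module.mem_annihilator.1 hs φ), map_zero]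
      refine subsingleton_of_forall_eq 0 (fun z => ?_)
      obtain ⟨w, rfl⟩ := smul_surj (a := a) (N := L) (c+1) s (fun Q _ => hR Q) (fun Q hQ => by
        obtain ⟨h5, h6⟩ := qs_supp s hQ
        have h7 := hsupp Q (Module.support_subset_of_injective _ L.subtype_injective h6)
        exact lt_of_lt_succ_coheight (lt_of_le_of_ne h7 (by rintro rfl; exact hsP h5)) (hR P)) z
      exact hkill w
  refine hne (nz c hR L P hc ?_ hFL)
  intro r hr
  by_contra hrP
  have hz : ∀ m : M, (s0 * x) • m = 0 := by
    intro m
    have h8 := Module.mem_annihilator.1 hr ⟨x • T.mkQ m, ⟨T.mkQ m, rfl⟩⟩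
    have h9 : r • x • T.mkQ m = 0 := congrArg Subtype.val h8
    have h10 := htf r hrP _ h9
    rw [← map_smul, Submodule.mkQ_apply, Submodule.Quotient.mk_eq_zero] at h10
    obtain ⟨y, hy⟩ := hs0T _ h10
    rw [mul_smul, hy, zero_smul]
  exact hs0 ((hx s0).2 (hM _ hz))

end
end LCP

open CategoryTheory
namespace LCP
noncomputable section
set_option linter.unusedSectionVars false

lemma compl_noeth {R : Type} [CommRing R] [IsNoetherianRing R] (m : Ideal R) :
    IsNoetherianRing (AdicCompletion m R) := by
  obtain ⟨n, g, hg⟩ := Submodule.fg_iff_exists_fin_generating_family.1 ((isNoetherianRing_iff_ideal_fg R).1 inferInstance m)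
  let φ : MvPolynomial (Fin n) R →+* R := (MvPolynomial.aeval g : MvPolynomial (Fin n) R →ₐ[R] R).toRingHom
  have hφX : ∀ i, φ (MvPolynomial.X i) = g i := fun i => MvPolynomial.aeval_X g i
  have hφC : ∀ r, φ (MvPolynomial.C r) = r := fun r => MvPolynomial.aeval_C g r
  have hmap : ∀ k, MvPolynomial.idealOfVars (Fin n) R ^ k ≤ (m ^ k).comap φ := by
    intro k
    rw [← Ideal.map_le_iff_le_comap, Ideal.map_pow]
    refine Ideal.pow_right_mono ?_ k
    rw [MvPolynomial.idealOfVars, Ideal.map_span, Ideal.span_le]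
    rintro _ ⟨_, ⟨i, rfl⟩, rfl⟩
    rw [hφX, ← hg]
    exact Submodule.subset_span ⟨i, rfl⟩
  let f : (k : ℕ) → MvPowerSeries (Fin n) R →+* R ⧸ m ^ k := fun k =>
    (Ideal.quotientMap (m ^ k) φ (hmap k)).comp (MvPowerSeries.truncTotalAlgHom (Fin n) R k).toRingHom
  have hf : ∀ {k l : ℕ} (hle : k ≤ l), (Ideal.Quotient.factorPow m hle).comp (f l) = f k := by
    intro k l hle
    ext p
    change Ideal.Quotient.mk _ (φ (MvPowerSeries.truncTotal l p)) = Ideal.Quotient.mk _ (φ (MvPowerSeries.truncTotal k p))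
    rw [Ideal.Quotient.eq, ← map_sub]
    exact hmap k (MvPowerSeries.truncTotal_sub_truncTotal_mem_pow_idealOfVars hle le_rfl p)
  let F := AdicCompletion.liftRingHom m f hf
  have hF : ∀ p : MvPolynomial (Fin n) R, F (p : MvPowerSeries (Fin n) R) = algebraMap R (AdicCompletion m R) (φ p) := by
    intro p
    refine AdicCompletion.ext_evalₐ (fun k => ?_)
    rw [AdicCompletion.evalₐ_liftRingHom, AlgHom.commutes]
    change Ideal.quotientMap (m ^ k) φ (hmap k) ((MvPowerSeries.truncTotalAlgHom (Fin n) R k) (algebraMap (MvPolynomial (Fin n) R) _ p)) = _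
    rw [AlgHom.commutes]
    rfl
  have hmfg : m.FG := (isNoetherianRing_iff_ideal_fg R).1 inferInstance m
  have hI : (Ideal.span (Set.range MvPowerSeries.X) : Ideal (MvPowerSeries (Fin n) R)).map F = m.map (algebraMap R (AdicCompletion m R)) := by
    have hg2 : Ideal.map (algebraMap R (AdicCompletion m R)) m = Ideal.map (algebraMap R (AdicCompletion m R)) (Ideal.span (Set.range g)) := congrArg _ hg.symm
    rw [hg2]
    rw [Ideal.map_span, Ideal.map_span, ← Set.range_comp, ← Set.range_comp]
    congr 2
    ext1 i
    simp only [Function.comp]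
    rw [← MvPolynomial.coe_X, hF, hφX]
  have hc := AdicCompletion.isAdicComplete_self m hmfg
  rw [← hI] at hc
  have hs : Function.Surjective F := by
    have := hc.toIsHausdorff
    refine surjective_of_mk_map_comp_surjective (I := Ideal.span (Set.range MvPowerSeries.X)) F ?_
    intro y
    obtain ⟨b, rfl⟩ := Ideal.Quotient.mk_surjective y
    obtain ⟨r, hr⟩ := Ideal.Quotient.mk_surjective (AdicCompletion.evalOneₐ m b)
    refine ⟨((MvPolynomial.C r : MvPolynomial (Fin n) R) : MvPowerSeries (Fin n) R), ?_⟩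
    rw [RingHom.comp_apply, hF, hφC, Ideal.Quotient.eq, hI, ← AdicCompletion.ker_evalOneₐ_eq_map m hmfg, RingHom.mem_ker, map_sub, sub_eq_zero]
    exact hr
  exact isNoetherianRing_of_surjective _ _ F hs

end
end LCP

open CategoryTheory
namespace LCP
noncomputable section
set_option linter.unusedSectionVars false
open IsLocalRing TensorProduct

lemma compl_dim {R B : Type} [CommRing R] [IsNoetherianRing R] [CommRing B] [IsNoetherianRing B] [IsLocalRing B] [Algebra R B]
    (m : Ideal R) [m.IsMaximal] (hm : maximalIdeal B = m.map (algebraMap R B)) (c : ℕ)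
    (hR : ∀ Q : PrimeSpectrum R, Order.coheight Q ≤ c) (Q : PrimeSpectrum B) : Order.coheight Q ≤ c := by
  classical
  obtain ⟨s, hs, hcard⟩ := Ideal.exists_finset_card_eq_height_of_isNoetherianRing m
  have hmin : maximalIdeal B ∈ (Ideal.span ((s.image (algebraMap R B) : Finset B) : Set B)).minimalPrimes := by
    rw [Finset.coe_image, ← Ideal.map_span]
    refine ⟨⟨inferInstance, ?_⟩, ?_⟩
    · rw [hm]; exact Ideal.map_mono hs.1.2
    · rintro q ⟨hq, hsq⟩ hqm
      have := hq
      rw [hm, Ideal.map_le_iff_le_comap]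
      refine hs.2 ⟨Ideal.IsPrime.comap _, Ideal.map_le_iff_le_comap.1 hsq⟩ ?_
      have hmc : m = (maximalIdeal B).comap (algebraMap R B) := by
        refine (inferInstance : m.IsMaximal).eq_of_le (Ideal.IsPrime.ne_top (Ideal.IsPrime.comap _)) ?_
        rw [hm]; exact Ideal.le_comap_map
      rw [hmc]
      exact Ideal.comap_mono hqm
  have h1 := Ideal.height_le_card_of_mem_minimalPrimes_span_finset hmin
  have h2 : m.height ≤ c := by
    have : Nonempty (PrimeSpectrum R) := ⟨⟨m, inferInstance⟩⟩
    have : (m.height : WithBot ℕ∞) ≤ (c : ℕ∞) := by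
      refine (Ideal.height_le_ringKrullDim_of_ne_top (Ideal.IsPrime.ne_top inferInstance)).trans ?_
      rw [ringKrullDim, Order.krullDim_eq_iSup_coheight_of_nonempty]
      exact WithBot.coe_le_coe.2 (iSup_le hR)
    exact WithBot.coe_le_coe.1 this
  have h3 : (s.card : ℕ∞) ≤ c := hcard ▸ h2
  have h4 : ((s.image (algebraMap R B)).card : ℕ∞) ≤ s.card := by exact_mod_cast Finset.card_image_le
  have h5 : (Order.coheight Q : WithBot ℕ∞) ≤ (c : ℕ∞) := by
    refine (Order.coheight_le_krullDim Q).trans ?_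
    change ringKrullDim B ≤ _
    rw [← IsLocalRing.maximalIdeal_height_eq_ringKrullDim]
    exact WithBot.coe_le_coe.2 (h1.trans (h4.trans h3))
  exact WithBot.coe_le_coe.1 h5

lemma base_faithful {R B : Type} [CommRing R] [CommRing B] [Algebra R B] [Module.Flat R B] (M : Type) [AddCommGroup M] [Module R M]
    [Module.Finite R M] (hM : ∀ r : R, (∀ m : M, r • m = 0) → r = 0) (r : B) (hr : ∀ t : B ⊗[R] M, r • t = 0) : r = 0 := by
  classical
  obtain ⟨n, g, hg⟩ := Module.Finite.exists_fin (R := R) (M := M)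
  let f : R →ₗ[R] (Fin n → M) := LinearMap.toSpanSingleton R _ g
  have hf : Function.Injective f := by
    rw [injective_iff_map_eq_zero]
    intro s hs
    refine hM s (fun m => ?_)
    have hm : m ∈ Submodule.span R (Set.range g) := hg ▸ trivial
    induction hm using Submodule.span_induction with
    | mem x h => obtain ⟨i, rfl⟩ := h; exact congrFun hs i
    | zero => simp
    | add x y _ _ hx hy => rw [smul_add, hx, hy, add_zero]
    | smul t x _ hx => rw [smul_comm, hx, smul_zero]
  have h1 := Module.Flat.lTensor_preserves_injective_linearMap (M := B) f hf
  have h2 : f.lTensor B (r ⊗ₜ 1) = 0 := by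
    have hgs : f 1 = ∑ i, LinearMap.single R (fun _ => M) i (g i) := by
      rw [show f 1 = g by simp [f]]
      exact (Finset.univ_sum_single g).symm
    rw [LinearMap.lTensor_tmul, hgs, tmul_sum]
    refine Finset.sum_eq_zero (fun i _ => ?_)
    rw [← LinearMap.lTensor_tmul]
    have : r ⊗ₜ[R] g i = 0 := by
      have := hr ((1 : B) ⊗ₜ[R] g i)
      rwa [smul_tmul', smul_eq_mul, mul_one] at this
    rw [this, map_zero]
  have h3 : r ⊗ₜ[R] (1 : R) = 0 := h1 (by rw [h2, map_zero])
  have := congrArg (TensorProduct.rid R B) h3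
  simpa using this

lemma ten_ne {R B : Type} [CommRing R] [CommRing B] [Algebra R B] [Module.Flat R B] {A : Type} [AddCommGroup A] [Module R A]
    (z : A) (m : Ideal R) (hm : m.map (algebraMap R B) ≠ ⊤) (hz : ∀ r : R, r • z = 0 → r ∈ m) : z ⊗ₜ[R] (1 : B) ≠ 0 := by
  intro h
  let J : Ideal R := LinearMap.ker (LinearMap.toSpanSingleton R A z)
  let f : (R ⧸ J) →ₗ[R] A := J.liftQ (LinearMap.toSpanSingleton R A z) le_rfl
  have hf : Function.Injective f := by
    rw [← LinearMap.ker_eq_bot, Submodule.ker_liftQ_eq_bot _ _ _ le_rfl]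
  have h1 := Module.Flat.rTensor_preserves_injective_linearMap (M := B) f hf
  have h2 : (Ideal.Quotient.mk J 1) ⊗ₜ[R] (1 : B) = 0 := by
    apply h1
    rw [LinearMap.rTensor_tmul, map_zero, ← h]
    congr 1
    exact one_smul R z
  have h3 := congrArg (TensorProduct.quotTensorEquivQuotSMul B J) h2
  rw [TensorProduct.quotTensorEquivQuotSMul_mk_tmul, map_zero, one_smul, Submodule.Quotient.mk_eq_zero, Ideal.smul_top_eq_map] at h3
  apply hm
  rw [Ideal.eq_top_iff_one]
  exact Ideal.map_mono (fun r hr => hz r hr) h3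

end
end LCP

open CategoryTheory
namespace LCP
noncomputable section
set_option linter.unusedSectionVars false
open IsLocalRing TensorProduct

theorem main3_aux {R B : Type} [CommRing R] [IsNoetherianRing R] [CommRing B] [IsNoetherianRing B] [IsLocalRing B]
    [IsAdicComplete (maximalIdeal B) B] [Algebra R B] [Module.Flat R B]
    (m : Ideal R) [m.IsMaximal] (hm : maximalIdeal B = m.map (algebraMap R B)) {a : Ideal R} (c : ℕ)
    (hR : ∀ Q : PrimeSpectrum R, Order.coheight Q ≤ c) (P : PrimeSpectrum R) (x : R) (hx : ∀ r, r ∈ P.1 ↔ r * x = 0)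
    (z : H a c (R ⧸ P.1)) (hz : ∀ r : R, r • z = 0 → r ∈ m)
    (M : Type) [AddCommGroup M] [Module R M] [Module.Finite R M]
    (hM : ∀ r : R, (∀ m : M, r • m = 0) → r = 0) : ∃ z : H a c M, x • z ≠ 0 := by
  by_contra hcon
  push Not at hcon
  have hB := compl_dim m hm c hR
  have hkM : ∀ w : H (a.map (algebraMap R B)) c (B ⊗[R] M), algebraMap R B x • w = 0 := by
    rw [← kills_base]
    intro w
    have h1 := ten_kills (X := B) c hR x hcon (Hequiv a c (TensorProduct.comm R B M) w)
    rw [← map_smul] at h1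
    exact (Hequiv a c (TensorProduct.comm R B M)).injective (by rw [h1, map_zero])
  have hne : ¬ Subsingleton (H (a.map (algebraMap R B)) c (B ⊗[R] (R ⧸ P.1))) := by
    intro hsub
    have h1 : ∀ w : H a c (B ⊗[R] (R ⧸ P.1)), (1 : R) • w = 0 := by
      rw [kills_base (B := B)]
      intro w
      exact Subsingleton.elim _ _
    refine ten_ne (B := B) z m (by rw [← hm]; exact Ideal.IsPrime.ne_top inferInstance) hz (ten_inj c hR z (1 : B) ?_)
    apply (Hequiv a c (TensorProduct.comm R (R ⧸ P.1) B)).injective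
    rw [map_zero, ← h1 (Hequiv a c (TensorProduct.comm R (R ⧸ P.1) B) _), one_smul]
  have hex : ∃ Q ∈ Module.support B (B ⊗[R] (R ⧸ P.1)), ¬ Subsingleton (H (a.map (algebraMap R B)) c (B ⧸ Q.1)) := by
    by_contra hno
    push Not at hno
    exact hne (H_van _ hno)
  obtain ⟨Q, hQs, hQ⟩ := hex
  have hQc := coheight_of_ne c Q (ann_quot Q.1) hQ
  obtain ⟨w, hw⟩ := ass_of_top c (fun Q _ => hB Q) hQs (not_lt_of_ge hQc)
  let f : (R ⧸ P.1) →ₗ[R] R := P.1.liftQ (LinearMap.toSpanSingleton R R x) (fun r hr => (hx r).1 hr)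
  have hf : Function.Injective f := by
    rw [← LinearMap.ker_eq_bot]
    refine Submodule.ker_liftQ_eq_bot _ _ _ ?_
    intro r hr
    exact (hx r).2 hr
  have hfi : Function.Injective (f.baseChange B) := Module.Flat.lTensor_preserves_injective_linearMap (M := B) f hf
  let ψ : B ⊗[R] (R ⧸ P.1) →ₗ[B] B := (AlgebraTensorModule.rid R B B).toLinearMap ∘ₗ f.baseChange B
  have hψ : Function.Injective ψ := (AlgebraTensorModule.rid R B B).injective.comp hfi
  have hψx : ∀ w, ∃ y, ψ w = y * algebraMap R B x := by
    intro w
    induction w using TensorProduct.induction_on with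
    | zero => exact ⟨0, by simp⟩
    | tmul b r =>
      obtain ⟨r, rfl⟩ := Ideal.Quotient.mk_surjective r
      refine ⟨r • b, ?_⟩
      change (r • x) • b = (r • b) * algebraMap R B x
      rw [smul_eq_mul, Algebra.smul_def, Algebra.smul_def, map_mul]
      ring
    | add u v hu hv =>
      obtain ⟨y, hy⟩ := hu
      obtain ⟨y', hy'⟩ := hv
      exact ⟨y + y', by rw [map_add, hy, hy', add_mul]⟩
  obtain ⟨y, hy⟩ := hψx w
  obtain ⟨t, ht⟩ := ThmC (a := a.map (algebraMap R B)) c hB Q (ψ w) (fun r => by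
    rw [hw, ← smul_eq_mul, ← map_smul, map_eq_zero_iff ψ hψ]) hQ (B ⊗[R] M) (base_faithful M hM)
  apply ht
  rw [hy, mul_smul, hkM, smul_zero]

theorem main3 {R : Type} [CommRing R] [IsNoetherianRing R] {a : Ideal R} (c : ℕ)
    (hR : ∀ Q : PrimeSpectrum R, Order.coheight Q ≤ c) (P : PrimeSpectrum R) (x : R) (hx : ∀ r, r ∈ P.1 ↔ r * x = 0)
    (hne : ¬ Subsingleton (H a c (R ⧸ P.1)))
    (M : Type) [AddCommGroup M] [Module R M] [Module.Finite R M]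
    (hM : ∀ r : R, (∀ m : M, r • m = 0) → r = 0) : ∃ z : H a c M, x • z ≠ 0 := by
  rw [not_subsingleton_iff_nontrivial] at hne
  obtain ⟨z, hz⟩ := exists_ne (0 : H a c (R ⧸ P.1))
  have hJ : LinearMap.ker (LinearMap.toSpanSingleton R _ z) ≠ ⊤ := by
    intro h
    apply hz
    have : (1 : R) ∈ LinearMap.ker (LinearMap.toSpanSingleton R _ z) := h ▸ trivial
    rw [LinearMap.mem_ker] at this
    simpa using this
  obtain ⟨m, hmax, hm⟩ := Ideal.exists_le_maximal _ hJ
  have hmfg : m.FG := (isNoetherianRing_iff_ideal_fg R).1 inferInstance m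
  have := compl_noeth m
  have h1 := AdicCompletion.isAdicComplete_self m hmfg
  have h2 := AdicCompletion.isMaximal_map_of_le m m le_rfl hmfg
  have h3 := isLocalRing_of_isAdicComplete_maximal (m.map (algebraMap R (AdicCompletion m R)))
  have h4 := (IsLocalRing.eq_maximalIdeal h2).symm
  rw [← h4] at h1
  exact main3_aux (B := AdicCompletion m R) m h4 c hR P x hx z (fun r hr => hm hr) M hM

theorem final {R : Type} [CommRing R] [IsNoetherianRing R] (a : Ideal R) (c : ℕ)
    (hR : ∀ Q : PrimeSpectrum R, Order.coheight Q ≤ c) 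
    (M : Type) [AddCommGroup M] [Module R M] [Module.Finite R M]
    (hM : ∀ r : R, (∀ m : M, r • m = 0) → r = 0) :
    Module.annihilator R (H a c M) = ⊥ ↔
      associatedPrimes R R = {p | p.IsPrime ∧ ∃ S : Submodule R (H a c M), p = Module.annihilator R (H a c M ⧸ S)} := by
  have hFne : ∀ (P : PrimeSpectrum R) (S : Submodule R (H a c M)), P.1 = Module.annihilator R (H a c M ⧸ S) →
      c ≤ Order.coheight P ∧ ¬ Subsingleton (H a c (R ⧸ P.1)) := by
    intro P S hS
    have h1 := att_sub c hR P S hS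
    have h2 := coheight_of_ne c P (quot_kill P.1) h1
    refine ⟨h2, fun hsub => h1 (H_van _ (fun Q hQ => ?_))⟩
    have hPQ : P ≤ Q := (quot_kill P.1).trans (Module.annihilator_le_of_mem_support hQ)
    rcases hPQ.eq_or_lt with rfl | hlt
    · exact hsub
    · by_contra hns
      exact absurd (lt_of_lt_succ_coheight hlt (hR P)) (not_lt_of_ge (coheight_of_ne c Q (ann_quot Q.1) hns))
  constructor
  · intro hA
    ext p
    constructor
    · intro hp
      have hpp : p.IsPrime := hp.isPrime
      obtain ⟨x, hx⟩ := ass_iff hp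
      refine ⟨hpp, ass_sub c hR ⟨p, hpp⟩ x hx ?_⟩
      by_contra hno
      push Not at hno
      have : x ∈ Module.annihilator R (H a c M) := Module.mem_annihilator.2 hno
      rw [hA, Ideal.mem_bot] at this
      exact hpp.ne_top ((Ideal.eq_top_iff_one _).2 ((hx 1).2 (by rw [this, smul_zero])))
    · rintro ⟨hpp, S, hS⟩
      exact ass_of_coheight (P := ⟨p, hpp⟩) c hR (hFne ⟨p, hpp⟩ S hS).1
  · intro hE
    rw [eq_bot_iff]
    intro x hx
    by_contra hx0
    obtain ⟨p, hp, hle⟩ := exists_le_isAssociatedPrime_of_isNoetherianRing R (⟨x, hx⟩ : Module.annihilator R (H a c M)) (by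
      intro h; exact hx0 (congrArg Subtype.val h))
    obtain ⟨y, hy⟩ := ass_iff (W := Module.annihilator R (H a c M)) hp
    have hpp := hp.isPrime
    have hpR : p ∈ associatedPrimes R R := associatedPrimes.subset_of_injective (f := (Module.annihilator R (H a c M)).subtype) (Submodule.subtype_injective _) hp
    rw [hE] at hpR
    obtain ⟨-, S, hS⟩ := hpR
    obtain ⟨z, hz⟩ := main3 (a := a) c hR ⟨p, hpp⟩ y.1 (fun r => by
      change r ∈ p ↔ _
      rw [hy, Subtype.ext_iff]; rfl) (hFne ⟨p, hpp⟩ S hS).2 M hM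
    exact hz (Module.mem_annihilator.1 y.2 z)

end
end LCP

theorem stmt2 {R : Type} [CommRing R] [IsNoetherianRing R]
    (a : Ideal R) (M : ModuleCat R) [Module.Finite R M] (hM : Nontrivial M)
    (hfaithful : Module.annihilator R M = ⊥)
    (c : ℕ) (hdim : ringKrullDim (R ⧸ Module.annihilator R M) = (c : WithBot (WithTop ℕ)))
    (hcd : HasCD a M c) :
    Module.annihilator R ((localCohomology a c).obj M) = ⊥ ↔
      associatedPrimes R R = attachedPrimes R ((localCohomology a c).obj M) := by
  have hR : ∀ Q : PrimeSpectrum R, Order.coheight Q ≤ c := by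
    intro Q
    have h1 : ringKrullDim R = (c : WithBot (WithTop ℕ)) := by
      rw [← hdim, hfaithful]
      exact ringKrullDim_eq_of_ringEquiv (RingEquiv.quotientBot R).symm
    have h2 : (Order.coheight Q : WithBot ℕ∞) ≤ ((c : ℕ∞) : WithBot ℕ∞) := by
      refine (Order.coheight_le_krullDim Q).trans ?_
      change ringKrullDim R ≤ _
      rw [h1]
      exact le_rfl
    exact WithBot.coe_le_coe.1 h2
  have hf : ∀ r : R, (∀ m : M, r • m = 0) → r = 0 := by
    intro r hr
    have : r ∈ Module.annihilator R M := Module.mem_annihilator.2 hr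
    rwa [hfaithful, Ideal.mem_bot] at this
  exact LCP.final a c hR M hf
end

section
/- Let R be a Noetherian ring, 𝔞 an ideal of R, and let M, N be nonzero finitely generated R-modules with Supp(N) ⊆ Supp(M). Then cd(𝔞, N) ≤ cd(𝔞, M). -/
open CategoryTheory

section Aux
open CategoryTheory Opposite Limits

noncomputable section
variable {R : Type} [CommRing R]

lemma homologyUnop_nat {V : Type*} [Category V] [Abelian V] {ι : Type*} {c : ComplexShape ι}
   {K L : HomologicalComplex Vᵒᵖ c} (φ : K ⟶ L) (i : ι) :
   (HomologicalComplex.homologyMap φ i).unop ≫ (K.homologyUnop i).inv = (L.homologyUnop i).inv ≫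
     HomologicalComplex.homologyMap ((HomologicalComplex.unopFunctor V c).map φ.op) i := by
  have := HomologicalComplex.homologyOp_hom_naturality ((HomologicalComplex.unopFunctor V c).map φ.op) i
  have h2 := congrArg Quiver.Hom.unop this
  refine (Iso.eq_inv_comp (L.homologyUnop i)).2 ?_
  refine (Category.assoc _ _ _).symm.trans ?_
  refine (Iso.comp_inv_eq (K.homologyUnop i)).2 ?_
  exact h2

def lyMap {X X' : ModuleCat.{0} R} {P : ProjectiveResolution X} {P' : ProjectiveResolution X'} 
  (φ : P'.complex ⟶ P.complex) (Y : ModuleCat.{0} R) :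
  P.complex.linearYonedaObj R Y ⟶ P'.complex.linearYonedaObj R Y :=
  (HomologicalComplex.unopFunctor _ _).map
    ((((linearYoneda R (ModuleCat R)).obj Y).rightOp.mapHomologicalComplex _).map φ).op

lemma lyMap_f {X X' : ModuleCat.{0} R} {P : ProjectiveResolution X} {P' : ProjectiveResolution X'} 
  (φ : P'.complex ⟶ P.complex) (Y : ModuleCat.{0} R) (n : ℕ) (f : P.complex.X n ⟶ Y) :
   (lyMap φ Y).f n f = (φ.f n ≫ f : P'.complex.X n ⟶ Y) := rfl

lemma isoExt_nat {X X' : ModuleCat.{0} R} {P : ProjectiveResolution X} {P' : ProjectiveResolution X'} {g : X' ⟶ X}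
   (φ : P'.complex ⟶ P.complex) (comm : φ.f 0 ≫ P.π.f 0 = P'.π.f 0 ≫ g) (Y : ModuleCat.{0} R) (n : ℕ) :
   ((_root_.Ext R (ModuleCat R) n).map g.op).app Y ≫ (P'.isoExt n Y).hom =
     (P.isoExt n Y).hom ≫ HomologicalComplex.homologyMap (lyMap φ Y) n := by
  have h1 := ProjectiveResolution.isoLeftDerivedObj_inv_naturality g P' P φ comm ((linearYoneda R (ModuleCat R)).obj Y).rightOp n
  have h2 := homologyUnop_nat ((((linearYoneda R (ModuleCat R)).obj Y).rightOp.mapHomologicalComplex _).map φ) n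
  have h1' := congrArg Quiver.Hom.unop h1
  rw [unop_comp, unop_comp] at h1'
  have e1 : ((_root_.Ext R (ModuleCat R) n).map g.op).app Y =
    (((((linearYoneda R (ModuleCat R)).obj Y).rightOp).leftDerived n).map g).unop := rfl
  have e2 : (P'.isoExt (R := R) n Y).hom = (P'.isoLeftDerivedObj ((linearYoneda R (ModuleCat R)).obj Y).rightOp n).inv.unop ≫ 
     (HomologicalComplex.homologyUnop _ n).inv := rfl
  have e3 : (P.isoExt (R := R) n Y).hom = (P.isoLeftDerivedObj ((linearYoneda R (ModuleCat R)).obj Y).rightOp n).inv.unop ≫ 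
     (HomologicalComplex.homologyUnop _ n).inv := rfl
  rw [e1, e2, e3]
  erw [reassoc_of% h1']
  exact congrArg _ h2

lemma d_lin {X : ModuleCat.{0} R} (P : ProjectiveResolution X) (Y : ModuleCat.{0} R) (n m : ℕ) (f : P.complex.X n ⟶ Y) :
   (P.complex.linearYonedaObj R Y).d n m f = (P.complex.d m n ≫ f : P.complex.X m ⟶ Y) := rfl

/-- The classes `x` (derived-functor `Ext`) and `α` (derived-category `Ext`) are represented
by a common cocycle. -/
def ExtRel {X : ModuleCat.{0} R} (P : ProjectiveResolution X) {Y : ModuleCat.{0} R} {n : ℕ} 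
    (x : ((_root_.Ext R (ModuleCat R) n).obj (op X)).obj Y) (α : Abelian.Ext.{0} X Y n) : Prop :=
  ∃ (f : P.complex.X n ⟶ Y) (hf : P.complex.d (n+1) n ≫ f = 0) 
    (z : (P.complex.linearYonedaObj R Y).cycles n),
    (P.isoExt n Y).hom x = (P.complex.linearYonedaObj R Y).homologyπ n z ∧
    (P.complex.linearYonedaObj R Y).iCycles n z = f ∧ P.extMk f (n+1) rfl hf = α

variable {X : ModuleCat.{0} R} (P : ProjectiveResolution X) {Y : ModuleCat.{0} R} {n : ℕ} 

lemma ExtRel.exists_right (x : ((_root_.Ext R (ModuleCat R) n).obj (op X)).obj Y) : ∃ α, ExtRel P x α := by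
  obtain ⟨z, hz⟩ := (ModuleCat.epi_iff_surjective ((P.complex.linearYonedaObj R Y).homologyπ n)).1 inferInstance ((P.isoExt n Y).hom x)
  refine ⟨_, (P.complex.linearYonedaObj R Y).iCycles n z, ?_, z, hz.symm, rfl, rfl⟩
  have := (P.complex.linearYonedaObj R Y).iCycles_d n (n+1)
  exact ConcreteCategory.congr_hom this z

lemma ExtRel.exists_left (α : Abelian.Ext.{0} X Y n) : 
   ∃ x : ((_root_.Ext R (ModuleCat R) n).obj (op X)).obj Y, ExtRel P x α := by
  obtain ⟨f, hf, rfl⟩ := P.extMk_surjective α (n+1) rfl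
  let z : (P.complex.linearYonedaObj R Y).cycles n := (P.complex.linearYonedaObj R Y).cyclesMk (i := n) f (n+1) (by simp) hf
  refine ⟨(P.isoExt n Y).inv ((P.complex.linearYonedaObj R Y).homologyπ n z), f, hf, z, ?_, ?_, rfl⟩
  · rw [← ConcreteCategory.comp_apply, Iso.inv_hom_id]; rfl
  · exact (P.complex.linearYonedaObj R Y).i_cyclesMk (i := n) f (n+1) (by simp) hf

lemma extMk_eq_zero_iff0 (f : P.complex.X 0 ⟶ Y) (hf : P.complex.d 1 0 ≫ f = 0) :
    P.extMk f 1 rfl hf = 0 ↔ f = 0 := by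
  constructor
  · intro h
    simp only [← P.extEquivCohomologyClass.apply_eq_iff_eq,
      ProjectiveResolution.extEquivCohomologyClass_extMk, ProjectiveResolution.extEquivCohomologyClass_zero,
      CochainComplex.HomComplex.CohomologyClass.mk_eq_zero_iff] at h
    rw [CochainComplex.HomComplex.Cocycle.toSingleMk_mem_coboundaries_iff _ _ _ _ _ 1 (by simp)] at h
    obtain ⟨g, hg⟩ := h
    have hz : IsZero (P.cochainComplex.X 1) := CochainComplex.isZero_of_isStrictlyLE _ 0 _ (by simp)
    rw [hz.eq_of_src g 0, comp_zero, eq_comm] at hg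
    simpa using hg
  · rintro rfl; simp

lemma pi_zero_iff (K : CochainComplex (ModuleCat.{0} R) ℕ) (z : K.cycles n) (p : ℕ)
    (hp : (ComplexShape.up ℕ).prev n = p) :
    K.homologyπ n z = 0 ↔ ∃ y, K.d p n y = K.iCycles n z := by
  have hex := (ShortComplex.moduleCat_exact_iff _).1 (ShortComplex.exact_of_g_is_cokernel 
    (.mk (K.toCycles p n) (K.homologyπ n) (by simp)) (K.homologyIsCokernel p n hp))
  constructor
  · intro h
    obtain ⟨y, hy⟩ := hex z h
    refine ⟨y, ?_⟩
    rw [← hy, ← K.toCycles_i p n]; rfl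
  · rintro ⟨y, hy⟩
    have : K.toCycles p n y = z := by
      apply (ModuleCat.mono_iff_injective (K.iCycles n)).1 inferInstance
      rw [← hy, ← K.toCycles_i p n]; rfl
    rw [← this, ← ConcreteCategory.comp_apply, K.toCycles_comp_homologyπ]; rfl

lemma ExtRel.zero_iff {x : ((_root_.Ext R (ModuleCat R) n).obj (op X)).obj Y} {α : Abelian.Ext.{0} X Y n}
    (h : ExtRel P x α) : x = 0 ↔ α = 0 := by
  obtain ⟨f, hf, z, hx, hz, rfl⟩ := h
  have e : x = 0 ↔ (P.isoExt (R := R) n Y).hom x = 0 := by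
    constructor
    · rintro rfl; simp
    · intro h
      apply (ModuleCat.mono_iff_injective (P.isoExt (R := R) n Y).hom).1 inferInstance
      rw [h, map_zero]
  rw [e, hx]
  rcases n with _ | p
  · rw [pi_zero_iff _ z 0 (by simp), hz, extMk_eq_zero_iff0]
    rw [HomologicalComplex.shape _ 0 0 (by simp)]
    constructor
    · rintro ⟨y, hy⟩
      exact hy.symm
    · rintro rfl; exact ⟨0, rfl⟩
  · rw [pi_zero_iff _ z p (by simp), hz, P.extMk_eq_zero_iff f _ rfl hf p rfl]
    rfl

lemma ExtRel.map {X' : ModuleCat.{0} R} (P' : ProjectiveResolution X') (g : X' ⟶ X)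
   {x : ((_root_.Ext R (ModuleCat R) n).obj (op X)).obj Y} {α : Abelian.Ext.{0} X Y n}
    (h : ExtRel P x α) : ExtRel P' (((_root_.Ext R (ModuleCat R) n).map g.op).app Y x) 
      ((Abelian.Ext.mk₀ g).comp α (zero_add _)) := by
  obtain ⟨f, hf, z, hx, hz, rfl⟩ := h
  have comm : (ProjectiveResolution.lift g P' P).f 0 ≫ P.π.f 0 = P'.π.f 0 ≫ g := by
    have := congrArg (fun q => HomologicalComplex.Hom.f q 0) (ProjectiveResolution.lift_commutes g P' P)
    exact this
  let φ : ProjectiveResolution.Hom P' P g := ⟨ProjectiveResolution.lift g P' P, by simpa using comm⟩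
  rw [ProjectiveResolution.mk₀_comp_extMk f _ rfl hf φ]
  refine ⟨_, _, HomologicalComplex.cyclesMap (lyMap φ.hom Y) n z, ?_, ?_, rfl⟩
  · rw [← ConcreteCategory.comp_apply, isoExt_nat φ.hom comm, ConcreteCategory.comp_apply, hx,
      ← ConcreteCategory.comp_apply, HomologicalComplex.homologyπ_naturality]; rfl
  · rw [← ConcreteCategory.comp_apply, HomologicalComplex.cyclesMap_i, ConcreteCategory.comp_apply, hz]
    rfl

/-- The module `R / a ^ t`. -/
abbrev QM (a : Ideal R) (t : ℕ) : ModuleCat.{0} R := ModuleCat.of R (R ⧸ a ^ t)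

/-- The projection `R / a ^ s → R / a ^ t`. -/
def qproj (a : Ideal R) {t s : ℕ} (h : t ≤ s) : QM a s ⟶ QM a t :=
  ModuleCat.ofHom (Submodule.mapQ _ _ LinearMap.id (Ideal.pow_le_pow_right h))

/-- Elementwise vanishing of the colimit of `Ext^j (R / a ^ t, Y)`. -/
def Van (a : Ideal R) (Y : ModuleCat.{0} R) (j : ℕ) : Prop :=
  ∀ (t : ℕ) (α : Abelian.Ext.{0} (QM a t) Y j), ∃ (s : ℕ) (h : t ≤ s),
    (Abelian.Ext.mk₀ (qproj a h)).comp α (zero_add _) = 0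

open localCohomology in
lemma van_iff (a : Ideal R) (Y : ModuleCat.{0} R) (j : ℕ) :
    Van a Y j ↔ Subsingleton ((localCohomology a j).obj Y) := by
  let D := diagram (idealPowersDiagram a) j
  have hD : HasColimit D := inferInstance
  let D' := D ⋙ (evaluation _ _).obj Y
  let c : Cocone D' := ((evaluation (ModuleCat.{0} R) (ModuleCat.{0} R)).obj Y).mapCocone (colimit.cocone D)
  have hc : IsColimit c := isColimitOfPreserves _ (colimit.isColimit D)
  change _ ↔ Subsingleton c.pt
  let P : ∀ t : ℕ, ProjectiveResolution (QM a t) := fun t => ProjectiveResolution.of _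
  have key : Subsingleton c.pt ↔ ∀ (t : ℕ) (x : ((_root_.Ext R (ModuleCat R) j).obj (op (QM a t))).obj Y),
      ∃ (s : ℕ) (h : t ≤ s), ((_root_.Ext R (ModuleCat R) j).map (qproj a h).op).app Y x = 0 := by
    constructor
    · intro hs t x
      have h0 : c.ι.app (op (op t)) x = c.ι.app (op (op t)) (0 : ((_root_.Ext R (ModuleCat R) j).obj (op (QM a t))).obj Y) := 
        hs.elim _ _
      obtain ⟨k, f, g, h⟩ := (Concrete.isColimit_rep_eq_iff_exists D' hc (i := op (op t)) (j := op (op t)) x _).1 h0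
      refine ⟨k.unop.unop, leOfHom f.unop.unop, ?_⟩
      have e : f = (homOfLE (leOfHom f.unop.unop)).op.op := rfl
      refine Eq.trans (b := D'.map f x) rfl ?_
      rw [h]
      exact map_zero (D'.map g).hom
    · intro h
      refine subsingleton_of_forall_eq 0 fun y => ?_
      obtain ⟨k, x, rfl⟩ := Concrete.isColimit_exists_rep D' hc y
      obtain ⟨s, hs, hx⟩ := h k.unop.unop x
      let f : k ⟶ op (op s) := (homOfLE hs).op.op
      have := c.w f
      rw [← this, ConcreteCategory.comp_apply]
      have e : D'.map f x = 0 := hx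
      rw [e, map_zero]
  rw [key]
  constructor
  · intro h t x
    obtain ⟨α, hα⟩ := ExtRel.exists_right (P t) x
    obtain ⟨s, hs, h0⟩ := h t α
    exact ⟨s, hs, ((hα.map (P t) (P s) (qproj a hs)).zero_iff (P s)).2 h0⟩
  · intro h t α
    obtain ⟨x, hα⟩ := ExtRel.exists_left (P t) α
    obtain ⟨s, hs, h0⟩ := h t x
    exact ⟨s, hs, ((hα.map (P t) (P s) (qproj a hs)).zero_iff (P s)).1 h0⟩

end


section LES
variable {R : Type} [CommRing R]

lemma qproj_comp (a : Ideal R) {t s u : ℕ} (h : t ≤ s) (h' : s ≤ u) :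
    qproj a h' ≫ qproj a h = qproj a (h.trans h') := by
  refine ModuleCat.hom_ext (LinearMap.ext fun x => ?_)
  obtain ⟨x, rfl⟩ := Submodule.Quotient.mk_surjective _ x
  rfl

/-- If a class dies at level `s`, it can be killed in two steps. -/
lemma kill_trans (a : Ideal R) {Y : ModuleCat.{0} R} {j t s u : ℕ} (h : t ≤ s) (h' : s ≤ u)
    (α : Abelian.Ext.{0} (QM a t) Y j)
    (h0 : (Abelian.Ext.mk₀ (qproj a h')).comp
      ((Abelian.Ext.mk₀ (qproj a h)).comp α (zero_add _)) (zero_add _) = 0) :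
    (Abelian.Ext.mk₀ (qproj a (h.trans h'))).comp α (zero_add _) = 0 := by
  rw [← qproj_comp a h h', ← Abelian.Ext.mk₀_comp_mk₀_assoc]
  exact h0

open Abelian in
lemma van_two (a : Ideal R) {S : ShortComplex (ModuleCat.{0} R)} (hS : S.ShortExact) {j : ℕ}
    (h1 : Van a S.X₁ j) (h3 : Van a S.X₃ j) : Van a S.X₂ j := by
  intro t α
  obtain ⟨s, hs, h⟩ := h3 t (α.comp (Ext.mk₀ S.g) (add_zero _))
  rw [← Ext.comp_assoc_of_third_deg_zero] at h
  obtain ⟨β, hβ⟩ := Ext.covariant_sequence_exact₂ _ hS _ h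
  obtain ⟨u, hu, h'⟩ := h1 s β
  refine ⟨u, hs.trans hu, kill_trans a hs hu α ?_⟩
  rw [← hβ, ← Ext.comp_assoc_of_third_deg_zero, h', Ext.zero_comp]

open Abelian in
lemma van_three (a : Ideal R) {S : ShortComplex (ModuleCat.{0} R)} (hS : S.ShortExact) {j : ℕ}
    (h2 : Van a S.X₂ j) (h1 : Van a S.X₁ (j + 1)) : Van a S.X₃ j := by
  intro t α
  obtain ⟨s, hs, h⟩ := h1 t (α.comp hS.extClass rfl)
  rw [← Ext.comp_assoc _ _ _ (zero_add _) rfl (by omega)] at h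
  obtain ⟨β, hβ⟩ := Ext.covariant_sequence_exact₃ _ hS _ _ h
  obtain ⟨u, hu, h'⟩ := h2 s β
  refine ⟨u, hs.trans hu, kill_trans a hs hu α ?_⟩
  rw [← hβ, ← Ext.comp_assoc_of_third_deg_zero, h', Ext.zero_comp]

open Abelian in
lemma van_one (a : Ideal R) {S : ShortComplex (ModuleCat.{0} R)} (hS : S.ShortExact) {j : ℕ}
    (h3 : Van a S.X₃ j) (h2 : Van a S.X₂ (j + 1)) : Van a S.X₁ (j + 1) := by
  intro t α
  obtain ⟨s, hs, h⟩ := h2 t (α.comp (Ext.mk₀ S.f) (add_zero _))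
  rw [← Ext.comp_assoc_of_third_deg_zero] at h
  obtain ⟨β, hβ⟩ := Ext.covariant_sequence_exact₁ _ hS _ h rfl
  obtain ⟨u, hu, h'⟩ := h3 s β
  refine ⟨u, hs.trans hu, kill_trans a hs hu α ?_⟩
  rw [← hβ, ← Ext.comp_assoc _ _ _ (zero_add _) rfl (by omega), h', Ext.zero_comp]

/-- Unbundled version of `Van`. -/
abbrev VanM (a : Ideal R) (A : Type) [AddCommGroup A] [Module R A] (j : ℕ) : Prop :=
  Van a (ModuleCat.of R A) j

variable {A B C : Type} [AddCommGroup A] [AddCommGroup B] [AddCommGroup C]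
  [Module R A] [Module R B] [Module R C]

lemma ses {f : A →ₗ[R] B} {g : B →ₗ[R] C} (hf : Function.Injective f)
    (hg : Function.Surjective g) (h : Function.Exact f g) :
    (ShortComplex.mk (ModuleCat.ofHom f) (ModuleCat.ofHom g)
      (by ext x; exact h.apply_apply_eq_zero x)).ShortExact :=
  ModuleCat.shortComplex_shortExact _ h hf hg

lemma vanM_two (a : Ideal R) {f : A →ₗ[R] B} {g : B →ₗ[R] C} (hf : Function.Injective f)
    (hg : Function.Surjective g) (h : Function.Exact f g) {j : ℕ}
    (h1 : VanM a A j) (h3 : VanM a C j) : VanM a B j :=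
  van_two a (ses hf hg h) h1 h3

lemma vanM_three (a : Ideal R) {f : A →ₗ[R] B} {g : B →ₗ[R] C} (hf : Function.Injective f)
    (hg : Function.Surjective g) (h : Function.Exact f g) {j : ℕ}
    (h2 : VanM a B j) (h1 : VanM a A (j + 1)) : VanM a C j :=
  van_three a (ses hf hg h) h2 h1

lemma vanM_one (a : Ideal R) {f : A →ₗ[R] B} {g : B →ₗ[R] C} (hf : Function.Injective f)
    (hg : Function.Surjective g) (h : Function.Exact f g) {j : ℕ}
    (h3 : VanM a C j) (h2 : VanM a B (j + 1)) : VanM a A (j + 1) :=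
  van_one a (ses hf hg h) h3 h2

lemma vanM_subsingleton (a : Ideal R) [Subsingleton A] (j : ℕ) : VanM a A j := by
  intro t α
  refine ⟨t, le_rfl, ?_⟩
  have : α = 0 := by
    rw [← Abelian.Ext.comp_mk₀_id α]
    have : 𝟙 (ModuleCat.of R A) = 0 := by
      ext x; exact Subsingleton.elim _ _
    rw [this, Abelian.Ext.mk₀_zero, Abelian.Ext.comp_zero]
  rw [this, Abelian.Ext.comp_zero]

lemma vanM_congr (a : Ideal R) (e : A ≃ₗ[R] B) {j : ℕ} (h : VanM a A j) : VanM a B j := by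
  refine vanM_two a (f := e.toLinearMap) (g := (0 : B →ₗ[R] PUnit.{1})) e.injective
    (fun x => ⟨0, Subsingleton.elim _ _⟩) ?_ h (vanM_subsingleton a j)
  intro y
  exact ⟨fun _ => ⟨e.symm y, by simp⟩, fun _ => rfl⟩

lemma vanM_injective (a : Ideal R) [Module.Injective R A] (j : ℕ) : VanM a A (j + 1) := by
  intro t α
  have : CategoryTheory.Injective (ModuleCat.of R A) :=
    Module.injective_object_of_injective_module R A
  refine ⟨t, le_rfl, ?_⟩
  rw [Abelian.Ext.eq_zero_of_injective α, Abelian.Ext.comp_zero]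

open Abelian in
lemma vanM_unit (a : Ideal R) (x : R) (hx : x ∈ a)
    (hb : Function.Bijective (fun y : A => x • y)) (j : ℕ) : VanM a A j := by
  intro t α
  refine ⟨t, le_rfl, ?_⟩
  suffices α = 0 by rw [this, Abelian.Ext.comp_zero]
  have h0 : (x ^ t) • α = 0 := by
    rw [← Ext.mk₀_id_comp α, ← Ext.smul_comp, ← Ext.mk₀_smul]
    have : (x ^ t) • 𝟙 (QM a t) = 0 := by
      refine ModuleCat.hom_ext (LinearMap.ext fun y => ?_)
      obtain ⟨y, rfl⟩ := Submodule.Quotient.mk_surjective _ y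
      change (x ^ t) • (Submodule.Quotient.mk y : R ⧸ a ^ t) = 0
      rw [← Submodule.Quotient.mk_smul, Submodule.Quotient.mk_eq_zero]
      exact Ideal.mul_mem_right _ _ (Ideal.pow_mem_pow hx t)
    rw [this, Ext.mk₀_zero, Ext.zero_comp]
  have hbt : Function.Bijective (fun y : A => (x ^ t) • y) := by
    have : (fun y : A => (x ^ t) • y) = (fun y : A => x • y)^[t] := by
      ext y; simp [smul_iterate]
    rw [this]; exact hb.iterate t
  let e : A ≃ₗ[R] A := LinearEquiv.ofBijective (LinearMap.lsmul R A (x ^ t)) hbt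
  have he : (x ^ t) • 𝟙 (ModuleCat.of R A) ≫ ModuleCat.ofHom e.symm.toLinearMap = 𝟙 _ := by
    ext y
    exact e.apply_symm_apply y
  have h1 : α.comp (Ext.mk₀ ((x ^ t) • 𝟙 (ModuleCat.of R A) ≫ ModuleCat.ofHom e.symm.toLinearMap))
      (add_zero _) = 0 := by
    rw [Ext.mk₀_smul, Ext.comp_smul, ← Ext.smul_comp, h0, Ext.zero_comp]
  rwa [he, Ext.comp_mk₀_id] at h1

end LES


section Tors
variable {R : Type} [CommRing R]

/-- `A` is `a`-power torsion. -/
def Tors (a : Ideal R) (A : Type) [AddCommGroup A] [Module R A] : Prop :=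
  ∀ y : A, ∃ n : ℕ, ∀ r ∈ a ^ n, r • y = 0

variable {A B : Type} [AddCommGroup A] [AddCommGroup B] [Module R A] [Module R B]

lemma Tors.of_injective {a : Ideal R} (h : Tors a B) (f : A →ₗ[R] B)
    (hf : Function.Injective f) : Tors a A := fun y => by
  obtain ⟨n, hn⟩ := h (f y)
  exact ⟨n, fun r hr => hf (by rw [map_smul, hn r hr, map_zero])⟩

lemma Tors.of_surjective {a : Ideal R} (h : Tors a A) (f : A →ₗ[R] B)
    (hf : Function.Surjective f) : Tors a B := fun y => by
  obtain ⟨y, rfl⟩ := hf y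
  obtain ⟨n, hn⟩ := h y
  exact ⟨n, fun r hr => by rw [← map_smul, hn r hr, map_zero]⟩

lemma Tors.sup {a b : Ideal R} (h : Tors a A) (h' : Tors b A) : Tors (a ⊔ b) A := fun y => by
  obtain ⟨n, hn⟩ := h y
  obtain ⟨m, hm⟩ := h' y
  refine ⟨n + m, fun r hr => ?_⟩
  obtain ⟨u, hu, v, hv, rfl⟩ := Submodule.mem_sup.1 (Ideal.sup_pow_add_le_pow_sup_pow hr)
  rw [add_smul, hn u hu, hm v hv, add_zero]

lemma Tors.unif {a : Ideal R} [Module.Finite R A] (h : Tors a A) :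
    ∃ k : ℕ, ∀ r ∈ a ^ k, ∀ y : A, r • y = 0 := by
  obtain ⟨S, hS⟩ := Module.Finite.fg_top (R := R) (M := A)
  choose n hn using h
  refine ⟨S.sup n, fun r hr y => ?_⟩
  have : Submodule.span R (S : Set A) ≤ LinearMap.ker (LinearMap.lsmul R A r) := by
    rw [Submodule.span_le]
    intro z hz
    exact hn z r (Ideal.pow_le_pow_right (Finset.le_sup hz) hr)
  rw [hS] at this
  exact this (Submodule.mem_top : y ∈ ⊤)

/-- The `a`-power torsion submodule. -/
def gam (a : Ideal R) (A : Type) [AddCommGroup A] [Module R A] : Submodule R A where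
  carrier := {y | ∃ n : ℕ, ∀ r ∈ a ^ n, r • y = 0}
  zero_mem' := ⟨0, fun r _ => smul_zero r⟩
  add_mem' := by
    rintro x y ⟨n, hn⟩ ⟨m, hm⟩
    refine ⟨max n m, fun r hr => ?_⟩
    rw [smul_add, hn r (Ideal.pow_le_pow_right (le_max_left _ _) hr),
      hm r (Ideal.pow_le_pow_right (le_max_right _ _) hr), add_zero]
  smul_mem' := by
    rintro c x ⟨n, hn⟩
    exact ⟨n, fun r hr => by rw [smul_comm, hn r hr, smul_zero]⟩

lemma gam_tors (a : Ideal R) : Tors a (gam a A) := by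
  rintro ⟨y, n, hn⟩
  exact ⟨n, fun r hr => Subtype.ext (hn r hr)⟩

lemma gam_injective [IsNoetherianRing R] (a : Ideal R) [Module.Injective R A] :
    Module.Injective R (gam a A) := by
  refine Module.Baer.injective fun J φ => ?_
  have ht : Tors a (LinearMap.range φ) :=
    (gam_tors (A := A) a).of_injective (LinearMap.range φ).subtype Subtype.val_injective
  obtain ⟨m, hm⟩ := ht.unif
  obtain ⟨k, hk⟩ := Ideal.exists_pow_inf_eq_pow_smul a (J : Submodule R R)
  have hz : ∀ x (hx : x ∈ J), x ∈ a ^ (k + m) → φ ⟨x, hx⟩ = 0 := by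
    intro x hx hxa
    have h1 : x ∈ (a ^ (k + m) • ⊤ ⊓ J : Submodule R R) := by
      refine ⟨?_, hx⟩
      simpa using hxa
    rw [hk (k + m) (by omega), Nat.add_sub_cancel_left] at h1
    have : ∃ hx : x ∈ J, φ ⟨x, hx⟩ = 0 := by
      refine Submodule.smul_induction_on h1 ?_ ?_
      · rintro r hr n ⟨-, hn⟩
        refine ⟨J.mul_mem_left r hn, ?_⟩
        have h2 := hm r hr ⟨φ ⟨n, hn⟩, ⟨n, hn⟩, rfl⟩
        have h3 : r • φ ⟨n, hn⟩ = 0 := congrArg Subtype.val h2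
        rw [← map_smul] at h3
        exact h3
      · rintro u v ⟨hu, hu'⟩ ⟨hv, hv'⟩
        refine ⟨J.add_mem hu hv, ?_⟩
        have : (⟨u + v, J.add_mem hu hv⟩ : J) = ⟨u, hu⟩ + ⟨v, hv⟩ := rfl
        rw [this, map_add, hu', hv', add_zero]
    exact this.2
  let K : Submodule R J := Submodule.comap J.subtype (a ^ (k + m))
  let f : (J ⧸ K) →ₗ[R] (R ⧸ a ^ (k + m)) := Submodule.mapQ K (a ^ (k + m)) J.subtype le_rfl
  have hf : Function.Injective f := by
    rw [← LinearMap.ker_eq_bot, Submodule.ker_mapQ]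
    exact Submodule.mkQ_map_self _
  let g : (J ⧸ K) →ₗ[R] A := K.liftQ ((gam a A).subtype ∘ₗ φ) (by
    rintro ⟨x, hx⟩ hx'
    simp [hz x hx hx'])
  obtain ⟨h, hh⟩ := Module.Injective.out f hf g
  let h' : R →ₗ[R] A := h ∘ₗ Submodule.mkQ (a ^ (k + m))
  refine ⟨h'.codRestrict (gam a A) fun r => ⟨k + m, fun u hu => ?_⟩, fun x hx => ?_⟩
  · rw [← map_smul]
    have : u • r ∈ a ^ (k + m) := Ideal.mul_mem_right _ _ hu
    change h (Submodule.Quotient.mk (u • r)) = 0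
    rw [(Submodule.Quotient.mk_eq_zero _).2 this, map_zero]
  · exact Subtype.ext (hh (Submodule.Quotient.mk ⟨x, hx⟩))

open Abelian in
lemma vanM_tors_one (a : Ideal R) {A B C : Type} [AddCommGroup A] [AddCommGroup B]
    [AddCommGroup C] [Module R A] [Module R B] [Module R C] {f : A →ₗ[R] B} {g : B →ₗ[R] C}
    (hf : Function.Injective f) (hg : Function.Surjective g) (h : Function.Exact f g)
    [Module.Injective R B] (hB : Tors a B) : VanM a A 1 := by
  have hS := ses hf hg h
  have : CategoryTheory.Injective (ModuleCat.of R B) :=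
    Module.injective_object_of_injective_module R B
  intro t α
  obtain ⟨x, hx⟩ := Ext.covariant_sequence_exact₁ _ hS α
    (Ext.eq_zero_of_injective (I := ModuleCat.of R B) _) (zero_add 1)
  obtain ⟨q, rfl⟩ := Ext.mk₀_bijective _ _ |>.2 x
  obtain ⟨e, he⟩ := hg (q.hom (Submodule.Quotient.mk 1))
  obtain ⟨n, hn⟩ := hB e
  let e' : QM a (max t n) ⟶ ModuleCat.of R B := ModuleCat.ofHom
    (Submodule.liftQ (a ^ max t n) (LinearMap.toSpanSingleton R B e) fun r hr =>
      hn r (Ideal.pow_le_pow_right (le_max_right _ _) hr))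
  refine ⟨max t n, le_max_left _ _, ?_⟩
  have hc : qproj a (le_max_left t n) ≫ q = e' ≫ ModuleCat.ofHom g := by
    refine ModuleCat.hom_ext (LinearMap.ext fun y => ?_)
    obtain ⟨y, rfl⟩ := Submodule.Quotient.mk_surjective _ y
    change q.hom (Submodule.Quotient.mk y) = g (y • e)
    rw [map_smul, he, ← map_smul, ← Submodule.Quotient.mk_smul, smul_eq_mul, mul_one]
  rw [← hx, Ext.mk₀_comp_mk₀_assoc, hc, ← Ext.mk₀_comp_mk₀_assoc]
  have := hS.comp_extClass
  dsimp at this ⊢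
  rw [this, Ext.comp_zero]

lemma vanM_tors [IsNoetherianRing R] (a : Ideal R) (j : ℕ) :
    ∀ (A : Type) [AddCommGroup A] [Module R A], Tors a A → VanM a A (j + 1) := by
  induction j with
  | zero =>
    intro A _ _ hA
    let I := Injective.under (ModuleCat.of R A)
    let ι := Injective.ι (ModuleCat.of R A)
    have hι : Function.Injective ι.hom := (ModuleCat.mono_iff_injective ι).1 inferInstance
    have : Module.Injective R I :=
      have : CategoryTheory.Injective (ModuleCat.of R I) :=
        (inferInstance : CategoryTheory.Injective (Injective.under (ModuleCat.of R A)))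
      Module.injective_module_of_injective_object R I
    have := gam_injective (A := I) a
    let f : A →ₗ[R] gam a I := ι.hom.codRestrict _ fun y => by
      obtain ⟨n, hn⟩ := hA y
      exact ⟨n, fun r hr => by
        have : r • ι.hom y = ι.hom (r • y) := (map_smul _ _ _).symm
        rw [this, hn r hr]; exact map_zero _⟩
    exact vanM_tors_one a (f := f) (g := (LinearMap.range f).mkQ)
      (fun x y h => hι (congrArg Subtype.val h)) (Submodule.mkQ_surjective _)
      (LinearMap.exact_map_mkQ_range f) (gam_tors a)
  | succ j ih =>
    intro A _ _ hA
    let I := Injective.under (ModuleCat.of R A)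
    let ι := Injective.ι (ModuleCat.of R A)
    have hι : Function.Injective ι.hom := (ModuleCat.mono_iff_injective ι).1 inferInstance
    have : Module.Injective R I :=
      have : CategoryTheory.Injective (ModuleCat.of R I) :=
        (inferInstance : CategoryTheory.Injective (Injective.under (ModuleCat.of R A)))
      Module.injective_module_of_injective_object R I
    have := gam_injective (A := I) a
    let f : A →ₗ[R] gam a I := ι.hom.codRestrict _ fun y => by
      obtain ⟨n, hn⟩ := hA y
      exact ⟨n, fun r hr => by
        have : r • ι.hom y = ι.hom (r • y) := (map_smul _ _ _).symm
        rw [this, hn r hr]; exact map_zero _⟩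
    exact vanM_one a (f := f) (g := (LinearMap.range f).mkQ)
      (fun x y h => hι (congrArg Subtype.val h)) (Submodule.mkQ_surjective _)
      (LinearMap.exact_map_mkQ_range f)
      (ih _ ((gam_tors a).of_surjective _ (Submodule.mkQ_surjective _))) (vanM_injective a _)

lemma tors_span_of {x : R} (h : ∀ y : A, ∃ n : ℕ, x ^ n • y = 0) : Tors (Ideal.span {x}) A := by
  intro y
  obtain ⟨n, hn⟩ := h y
  refine ⟨n, fun r hr => ?_⟩
  rw [Ideal.span_singleton_pow, Ideal.mem_span_singleton'] at hr
  obtain ⟨c, rfl⟩ := hr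
  rw [mul_smul, hn, smul_zero]

lemma vanM_bound [IsNoetherianRing R] (a : Ideal R) (l : List R) :
    ∀ (c : Ideal R) (_ : a = Ideal.ofList l ⊔ c) (A : Type) [AddCommGroup A] [Module R A],
      Tors c A → ∀ j, l.length < j → VanM a A j := by
  induction l with
  | nil =>
    intro c hc A _ _ hA j hj
    obtain ⟨j, rfl⟩ := Nat.exists_eq_succ_of_ne_zero (Nat.pos_iff_ne_zero.1 hj)
    simp only [Ideal.ofList_nil, bot_sup_eq] at hc
    exact vanM_tors a j A (hc ▸ hA)
  | cons x l ih =>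
    intro c hc A _ _ hA j hj
    rw [List.length_cons] at hj
    obtain ⟨j, rfl⟩ := Nat.exists_eq_succ_of_ne_zero (by omega : j ≠ 0)
    have hc' : a = Ideal.ofList l ⊔ (Ideal.span {x} ⊔ c) := by
      rw [hc, Ideal.ofList_cons, ← sup_assoc, sup_comm (Ideal.ofList l)]
    have hxa : x ∈ a := by
      rw [hc']
      exact Ideal.mem_sup_right (Ideal.mem_sup_left (Ideal.mem_span_singleton_self x))
    let L := LocalizedModule (Submonoid.powers x) A
    let f : A →ₗ[R] L := LocalizedModule.mkLinearMap _ _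
    have hL : VanM a L (j + 1) := by
      refine vanM_unit a x hxa ?_ _
      exact (Module.End.isUnit_iff _).1
        (IsLocalizedModule.map_units f ⟨x, Submonoid.mem_powers x⟩)
    have hLc : Tors c L := by
      intro y
      obtain ⟨⟨y, s⟩, rfl⟩ := IsLocalizedModule.mk'_surjective (Submonoid.powers x) f y
      obtain ⟨n, hn⟩ := hA y
      refine ⟨n, fun r hr => ?_⟩
      change r • IsLocalizedModule.mk' f y s = 0
      rw [← IsLocalizedModule.mk'_smul, hn r hr, IsLocalizedModule.mk'_zero]
    have hK : VanM a (LinearMap.ker f) (j + 1) := by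
      refine ih _ hc' _ (Tors.sup (tors_span_of ?_) (hA.of_injective (LinearMap.ker f).subtype
          Subtype.val_injective)) _
        (by omega)
      rintro ⟨y, hy⟩
      obtain ⟨⟨_, n, rfl⟩, hs⟩ := (IsLocalizedModule.eq_zero_iff (Submonoid.powers x) f).1 hy
      exact ⟨n, Subtype.ext hs⟩
    have hC : VanM a (L ⧸ LinearMap.range f) j := by
      refine ih _ hc' _ (Tors.sup (tors_span_of ?_)
        (hLc.of_surjective _ (Submodule.mkQ_surjective _))) _ (by omega)
      intro y
      obtain ⟨y, rfl⟩ := Submodule.Quotient.mk_surjective _ y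
      obtain ⟨⟨y, s⟩, rfl⟩ := IsLocalizedModule.mk'_surjective (Submonoid.powers x) f y
      obtain ⟨_, n, rfl⟩ := s
      refine ⟨n, ?_⟩
      rw [← Submodule.Quotient.mk_smul, Submodule.Quotient.mk_eq_zero]
      exact ⟨y, (IsLocalizedModule.mk'_cancel' f y
        (⟨x ^ n, n, rfl⟩ : Submonoid.powers x)).symm⟩
    have hI : VanM a (LinearMap.range f) (j + 1) :=
      vanM_one a (f := (LinearMap.range f).subtype) (g := (LinearMap.range f).mkQ)
        Subtype.val_injective (Submodule.mkQ_surjective _)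
        (LinearMap.exact_subtype_mkQ _) hC hL
    refine vanM_two a (f := (LinearMap.ker f).subtype) (g := f.rangeRestrict)
      Subtype.val_injective f.surjective_rangeRestrict ?_ hK hI
    intro y
    rw [← LinearMap.mem_ker, LinearMap.ker_rangeRestrict]
    simp

lemma exists_bound [IsNoetherianRing R] (a : Ideal R) :
    ∃ n : ℕ, ∀ (A : Type) [AddCommGroup A] [Module R A] (j : ℕ), n < j → VanM a A j := by
  obtain ⟨S, hS⟩ := (isNoetherianRing_iff_ideal_fg R).1 inferInstance a
  refine ⟨S.toList.length, fun A _ _ j hj => vanM_bound a S.toList ⊥ ?_ A ?_ j hj⟩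
  · rw [sup_bot_eq, Ideal.ofList]
    simp [← hS]
  · intro y
    refine ⟨1, fun r hr => ?_⟩
    rw [pow_one] at hr
    rw [(Submodule.mem_bot R).1 hr, zero_smul]

end Tors


section Main
variable {R : Type} [CommRing R] [IsNoetherianRing R]

open TensorProduct in
lemma exists_map {M : Type} [AddCommGroup M] [Module R M] [Module.Finite R M]
    (p : PrimeSpectrum R) (hp : p ∈ Module.support R M) :
    ∃ f : M →ₗ[R] (R ⧸ p.asIdeal), f ≠ 0 := by
  let κ := p.asIdeal.ResidueField
  have hn : Nontrivial (κ ⊗[R] M) :=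
    (Module.mem_support_iff_nontrivial_residueField_tensorProduct p).1 hp
  obtain ⟨v, hv⟩ := exists_ne (0 : κ ⊗[R] M)
  obtain ⟨l, hl⟩ : ∃ l : Module.Dual κ (κ ⊗[R] M), l v ≠ 0 := by
    by_contra! h
    exact hv ((Module.forall_dual_apply_eq_zero_iff κ v).1 h)
  let g : M →ₗ[R] κ := l.restrictScalars R ∘ₗ TensorProduct.mk R κ M 1
  have hg : ∃ m, g m ≠ 0 := by
    by_contra! h
    apply hl
    induction v with
    | zero => simp
    | tmul c m =>
      have : c ⊗ₜ[R] m = c • ((1 : κ) ⊗ₜ[R] m) := by simp [TensorProduct.smul_tmul']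
      rw [this, map_smul]
      have : l (1 ⊗ₜ[R] m) = 0 := h m
      rw [this, smul_zero]
    | add u w hu hw =>
      have h1 : ∀ z : κ ⊗[R] M, l z = 0 := by
        intro z
        induction z with
        | zero => simp
        | tmul c m =>
          have : c ⊗ₜ[R] m = c • ((1 : κ) ⊗ₜ[R] m) := by simp [TensorProduct.smul_tmul']
          rw [this, map_smul]
          have : l (1 ⊗ₜ[R] m) = 0 := h m
          rw [this, smul_zero]
        | add u w hu hw => rw [map_add, hu, hw, add_zero]
      exact h1 _
  obtain ⟨S, hS⟩ := Module.Finite.fg_top (R := R) (M := M)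
  classical
  obtain ⟨b, hb⟩ := IsLocalization.exist_integer_multiples_of_finset
    (nonZeroDivisors (R ⧸ p.asIdeal)) (S.image g)
  obtain ⟨r, hr⟩ := Ideal.Quotient.mk_surjective b.1
  let i : (R ⧸ p.asIdeal) →ₗ[R] κ := (Algebra.linearMap (R ⧸ p.asIdeal) κ).restrictScalars R
  have hi : Function.Injective i := IsFractionRing.injective (R ⧸ p.asIdeal) κ
  have hrs : ∀ y : κ, r • y = b.1 • y := by
    intro y
    rw [← hr, Algebra.smul_def, Algebra.smul_def]
    rfl
  have hrange : ∀ m, (r • g) m ∈ LinearMap.range i := by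
    have : Submodule.span R (S : Set M) ≤ (LinearMap.range i).comap (r • g) := by
      rw [Submodule.span_le]
      intro z hz
      obtain ⟨y, hy⟩ := hb (g z) (Finset.mem_image_of_mem g hz)
      refine ⟨y, ?_⟩
      rw [LinearMap.smul_apply, hrs]
      exact hy
    intro m
    rw [hS] at this
    exact this (Submodule.mem_top : m ∈ ⊤)
  let e := LinearEquiv.ofInjective i hi
  refine ⟨e.symm.toLinearMap ∘ₗ (r • g).codRestrict _ hrange, fun h0 => ?_⟩
  obtain ⟨m, hm⟩ := hg
  have h1 := LinearMap.congr_fun h0 m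
  have h2 : (r • g).codRestrict _ hrange m = 0 := e.symm.injective (by simpa using h1)
  have h3 : r • g m = 0 := congrArg Subtype.val h2
  rw [hrs, Algebra.smul_def] at h3
  rcases mul_eq_zero.1 h3 with h | h
  · exact nonZeroDivisors.ne_zero b.2 (hi (h.trans (map_zero i).symm))
  · exact hm h

lemma filt (a : Ideal R) (j : ℕ) (T : Set (PrimeSpectrum R))
    (h : ∀ p ∈ T, VanM a (R ⧸ p.asIdeal) j) (L : Type) [AddCommGroup L] [Module R L]
    [hL : Module.Finite R L] : Module.support R L ⊆ T → VanM a L j := by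
  refine IsNoetherianRing.induction_on_isQuotientEquivQuotientPrime R hL
    (motive := fun N _ _ _ => Module.support R N ⊆ T → VanM a N j) ?_ ?_ ?_
  · intro N _ _ _ _ _
    exact vanM_subsingleton a j
  · intro N _ _ _ p e hN
    refine vanM_congr a e.symm (h p (hN ?_))
    rw [e.support_eq, Module.mem_support_iff_of_finite, Ideal.annihilator_quotient]
  · intro N₁ _ _ _ N₂ _ _ _ N₃ _ _ _ f g hf hg hfg h1 h3 hN
    exact vanM_two a hf hg hfg (h1 ((Module.support_subset_of_injective f hf).trans hN))
      (h3 ((Module.support_subset_of_surjective g hg).trans hN))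

lemma main_step (a : Ideal R) (M : Type) [AddCommGroup M] [Module R M] [Module.Finite R M]
    (j : ℕ) (hM : VanM a M j)
    (hnext : ∀ (L : Type) [AddCommGroup L] [Module R L] [Module.Finite R L],
      Module.support R L ⊆ Module.support R M → VanM a L (j + 1))
    (L : Type) [AddCommGroup L] [Module R L] [Module.Finite R L]
    (hL : Module.support R L ⊆ Module.support R M) : VanM a L j := by
  refine filt a j _ ?_ L hL
  intro p
  have : WellFoundedGT (PrimeSpectrum R) :=
    StrictMono.wellFoundedGT (f := fun p : PrimeSpectrum R => p.asIdeal) fun _ _ h => h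
  induction p using WellFoundedGT.induction with
  | ind p ih =>
  intro hp
  obtain ⟨f, hf⟩ := exists_map p hp
  have hI : VanM a (LinearMap.range f) j := by
    refine vanM_three a (f := (LinearMap.ker f).subtype) (g := f.rangeRestrict)
      Subtype.val_injective f.surjective_rangeRestrict ?_ hM (hnext _ ?_)
    · intro y
      rw [← LinearMap.mem_ker, LinearMap.ker_rangeRestrict]
      simp
    · exact Module.support_subset_of_injective _ (LinearMap.ker f).injective_subtype
  refine vanM_two a (f := (LinearMap.range f).subtype) (g := (LinearMap.range f).mkQ)
    Subtype.val_injective (Submodule.mkQ_surjective _) (LinearMap.exact_subtype_mkQ _) hI ?_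
  refine filt a j {q | p < q} (fun q hq => ih q hq (Module.mem_support_mono (le_of_lt hq) hp)) _ ?_
  intro q hq
  have h1 : p ≤ q := by
    have := Module.support_subset_of_surjective _ (Submodule.mkQ_surjective (LinearMap.range f)) hq
    rwa [Module.mem_support_iff_of_finite, Ideal.annihilator_quotient] at this
  refine lt_of_le_of_ne h1 ?_
  rintro rfl
  revert hq
  rw [imp_false, Module.notMem_support_iff']
  obtain ⟨m, hm⟩ : ∃ m, f m ≠ 0 := by
    by_contra! h
    exact hf (LinearMap.ext h)
  obtain ⟨r, hr⟩ := Ideal.Quotient.mk_surjective (f m)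
  intro y
  obtain ⟨y, rfl⟩ := Submodule.Quotient.mk_surjective _ y
  obtain ⟨s, rfl⟩ := Ideal.Quotient.mk_surjective y
  refine ⟨r, fun h => hm (by rw [← hr, Ideal.Quotient.eq_zero_iff_mem]; exact h), ?_⟩
  rw [← Submodule.Quotient.mk_smul, Submodule.Quotient.mk_eq_zero]
  refine ⟨s • m, ?_⟩
  rw [map_smul, ← hr, Algebra.smul_def, Algebra.smul_def]
  exact mul_comm _ _

lemma main_van (a : Ideal R) (M : Type) [AddCommGroup M] [Module R M] [Module.Finite R M]
    (i : ℕ) (hM : ∀ j, i ≤ j → VanM a M j)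
    (L : Type) [AddCommGroup L] [Module R L] [Module.Finite R L]
    (hL : Module.support R L ⊆ Module.support R M) : VanM a L i := by
  obtain ⟨n, hn⟩ := exists_bound a
  have key : ∀ k j : ℕ, i ≤ j → n < j + k →
      ∀ (L : Type) [AddCommGroup L] [Module R L] [Module.Finite R L],
      Module.support R L ⊆ Module.support R M → VanM a L j := by
    intro k
    induction k with
    | zero =>
      intro j _ hj L _ _ _ _
      exact hn L j hj
    | succ k ih =>
      intro j hij hj
      exact main_step a M j (hM j hij) (ih (j + 1) (by omega) (by omega))
  exact key (n + 1) i le_rfl (by omega) L hL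

end Main

end Aux

theorem stmt3 {R : Type} [CommRing R] [IsNoetherianRing R]
    (a : Ideal R) (M N : ModuleCat R) [Module.Finite R M] [Module.Finite R N]
    (hM : Nontrivial M) (hN : Nontrivial N)
    (hsupp : Module.support R N ⊆ Module.support R M) :
    ∀ i : ℕ, Nontrivial ((localCohomology a i).obj N) →
      ∃ j : ℕ, i ≤ j ∧ Nontrivial ((localCohomology a j).obj M) := by
  intro i hi
  by_contra! h
  have hN' : Van a N i := main_van a M i (fun j hj => (van_iff a M j).2 (h j hj)) N hsupp
  exact not_subsingleton_iff_nontrivial.2 hi ((van_iff a N i).1 hN')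
end
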